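/- For all q ∈ (0,1) and C' ≥ 1, there is a constant C ≥ 1 such that the following holds for all 1 ≤ k ≤ n. Let w be a fixed (deterministic) binary string of length at most C'·log k, and let x ∈ {0,1}^n be formed by appending n − |w| uniformly random bits to w. Then there is a reconstruction function taking T := exp(C·(log k)^{1/3}) traces such that with probability at least 1 − 1/k over the choice of x and T independent traces of x through the deletion channel with deletion probability q, the function correctly outputs the first k bits of x. -/

import Mathlib

open scoped BigOperators

/-- Weight of a Bernoulli(p) retention pattern: each bit kept (`true`) w.p. `p`. -/
noncomputable def bern (p : ℝ) {n : ℕ} (r : Fin n → Bool) : ℝ :=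
  ∏ i, if r i then p else 1 - p

/-- Weight of a single uniformly random `n`-bit string. -/
noncomputable def unif (n : ℕ) : ℝ := (1 / 2 : ℝ) ^ n

/-- Probability of an event `E` in a finite outcome space with weight `w`. -/
noncomputable def prob {Ω : Type*} [Fintype Ω] (w : Ω → ℝ) (E : Set Ω) : ℝ :=
  ∑ ω, E.indicator w ω

/-- Extend a retention pattern on `Fin n` to all of `ℕ` (bits beyond `n` deleted). -/
def keep {n : ℕ} (r : Fin n → Bool) : ℕ → Bool := fun i => if h : i < n then r ⟨i, h⟩ else false

/-- The trace of the string `x` through the deletion channel with retention pattern `r`: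
the subsequence of retained bits. -/
def traceL (x : List Bool) (r : ℕ → Bool) : List Bool :=
  ((List.range x.length).filter r).map fun i => x.getD i false

open Classical in
noncomputable def ind (P : Prop) : ℝ := if P then 1 else 0

lemma ind_nonneg (P : Prop) : 0 ≤ ind P := by unfold ind; split <;> norm_num
lemma ind_le_one (P : Prop) : ind P ≤ 1 := by unfold ind; split <;> norm_num
lemma ind_true {P : Prop} (h : P) : ind P = 1 := by unfold ind; simp [h]
lemma ind_false {P : Prop} (h : ¬ P) : ind P = 0 := by unfold ind; simp [h]
lemma ind_mono {P Q : Prop} (h : P → Q) : ind P ≤ ind Q := by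
  by_cases hp : P
  · rw [ind_true hp, ind_true (h hp)]
  · rw [ind_false hp]; exact ind_nonneg _
lemma ind_or (P Q : Prop) : ind (P ∨ Q) ≤ ind P + ind Q := by
  by_cases hp : P
  · rw [ind_true hp, ind_true (Or.inl hp)]; linarith [ind_nonneg Q]
  · by_cases hq : Q
    · rw [ind_true hq, ind_true (Or.inr hq)]; linarith [ind_nonneg P]
    · rw [ind_false (by tauto)]; linarith [ind_nonneg P, ind_nonneg Q]
lemma ind_imp_or {P Q R : Prop} (h : P → Q ∨ R) : ind P ≤ ind Q + ind R :=
  (ind_mono h).trans (ind_or Q R)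
lemma ind_not (P : Prop) : ind (¬ P) = 1 - ind P := by
  by_cases hp : P
  · rw [ind_true hp, ind_false (by tauto)]; ring
  · rw [ind_false hp, ind_true hp]; ring
lemma ind_markov (f t : ℝ) (hf : 0 ≤ f) (ht : 0 < t) : ind (t < f) ≤ f / t := by
  by_cases h : t < f
  · rw [ind_true h, le_div_iff₀ ht]; linarith
  · rw [ind_false h]; positivity

/-- Expectation over the trace of a list. -/
noncomputable def Etr {V : Type} [AddCommGroup V] [Module ℝ V] (p : ℝ) :
    List Bool → (List Bool → V) → V
  | [], g => g []
  | b :: x, g => p • Etr p x (fun y => g (b :: y)) + (1 - p) • Etr p x g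

/-- Expectation over a uniform list of given length. -/
noncomputable def Eun : ℕ → (List Bool → ℝ) → ℝ
  | 0, g => g []
  | m + 1, g => (Eun m (fun y => g (true :: y)) + Eun m (fun y => g (false :: y))) / 2

section
variable {V : Type} [AddCommGroup V] [Module ℝ V] {p : ℝ}

lemma Etr_append (x x' : List Bool) (g : List Bool → V) :
    Etr p (x ++ x') g = Etr p x (fun a => Etr p x' (fun b => g (a ++ b))) := by
  induction x generalizing g with
  | nil => simp [Etr]
  | cons b x ih => simp [Etr, ih]

lemma Etr_add (x : List Bool) (g h : List Bool → V) :
    Etr p x (fun y => g y + h y) = Etr p x g + Etr p x h := by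
  induction x generalizing g h with
  | nil => simp [Etr]
  | cons b x ih => simp only [Etr, ih, smul_add]; abel

lemma Etr_sub (x : List Bool) (g h : List Bool → V) :
    Etr p x (fun y => g y - h y) = Etr p x g - Etr p x h := by
  induction x generalizing g h with
  | nil => simp [Etr]
  | cons b x ih => simp only [Etr, ih, smul_sub]; abel

lemma Etr_const (x : List Bool) (c : V) : Etr p x (fun _ => c) = c := by
  induction x with
  | nil => simp [Etr]
  | cons b x ih => simp only [Etr, ih, ← add_smul]; simp

lemma Etr_lin {W : Type} [AddCommGroup W] [Module ℝ W] (L : V →ₗ[ℝ] W) (x : List Bool)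
    (g : List Bool → V) : Etr p x (fun y => L (g y)) = L (Etr p x g) := by
  induction x generalizing g with
  | nil => simp [Etr]
  | cons b x ih => simp [Etr, ih]

lemma Etr_sum {ι : Type} (s : Finset ι) (x : List Bool) (g : ι → List Bool → V) :
    Etr p x (fun y => ∑ i ∈ s, g i y) = ∑ i ∈ s, Etr p x (g i) := by
  induction x generalizing g with
  | nil => simp [Etr]
  | cons b x ih => simp [Etr, ih, Finset.smul_sum, Finset.sum_add_distrib]

lemma Etr_congr (x : List Bool) (g h : List Bool → V)
    (H : ∀ y, y.length ≤ x.length → g y = h y) : Etr p x g = Etr p x h := by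
  induction x generalizing g h with
  | nil => simp [Etr, H]
  | cons b x ih =>
    simp only [Etr]
    rw [ih (fun y => g (b :: y)) (fun y => h (b :: y)) (fun y hy => H _ (by simp; omega)),
      ih g h (fun y hy => H _ (by simp; omega))]

end

section
variable {p : ℝ}

lemma Etr_mul_left (x : List Bool) (c : ℝ) (g : List Bool → ℝ) :
    Etr p x (fun y => c * g y) = c * Etr p x g := by
  induction x generalizing g with
  | nil => simp [Etr]
  | cons b x ih => simp only [Etr, ih, smul_eq_mul]; ring

lemma Etr_mul_leftC (x : List Bool) (c : ℂ) (g : List Bool → ℂ) :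
    Etr p x (fun y => c * g y) = c * Etr p x g := by
  induction x generalizing g with
  | nil => simp [Etr]
  | cons b x ih => simp only [Etr, ih, Complex.real_smul]; ring

lemma Etr_mono' (h0 : 0 ≤ p) (h1 : p ≤ 1) (x : List Bool) (g h : List Bool → ℝ)
    (H : ∀ y, y.length ≤ x.length → g y ≤ h y) : Etr p x g ≤ Etr p x h := by
  induction x generalizing g h with
  | nil => simpa [Etr] using H [] (by simp)
  | cons b x ih =>
    simp only [Etr, smul_eq_mul]
    have h2 : 0 ≤ 1 - p := by linarith
    have := ih (fun y => g (b :: y)) (fun y => h (b :: y)) (fun y hy => H _ (by simp; omega))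
    have := ih g h (fun y hy => H _ (by simp; omega))
    gcongr

lemma Etr_mono (h0 : 0 ≤ p) (h1 : p ≤ 1) (x : List Bool) (g h : List Bool → ℝ)
    (H : ∀ y, g y ≤ h y) : Etr p x g ≤ Etr p x h := Etr_mono' h0 h1 x g h (fun y _ => H y)

lemma Etr_nonneg (h0 : 0 ≤ p) (h1 : p ≤ 1) (x : List Bool) (g : List Bool → ℝ)
    (H : ∀ y, 0 ≤ g y) : 0 ≤ Etr p x g := by
  simpa [Etr_const] using Etr_mono h0 h1 x (fun _ => 0) g H

lemma Etr_norm_le (h0 : 0 ≤ p) (h1 : p ≤ 1) (x : List Bool) (g : List Bool → ℂ) :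
    ‖Etr p x g‖ ≤ Etr p x (fun y => ‖g y‖) := by
  induction x generalizing g with
  | nil => simp [Etr]
  | cons b x ih =>
    simp only [Etr]
    refine (norm_add_le _ _).trans ?_
    rw [norm_smul, norm_smul, Real.norm_of_nonneg h0, Real.norm_of_nonneg (by linarith : 0 ≤ 1 - p)]
    simp only [smul_eq_mul]
    have h2 : 0 ≤ 1 - p := by linarith
    gcongr
    · exact ih _
    · exact ih _

lemma Etr_ofReal (x : List Bool) (g : List Bool → ℝ) :
    Etr p x (fun y => (g y : ℂ)) = ((Etr p x g : ℝ) : ℂ) := by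
  induction x generalizing g with
  | nil => simp [Etr]
  | cons b x ih => simp [Etr, ih]

end

lemma Eun_append (m m' : ℕ) (g : List Bool → ℝ) :
    Eun (m + m') g = Eun m (fun a => Eun m' (fun b => g (a ++ b))) := by
  induction m generalizing g with
  | zero => simp [Eun]
  | succ m ih => rw [Nat.succ_add]; simp [Eun, ih]

lemma Eun_add (m : ℕ) (g h : List Bool → ℝ) :
    Eun m (fun y => g y + h y) = Eun m g + Eun m h := by
  induction m generalizing g h with
  | zero => simp [Eun]
  | succ m ih => simp only [Eun, ih]; ring

lemma Eun_mul_left (m : ℕ) (c : ℝ) (g : List Bool → ℝ) :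
    Eun m (fun y => c * g y) = c * Eun m g := by
  induction m generalizing g with
  | zero => simp [Eun]
  | succ m ih => simp only [Eun, ih]; ring

lemma Eun_const (m : ℕ) (c : ℝ) : Eun m (fun _ => c) = c := by
  induction m with
  | zero => simp [Eun]
  | succ m ih => simp [Eun, ih]

lemma Eun_sum {ι : Type} (s : Finset ι) (m : ℕ) (g : ι → List Bool → ℝ) :
    Eun m (fun y => ∑ i ∈ s, g i y) = ∑ i ∈ s, Eun m (g i) := by
  induction m generalizing g with
  | zero => simp [Eun]
  | succ m ih => simp only [Eun, ih, ← Finset.sum_add_distrib, Finset.sum_div]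

lemma Eun_mono (m : ℕ) (g h : List Bool → ℝ) (H : ∀ y, y.length = m → g y ≤ h y) :
    Eun m g ≤ Eun m h := by
  induction m generalizing g h with
  | zero => simpa [Eun] using H [] (by simp)
  | succ m ih =>
    simp only [Eun]
    have := ih (fun y => g (true :: y)) (fun y => h (true :: y)) (fun y hy => H _ (by simp [hy]))
    have := ih (fun y => g (false :: y)) (fun y => h (false :: y)) (fun y hy => H _ (by simp [hy]))
    linarith

lemma Eun_nonneg (m : ℕ) (g : List Bool → ℝ) (H : ∀ y, 0 ≤ g y) : 0 ≤ Eun m g := by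
  simpa [Eun_const] using Eun_mono m (fun _ => 0) g (fun y _ => H y)

lemma Eun_le (m : ℕ) (g : List Bool → ℝ) (c : ℝ) (H : ∀ y, y.length = m → g y ≤ c) :
    Eun m g ≤ c := by
  simpa [Eun_const] using Eun_mono m g (fun _ => c) H

lemma Eun_Etr {p : ℝ} (m : ℕ) (x : List Bool) (g : List Bool → List Bool → ℝ) :
    Eun m (fun u => Etr p x (fun y => g u y)) = Etr p x (fun y => Eun m (fun u => g u y)) := by
  induction x generalizing g with
  | nil => simp [Etr]
  | cons b x ih =>
    simp only [Etr, smul_eq_mul, Eun_add, Eun_mul_left, ih]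

/-- Markov over the uniform string. -/
lemma Eun_markov (m : ℕ) (f : List Bool → ℝ) (hf : ∀ y, 0 ≤ f y) (t : ℝ) (ht : 0 < t) (c : ℝ)
    (hc : Eun m f ≤ c) : Eun m (fun u => ind (t < f u)) ≤ c / t := by
  calc Eun m (fun u => ind (t < f u)) ≤ Eun m (fun u => t⁻¹ * f u) :=
        Eun_mono _ _ _ (fun y _ => (ind_markov (f y) t (hf y) ht).trans (by rw [div_eq_inv_mul]))
    _ = t⁻¹ * Eun m f := Eun_mul_left _ _ _
    _ ≤ t⁻¹ * c := by gcongr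
    _ = c / t := by rw [div_eq_inv_mul]

lemma ind_exists_le {ι : Type} (s : Finset ι) (P : ι → Prop) :
    ind (∃ i ∈ s, P i) ≤ ∑ i ∈ s, ind (P i) := by
  by_cases h : ∃ i ∈ s, P i
  · obtain ⟨i, hi, hP⟩ := h
    rw [ind_true ⟨i, hi, hP⟩, ← ind_true hP]
    exact Finset.single_le_sum (f := fun i => ind (P i)) (fun i _ => ind_nonneg _) hi
  · rw [ind_false h]; exact Finset.sum_nonneg (fun i _ => ind_nonneg _)

noncomputable def Eb (p : ℝ) {n : ℕ} (g : (Fin n → Bool) → ℝ) : ℝ := ∑ r, bern p r * g r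

lemma Eb_succ (p : ℝ) {n : ℕ} (j : Fin (n+1)) (g : (Fin (n+1) → Bool) → ℝ) :
    Eb p g = p * Eb p (fun r => g (Fin.insertNth j true r))
      + (1 - p) * Eb p (fun r => g (Fin.insertNth j false r)) := by
  unfold Eb
  rw [← (Fin.insertNthEquiv (fun _ => Bool) j).sum_comp, Fintype.sum_prod_type]
  simp only [Fintype.sum_bool, Finset.mul_sum, Fin.insertNthEquiv, Equiv.coe_fn_mk]
  have h : ∀ b (r : Fin n → Bool), bern p (Fin.insertNth (α := fun _ => Bool) j b r)
      = (if b then p else 1 - p) * bern p r := by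
    intro b r
    unfold bern
    rw [Fin.prod_univ_succAbove _ j]
    simp
  congr 1 <;> refine Finset.sum_congr rfl fun r _ => ?_
  · rw [h]; simp; ring
  · rw [h]; simp; ring

lemma Eb_succ0 (p : ℝ) {n : ℕ} (g : (Fin (n+1) → Bool) → ℝ) :
    Eb p g = p * Eb p (fun r => g (Fin.cons true r))
      + (1 - p) * Eb p (fun r => g (Fin.cons false r)) := by
  rw [Eb_succ p 0]; simp [Fin.insertNth_zero]

lemma traceL_cons (b : Bool) (x : List Bool) {n : ℕ} (c : Bool) (r : Fin n → Bool)  :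
    traceL (b :: x) (keep (Fin.cons c r : Fin (n+1) → Bool))
      = if c then b :: traceL x (keep r) else traceL x (keep r) := by
  have h0 : keep (Fin.cons c r : Fin (n+1) → Bool) 0 = c := by simp [keep]
  have h1 : ∀ i, keep (Fin.cons c r : Fin (n+1) → Bool) (i+1) = keep r i := by
    intro i; unfold keep
    by_cases h : i < n
    · have h' : i + 1 < n + 1 := by omega
      rw [dif_pos h, dif_pos h']
      exact Fin.cons_succ (α := fun _ => Bool) c r ⟨i, h⟩
    · have h' : ¬ i + 1 < n + 1 := by omega
      rw [dif_neg h, dif_neg h']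
  unfold traceL
  rw [List.length_cons, List.range_succ_eq_map, List.filter_cons, h0]
  have h2 : List.filter (keep (Fin.cons c r : Fin (n+1) → Bool)) (List.map Nat.succ (List.range x.length))
      = List.map Nat.succ (List.filter (keep r) (List.range x.length)) := by
    rw [List.filter_map]
    congr 1
    congr 1
    funext i; exact h1 i
  rw [h2]
  cases c <;> simp

lemma traceL_nil (r : ℕ → Bool) : traceL [] r = [] := by simp [traceL]

lemma Etr_eq_Eb (p : ℝ) {n : ℕ} (x : List Bool) (hx : x.length = n) (g : List Bool → ℝ) :
    Etr p x g = Eb p (fun r : Fin n → Bool => g (traceL x (keep r))) := by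
  induction n generalizing x g with
  | zero =>
    have : x = [] := List.length_eq_zero_iff.mp hx
    subst this
    simp [Etr, Eb, bern, traceL_nil]
  | succ n ih =>
    obtain ⟨b, x, rfl⟩ := List.exists_cons_of_length_eq_add_one hx
    rw [Eb_succ0]
    simp only [traceL_cons, Etr, if_true, smul_eq_mul]
    rw [ih x (by simpa using hx), ih x (by simpa using hx)]
    simp

lemma Eun_eq_Eb {n : ℕ} (g : List Bool → ℝ) :
    Eun n g = Eb (1/2) (fun r : Fin n → Bool => g (List.ofFn r)) := by
  induction n generalizing g with
  | zero => simp [Eun, Eb, bern]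
  | succ n ih =>
    rw [Eb_succ0]
    simp only [Eun, ih, List.ofFn_cons]
    ring

lemma bern_half {n : ℕ} (r : Fin n → Bool) : bern (1/2) r = unif n := by
  unfold bern unif
  rw [Finset.prod_congr rfl (g := fun _ => (1/2:ℝ)) (fun i _ => by split <;> norm_num)]
  simp

section
variable {p : ℝ} {n : ℕ}

lemma bern_nonneg (h0 : 0 ≤ p) (h1 : p ≤ 1) (r : Fin n → Bool) : 0 ≤ bern p r :=
  Finset.prod_nonneg fun i _ => by split <;> linarith

lemma Eb_const (c : ℝ) : Eb p (fun _ : Fin n → Bool => c) = c := by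
  induction n with
  | zero => simp [Eb, bern]
  | succ n ih => rw [Eb_succ0, ih]; ring

lemma Eb_add (f g : (Fin n → Bool) → ℝ) : Eb p (fun r => f r + g r) = Eb p f + Eb p g := by
  simp [Eb, mul_add, Finset.sum_add_distrib]

lemma Eb_mul (c : ℝ) (f : (Fin n → Bool) → ℝ) : Eb p (fun r => c * f r) = c * Eb p f := by
  simp only [Eb, Finset.mul_sum]; exact Finset.sum_congr rfl fun r _ => by ring

lemma Eb_sum {ι : Type} (s : Finset ι) (f : ι → (Fin n → Bool) → ℝ) :
    Eb p (fun r => ∑ i ∈ s, f i r) = ∑ i ∈ s, Eb p (f i) := by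
  simp only [Eb, Finset.mul_sum]; exact Finset.sum_comm

lemma Eb_mono (h0 : 0 ≤ p) (h1 : p ≤ 1) (f g : (Fin n → Bool) → ℝ) (h : ∀ r, f r ≤ g r) :
    Eb p f ≤ Eb p g :=
  Finset.sum_le_sum fun r _ => mul_le_mul_of_nonneg_left (h r) (bern_nonneg h0 h1 r)

lemma Eb_swap {m : ℕ} {p' : ℝ} (f : (Fin n → Bool) → (Fin m → Bool) → ℝ) :
    Eb p (fun r => Eb p' (fun s => f r s)) = Eb p' (fun s => Eb p (fun r => f r s)) := by
  simp only [Eb, Finset.mul_sum]; rw [Finset.sum_comm]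
  exact Finset.sum_congr rfl fun r _ => Finset.sum_congr rfl fun s _ => by ring

lemma Eb_zero (j : Fin n) (φ : Bool → ℝ) (hφ : p * φ true + (1 - p) * φ false = 0)
    (h : (Fin n → Bool) → ℝ) (hh : ∀ r b, h (Function.update r j b) = h r) :
    Eb p (fun r => φ (r j) * h r) = 0 := by
  cases n with
  | zero => exact j.elim0
  | succ n =>
    rw [Eb_succ p j]
    simp only [Fin.insertNth_apply_same]
    rw [Eb_mul, Eb_mul]
    have : (fun r : Fin n → Bool => h (Fin.insertNth (α := fun _ => Bool) j true r))
        = fun r => h (Fin.insertNth (α := fun _ => Bool) j false r) := by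
      funext r
      rw [← hh _ false]; congr 1; simp
    rw [this]
    linear_combination (Eb p fun r : Fin n → Bool => h (Fin.insertNth (α := fun _ => Bool) j false r)) * hφ

lemma Eb_prod (f : Fin n → Bool → ℝ) :
    Eb p (fun r => ∏ i, f i (r i)) = ∏ i, (p * f i true + (1 - p) * f i false) := by
  induction n with
  | zero => simp [Eb, bern]
  | succ n ih =>
    rw [Eb_succ0]
    simp only [Fin.prod_univ_succ, Fin.cons_zero, Fin.cons_succ]
    rw [Eb_mul, Eb_mul, ih]; ring

lemma Eb_markov (h0 : 0 ≤ p) (h1 : p ≤ 1) (f : (Fin n → Bool) → ℝ) (hf : ∀ r, 0 ≤ f r)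
    (t : ℝ) (ht : 0 < t) : Eb p (fun r => ind (t < f r)) ≤ Eb p f / t := by
  calc _ ≤ Eb p (fun r => t⁻¹ * f r) := Eb_mono h0 h1 _ _ fun r =>
        (ind_markov (f r) t (hf r) ht).trans (by rw [div_eq_inv_mul])
    _ = _ := by rw [Eb_mul, div_eq_inv_mul]

end

noncomputable def sg (b : Bool) : ℝ := if b then 1 else -1
def Tn {n : ℕ} (r : Fin n → Bool) (i : Fin n) : ℕ := ∑ j, if j < i ∧ r j then 1 else 0

lemma Tn_zero {n : ℕ} (r : Fin (n+1) → Bool) : Tn r 0 = 0 := by simp [Tn]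
lemma Tn_succ {n : ℕ} (c : Bool) (r : Fin n → Bool) (i : Fin n) :
    Tn (Fin.cons c r : Fin (n+1) → Bool) i.succ = (if c then 1 else 0) + Tn r i := by
  unfold Tn
  rw [Fin.sum_univ_succ]
  simp

lemma wsum (n : ℕ) (u r : Fin n → Bool) (f : ℕ → Bool → ℝ) :
    (∑ t ∈ Finset.range (traceL (List.ofFn u) (keep r)).length,
      f t ((traceL (List.ofFn u) (keep r)).getD t false))
    = ∑ i, if r i then f (Tn r i) (u i) else 0 := by
  induction n generalizing f with
  | zero => simp [traceL_nil]
  | succ n ih =>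
    rw [← Fin.cons_self_tail u, ← Fin.cons_self_tail r, List.ofFn_cons, traceL_cons,
      Fin.sum_univ_succ]
    simp only [Fin.cons_zero, Fin.cons_succ, Tn_zero, Tn_succ]
    cases hr : r 0
    · simp only [Bool.false_eq_true, if_false, zero_add]
      exact ih (Fin.tail u) (Fin.tail r) f
    · simp only [if_true, List.length_cons, Finset.sum_range_succ', List.getD_cons_succ, List.getD_cons_zero]
      rw [ih (Fin.tail u) (Fin.tail r) (fun t b => f (t+1) b)]
      simp only [add_comm 1]
      ring

noncomputable def cc (p R : ℝ) (i : ℕ) (y : List Bool) : ℝ :=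
  ∑ t ∈ Finset.range y.length, if |(t:ℝ) - p * i| ≤ R then sg (y.getD t false) else 0

def Base (lam : ℕ) (p R S0 th : ℝ) (u y : List Bool) : Prop :=
  y.length ≤ lam ∧ (∑ i : Fin lam, cc p R i y ^ 2) ≤ S0 ∧
    th ≤ ∑ i : Fin lam, sg (u.getD i false) * cc p R i y

lemma base_false (lam : ℕ) (p R S0 th : ℝ) (hS : 0 < S0) (hth : 0 ≤ th) (y : List Bool) :
    Eun lam (fun u => ind (Base lam p R S0 th u y)) ≤ Real.exp (-(th ^ 2 / (2 * S0))) := by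
  rw [Eun_eq_Eb]
  by_cases hy : (∑ i : Fin lam, cc p R i y ^ 2) ≤ S0
  swap
  · have : (fun r : Fin lam → Bool => ind (Base lam p R S0 th (List.ofFn r) y)) = fun _ => 0 := by
      funext r; exact ind_false (fun h => hy h.2.1)
    rw [this, Eb_const]; positivity
  set s := th / S0 with hs
  have hs0 : 0 ≤ s := by positivity
  calc _ ≤ Eb (1/2) (fun r : Fin lam → Bool =>
        Real.exp (-(s * th)) * ∏ i, Real.exp (s * (sg (r i) * cc p R i y))) := by
        refine Eb_mono (by norm_num) (by norm_num) _ _ fun r => ?_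
        rw [← Real.exp_sum, ← Real.exp_add, ← Finset.mul_sum]
        by_cases h : Base lam p R S0 th (List.ofFn r) y
        · rw [ind_true h]
          apply Real.one_le_exp
          have := h.2.2
          have h2 : (∑ i : Fin lam, sg ((List.ofFn r).getD i false) * cc p R i y)
            = ∑ i : Fin lam, sg (r i) * cc p R i y := by
            refine Finset.sum_congr rfl fun i _ => ?_
            simp [List.getD_eq_getElem?_getD]
          rw [h2] at this
          nlinarith
        · rw [ind_false h]; positivity
    _ = Real.exp (-(s * th)) * ∏ i : Fin lam, Real.cosh (s * cc p R i y) := by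
        rw [Eb_mul, Eb_prod (p := 1/2) (fun (i : Fin lam) b => Real.exp (s * (sg b * cc p R i y)))]
        congr 1
        refine Finset.prod_congr rfl fun i _ => ?_
        simp only [sg, if_true, Bool.false_eq_true, if_false, Real.cosh_eq]
        ring_nf
    _ ≤ Real.exp (-(s * th)) * ∏ i : Fin lam, Real.exp ((s * cc p R i y)^2/2) := by
        gcongr with i
        exact Real.cosh_le_exp_half_sq _
    _ = Real.exp (-(s*th) + s^2/2 * ∑ i : Fin lam, cc p R i y ^ 2) := by
        rw [← Real.exp_sum, ← Real.exp_add, Finset.mul_sum]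
        congr 2
        exact Finset.sum_congr rfl fun i _ => by ring
    _ ≤ _ := by
        apply Real.exp_le_exp.mpr
        have : s^2/2 * ∑ i : Fin lam, cc p R i y ^ 2 ≤ s^2/2 * S0 := by gcongr
        have h3 : -(s*th) + s^2/2*S0 = -(th^2/(2*S0)) := by rw [hs]; field_simp; ring
        linarith

section
variable {n : ℕ}

lemma sg_sq (b : Bool) : sg b * sg b = 1 := by cases b <;> simp [sg]

lemma upd_ne (i j : Fin n) (h : i ≠ j) (r : Fin n → Bool) (b : Bool) : Function.update r j b i = r i := by
  simp [h]

lemma E2 (p : ℝ) (φ : Bool → ℝ) (hφ : p * φ true + (1 - p) * φ false = 0) (i j : Fin n) (h : i ≠ j) :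
    Eb p (fun r => φ (r i) * φ (r j)) = 0 :=
  Eb_zero i φ hφ (fun r => φ (r j)) (fun r b => by simp [h.symm])

lemma E2s (i j : Fin n) : Eb (1/2) (fun u => sg (u i) * sg (u j)) = if i = j then 1 else 0 := by
  by_cases h : i = j
  · subst h; simp [sg_sq, Eb_const]
  · rw [if_neg h]; exact E2 _ _ (by norm_num [sg]) _ _ h

lemma E4s (i i' j j' : Fin n) (h : i ≠ i') (h' : j ≠ j') :
    Eb (1/2) (fun u => (sg (u i) * sg (u i')) * (sg (u j) * sg (u j')))
      ≤ (if i = j ∧ i' = j' then 1 else 0) + (if i = j' ∧ i' = j then 1 else 0) := by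
  by_cases h1 : i = j
  · subst h1
    have : (fun u : Fin n → Bool => (sg (u i) * sg (u i')) * (sg (u i) * sg (u j')))
      = fun u => sg (u i') * sg (u j') := by
      funext u; linear_combination (sg (u i') * sg (u j')) * sg_sq (u i)
    rw [this, E2s]
    by_cases h2 : i' = j'
    · simp [h2]; split <;> norm_num
    · simp [h2]; split <;> norm_num
  · by_cases h2 : i = j'
    · subst h2
      have : (fun u : Fin n → Bool => (sg (u i) * sg (u i')) * (sg (u j) * sg (u i)))
        = fun u => sg (u i') * sg (u j) := by
        funext u; linear_combination (sg (u i') * sg (u j)) * sg_sq (u i)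
      rw [this, E2s]
      simp [h1]
    · have := Eb_zero (p := 1/2) i sg (by norm_num [sg]) (fun u => sg (u i') * (sg (u j) * sg (u j')))
        (fun r b => by simp [Ne.symm h, Ne.symm h1, Ne.symm h2])
      simp only [← mul_assoc] at this ⊢
      rw [this]
      split <;> split <;> norm_num

/-- second moment of the off-diagonal chaos -/
lemma chaos (A : Fin n → Fin n → ℝ) (hA : ∀ i j, A i j = 0 ∨ A i j = 1) :
    Eb (1/2) (fun u => ((∑ i, sg (u i) * ∑ j, A i j * sg (u j)) - ∑ i, A i i) ^ 2)
      ≤ 2 * ∑ i, ∑ j, A i j := by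
  classical
  have hA0 : ∀ i j, 0 ≤ A i j := fun i j => by rcases hA i j with h | h <;> rw [h]; norm_num
  have hA1 : ∀ i j, A i j ≤ 1 := fun i j => by rcases hA i j with h | h <;> rw [h]; norm_num
  set B : Fin n × Fin n → ℝ := fun e => if e.1 = e.2 then 0 else A e.1 e.2 with hB
  have hB0 : ∀ e, 0 ≤ B e := fun e => by simp only [hB]; split <;> simp [hA0]
  have hB1 : ∀ e, B e ≤ 1 := fun e => by simp only [hB]; split <;> simp [hA1]
  have key : ∀ u : Fin n → Bool, (∑ i, sg (u i) * ∑ j, A i j * sg (u j)) - ∑ i, A i i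
      = ∑ e : Fin n × Fin n, B e * (sg (u e.1) * sg (u e.2)) := by
    intro u
    rw [Fintype.sum_prod_type, ← Finset.sum_sub_distrib]
    refine Finset.sum_congr rfl fun i _ => ?_
    rw [Finset.mul_sum]
    have : A i i = ∑ j, if i = j then A i j else 0 := by simp
    rw [this, ← Finset.sum_sub_distrib]
    refine Finset.sum_congr rfl fun j _ => ?_
    simp only [hB]
    by_cases h : i = j
    · subst h; simp; linear_combination A i i * sg_sq (u i)
    · simp [h]; ring
  have step : ∀ e e' : Fin n × Fin n, Eb (1/2) (fun u => (B e * (sg (u e.1) * sg (u e.2))) * (B e' * (sg (u e'.1) * sg (u e'.2))))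
      ≤ (if e = e' then B e else 0) + (if e' = e.swap then B e else 0) := by
    intro e e'
    have : (fun u : Fin n → Bool => (B e * (sg (u e.1) * sg (u e.2))) * (B e' * (sg (u e'.1) * sg (u e'.2))))
      = fun u => (B e * B e') * ((sg (u e.1) * sg (u e.2)) * (sg (u e'.1) * sg (u e'.2))) := by
      funext u; ring
    rw [this, Eb_mul]
    obtain ⟨i, i'⟩ := e
    obtain ⟨j, j'⟩ := e'
    by_cases h : i = i'
    · simp [hB, h]
    by_cases h' : j = j'
    · have : B (j, j') = 0 := by simp [hB, h']
      rw [this]; simp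
      have := hB0 (i, i')
      split <;> split <;> linarith
    have h4 := E4s i i' j j' h h'
    have hb : B (i,i') * B (j,j') ≤ B (i,i') := mul_le_of_le_one_right (hB0 _) (hB1 _)
    have hb0 : 0 ≤ B (i,i') * B (j,j') := mul_nonneg (hB0 _) (hB0 _)
    refine (mul_le_mul_of_nonneg_left h4 hb0).trans ?_
    rw [mul_add]
    have e1 : ((i, i') = (j, j')) ↔ (i = j ∧ i' = j') := by simp
    have e2 : ((j, j') = (i, i').swap) ↔ (i = j' ∧ i' = j) := by simp; tauto
    simp only [e1, e2]
    gcongr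
    · split <;> simp [hb]
    · split <;> simp [hb]
  calc _ = ∑ e, ∑ e', Eb (1/2) (fun u : Fin n → Bool => (B e * (sg (u e.1) * sg (u e.2))) * (B e' * (sg (u e'.1) * sg (u e'.2)))) := by
        simp only [key, sq, Finset.sum_mul_sum]
        rw [Eb_sum]
        exact Finset.sum_congr rfl fun e _ => Eb_sum _ _
    _ ≤ ∑ e, ∑ e', ((if e = e' then B e else 0) + (if e' = e.swap then B e else 0)) :=
        Finset.sum_le_sum fun e _ => Finset.sum_le_sum fun e' _ => step e e'
    _ = 2 * ∑ e, B e := by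
        simp [Finset.sum_add_distrib, two_mul]
    _ ≤ 2 * ∑ e : Fin n × Fin n, A e.1 e.2 := by
        gcongr with e
        simp only [hB]; split
        · exact hA0 _ _
        · exact le_rfl
    _ = _ := by rw [Fintype.sum_prod_type]

lemma sqmom (A : Fin n → Fin n → ℝ) (hA : ∀ i j, A i j = 0 ∨ A i j = 1) :
    Eb (1/2) (fun u => ∑ i, (∑ j, A i j * sg (u j)) ^ 2) = ∑ i, ∑ j, A i j := by
  rw [Eb_sum]
  refine Finset.sum_congr rfl fun i _ => ?_
  simp only [sq, Finset.sum_mul_sum]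
  rw [Eb_sum]
  refine Finset.sum_congr rfl fun j _ => ?_
  rw [Eb_sum]
  have : ∀ k, Eb (1/2) (fun u : Fin n → Bool => A i j * sg (u j) * (A i k * sg (u k)))
     = if j = k then A i j else 0 := by
    intro k
    have : (fun u : Fin n → Bool => A i j * sg (u j) * (A i k * sg (u k)))
      = fun u => (A i j * A i k) * (sg (u j) * sg (u k)) := by funext u; ring
    rw [this, Eb_mul, E2s]
    by_cases h : j = k
    · subst h; rcases hA i j with h | h <;> simp [h]
    · simp [h]
  simp only [this]; simp

/-- variance of weighted 0/1 sums -/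
lemma varsum (p : ℝ) (h0 : 0 ≤ p) (h1 : p ≤ 1) (a : Fin n → ℝ) (ha : ∀ i, a i = 0 ∨ a i = 1) :
    Eb p (fun r => (∑ i, a i * ((if r i then 1 else 0) - p)) ^ 2) ≤ p * n := by
  simp only [sq, Finset.sum_mul_sum]
  rw [Eb_sum]
  have : ∀ i, Eb p (fun r : Fin n → Bool => ∑ j, a i * ((if r i then 1 else 0) - p) * (a j * ((if r j then 1 else 0) - p))) ≤ p := by
    intro i
    rw [Eb_sum]
    have hj : ∀ j, Eb p (fun r : Fin n → Bool => a i * ((if r i then 1 else 0) - p) * (a j * ((if r j then 1 else 0) - p)))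
        ≤ if i = j then p else 0 := by
      intro j
      have e : (fun r : Fin n → Bool => a i * ((if r i then 1 else 0) - p) * (a j * ((if r j then 1 else 0) - p)))
        = fun r => (a i * a j) * (((if r i then 1 else 0) - p) * ((if r j then 1 else 0) - p)) := by
        funext r; ring
      rw [e, Eb_mul]
      by_cases h : i = j
      · subst h
        rw [if_pos rfl]
        have e1 : (fun r : Fin n → Bool => (((if r i then 1 else 0) - p) * ((if r i then 1 else 0) - p)))
           = fun r => ((1 - 2*p) * ((fun b : Bool => (if b then 1 else 0) - p) (r i) * 1)) + (p * (1-p)) := by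
          funext r; dsimp only; split <;> ring
        rw [e1, Eb_add, Eb_mul, Eb_const, Eb_zero i (fun b : Bool => (if b then 1 else 0) - p) (by simp; ring) (fun _ => 1) (fun _ _ => rfl)]
        rcases ha i with h | h <;> rw [h] <;> nlinarith
      · rw [if_neg h, E2 p (fun b => (if b then 1 else 0) - p) (by simp; ring) i j h]; simp
    exact (Finset.sum_le_sum fun j _ => hj j).trans (by simp)
  exact (Finset.sum_le_sum fun i _ => this i).trans (by simp [mul_comm])

end

noncomputable def Aker {n : ℕ} (p R : ℝ) (r : Fin n → Bool) (i j : Fin n) : ℝ :=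
  if r j = true ∧ |(Tn r j : ℝ) - p * (i:ℕ)| ≤ R then 1 else 0

lemma Aker01 {n : ℕ} (p R : ℝ) (r : Fin n → Bool) (i j : Fin n) :
    Aker p R r i j = 0 ∨ Aker p R r i j = 1 := by
  unfold Aker; split <;> simp

lemma cc_trace {n : ℕ} (p R : ℝ) (u r : Fin n → Bool) (i : Fin n) :
    cc p R i (traceL (List.ofFn u) (keep r)) = ∑ j, Aker p R r i j * sg (u j) := by
  unfold cc
  rw [wsum n u r (fun t b => if |(t:ℝ) - p * (i:ℕ)| ≤ R then sg b else 0)]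
  refine Finset.sum_congr rfl fun j _ => ?_
  unfold Aker
  by_cases h : r j = true <;> simp [h]

lemma count_band (n : ℕ) (p R t : ℝ) (hp : 0 < p) (hR : 0 ≤ R) :
    (∑ i : Fin n, if |t - p * (i:ℕ)| ≤ R then (1:ℝ) else 0) ≤ 2 * R / p + 1 := by
  classical
  rw [Finset.sum_ite, Finset.sum_const_zero, add_zero, Finset.sum_const, nsmul_eq_mul, mul_one]
  have h1 : (Finset.univ.filter (fun i : Fin n => |t - p * (i:ℕ)| ≤ R)).card
      ≤ (Finset.Icc ⌈(t - R)/p⌉ ⌊(t+R)/p⌋).card := by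
    refine Finset.card_le_card_of_injOn (fun i => ((i:ℕ):ℤ)) ?_ ?_
    · intro i hi
      simp only [Finset.coe_filter, Finset.mem_univ, true_and, Set.mem_ofPred_eq, abs_le] at hi
      simp only [Finset.coe_Icc, Set.mem_Icc]
      constructor
      · rw [Int.ceil_le, div_le_iff₀ hp]; push_cast; linarith [hi.2]
      · rw [Int.le_floor, le_div_iff₀ hp]; push_cast; linarith [hi.1]
    · intro i _ j _ h
      simp only [Nat.cast_inj] at h
      exact Fin.ext h
  have h2 : ((Finset.Icc ⌈(t - R)/p⌉ ⌊(t+R)/p⌋).card : ℝ) ≤ 2 * R / p + 1 := by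
    rw [Int.card_Icc]
    have e1 := Int.le_ceil ((t-R)/p)
    have e2 := Int.floor_le ((t+R)/p)
    have e3 : (t+R)/p - (t-R)/p = 2 * R / p := by ring
    by_cases h : 0 ≤ ⌊(t+R)/p⌋ + 1 - ⌈(t-R)/p⌉
    · have : (((⌊(t+R)/p⌋ + 1 - ⌈(t-R)/p⌉).toNat : ℤ) : ℝ) = ((⌊(t+R)/p⌋ + 1 - ⌈(t-R)/p⌉ : ℤ):ℝ) := by
        rw [Int.toNat_of_nonneg h]
      have h5 : (((⌊(t+R)/p⌋ + 1 - ⌈(t-R)/p⌉).toNat : ℕ) : ℝ) = ((⌊(t+R)/p⌋ + 1 - ⌈(t-R)/p⌉ : ℤ):ℝ) := by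
        rw [← this]; exact (Int.cast_natCast _).symm
      rw [h5]; push_cast; linarith
    · rw [Int.toNat_of_nonpos (by omega)]
      have : 0 ≤ 2 * R / p := by positivity
      push_cast; linarith
  calc _ ≤ ((Finset.Icc ⌈(t - R)/p⌉ ⌊(t+R)/p⌋).card : ℝ) := by exact_mod_cast h1
    _ ≤ _ := h2

lemma sumA {n : ℕ} (p R : ℝ) (hp : 0 < p) (hR : 0 ≤ R) (r : Fin n → Bool) :
    ∑ i, ∑ j, Aker p R r i j ≤ n * (2 * R / p + 1) := by
  rw [Finset.sum_comm]
  have : ∀ j, ∑ i, Aker p R r i j ≤ 2 * R / p + 1 := by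
    intro j
    refine le_trans (Finset.sum_le_sum fun i _ => ?_) (count_band n p R (Tn r j) hp hR)
    unfold Aker
    by_cases h : |(Tn r j : ℝ) - p * (i:ℕ)| ≤ R
    · simp only [h, and_true]; split <;> norm_num
    · simp [h]
  exact (Finset.sum_le_sum fun j _ => this j).trans (by simp [mul_add])

lemma Tn_eq {n : ℕ} (p : ℝ) (r : Fin n → Bool) (i : Fin n) : (Tn r i : ℝ) - p * (i:ℕ)
    = ∑ j, (if j < i then (1:ℝ) else 0) * ((if r j then 1 else 0) - p) := by
  unfold Tn
  have : (((i:ℕ) : ℕ) : ℝ) = ∑ j : Fin n, if j < i then (1:ℝ) else 0 := by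
    rw [Finset.sum_ite]
    simp only [Finset.sum_const_zero, add_zero, Finset.sum_const, nsmul_eq_mul, mul_one]
    have : (Finset.univ.filter (fun j : Fin n => j < i)) = Finset.Iio i := by ext; simp
    rw [this, Fin.card_Iio]
  rw [this, Finset.mul_sum]
  push_cast
  rw [← Finset.sum_sub_distrib]
  refine Finset.sum_congr rfl fun j _ => ?_
  by_cases h : j < i <;> by_cases h' : r j = true <;> simp [h, h']

lemma Zbound {n : ℕ} (p R : ℝ) (hp : 0 < p) (h1 : p ≤ 1) (hR : 0 < R) (hn : 0 < n) :
    Eb p (fun r : Fin n → Bool => ind (∑ i, Aker p R r i i < p * n / 4)) ≤ 4 / (p * n) + 4 * n / R ^ 2 := by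
  have hn' : (0:ℝ) < n := by exact_mod_cast hn
  have key : ∀ r : Fin n → Bool, ind (∑ i, Aker p R r i i < p * n / 4)
     ≤ ind ((p * n / 2) ^ 2 < (∑ i, (1:ℝ) * ((if r i then 1 else 0) - p)) ^ 2)
      + ind (p * n / 4 < ∑ i, ind (R ^ 2 < ((Tn r i : ℝ) - p * (i:ℕ)) ^ 2)) := by
    intro r
    apply ind_imp_or
    intro h
    by_contra hcon
    push Not at hcon
    obtain ⟨c1, c2⟩ := hcon
    have c3 := abs_le_of_sq_le_sq c1 (by positivity)
    have c4 : ∑ i, (1:ℝ) * ((if r i then 1 else 0) - p) = (∑ i, if r i then (1:ℝ) else 0) - n * p := by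
      simp [Finset.sum_sub_distrib]
    rw [c4, ] at c3
    have c5 : (∑ i, if r i then (1:ℝ) else 0) ≤ ∑ i, Aker p R r i i + ∑ i, ind (R ^ 2 < ((Tn r i : ℝ) - p * (i:ℕ)) ^ 2) := by
      rw [← Finset.sum_add_distrib]
      refine Finset.sum_le_sum fun i _ => ?_
      unfold Aker
      by_cases h : |(Tn r i : ℝ) - p * (i:ℕ)| ≤ R
      · simp only [h, and_true]
        linarith [ind_nonneg (R ^ 2 < ((Tn r i : ℝ) - p * (i:ℕ)) ^ 2)]
      · rw [ind_true]
        · split <;> split <;> norm_num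
        · push Not at h
          rw [← sq_abs ((Tn r i : ℝ) - p * (i:ℕ))]
          gcongr
    have c6 := (abs_le.mp c3).1
    linarith
  refine (Eb_mono hp.le h1 _ _ key).trans ?_
  rw [Eb_add]
  gcongr
  · refine (Eb_markov hp.le h1 _ (fun r => sq_nonneg _) _ (by positivity)).trans ?_
    refine (div_le_div_of_nonneg_right (varsum p hp.le h1 (fun _ => 1) (by simp)) (by positivity)).trans ?_
    apply le_of_eq; field_simp; norm_num
  · refine (Eb_markov hp.le h1 _ (fun r => Finset.sum_nonneg fun i _ => ind_nonneg _) _ (by positivity)).trans ?_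
    rw [Eb_sum]
    have : ∀ i : Fin n, Eb p (fun r : Fin n → Bool => ind (R ^ 2 < ((Tn r i : ℝ) - p * (i:ℕ)) ^ 2)) ≤ p * n / R ^ 2 := by
      intro i
      refine (Eb_markov hp.le h1 _ (fun r => sq_nonneg _) _ (by positivity)).trans ?_
      gcongr
      simp only [Tn_eq]
      exact varsum p hp.le h1 _ (fun j => by split <;> simp)
    refine (div_le_div_of_nonneg_right (Finset.sum_le_sum fun i _ => this i) (by positivity)).trans ?_
    simp only [Finset.sum_const, Finset.card_univ, Fintype.card_fin, nsmul_eq_mul]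
    apply le_of_eq; field_simp

lemma traceL_length (x : List Bool) (r : ℕ → Bool) : (traceL x r).length ≤ x.length := by
  unfold traceL
  rw [List.length_map]
  exact (List.length_filter_le _ _).trans (by simp)

lemma base_true {n : ℕ} (p R S0 : ℝ) (hp : 0 < p) (h1 : p ≤ 1) (hR : 0 < R) (hn : 0 < n) (hS : 0 < S0) :
    Eun n (fun u => Etr p u (fun y => ind (¬ Base n p R S0 (p * n / 8) u y)))
      ≤ n * (2 * R / p + 1) / S0 + 128 * (n * (2 * R / p + 1)) / (p * n) ^ 2
        + (4 / (p * n) + 4 * n / R ^ 2) := by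
  have hn' : (0:ℝ) < n := by exact_mod_cast hn
  rw [Eun_eq_Eb]
  have e : (fun u : Fin n → Bool => Etr p (List.ofFn u) (fun y => ind (¬ Base n p R S0 (p * n / 8) (List.ofFn u) y)))
      = fun u => Eb p (fun r : Fin n → Bool => ind (¬ Base n p R S0 (p * n / 8) (List.ofFn u) (traceL (List.ofFn u) (keep r)))) := by
    funext u; rw [Etr_eq_Eb (n := n) p (List.ofFn u) (by simp)]
  rw [e, Eb_swap]
  have key : ∀ r : Fin n → Bool, Eb (1/2) (fun u : Fin n → Bool => ind (¬ Base n p R S0 (p * n / 8) (List.ofFn u) (traceL (List.ofFn u) (keep r))))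
     ≤ (n * (2 * R / p + 1) / S0 + 128 * (n * (2 * R / p + 1)) / (p * n) ^ 2) + ind (∑ i, Aker p R r i i < p * n / 4) := by
    intro r
    have k2 : ∀ u : Fin n → Bool, ind (¬ Base n p R S0 (p * n / 8) (List.ofFn u) (traceL (List.ofFn u) (keep r)))
      ≤ (ind (S0 < ∑ i, (∑ j, Aker p R r i j * sg (u j)) ^ 2)
        + ind ((p * n / 8) ^ 2 < ((∑ i, sg (u i) * ∑ j, Aker p R r i j * sg (u j)) - ∑ i, Aker p R r i i) ^ 2))
        + ind (∑ i, Aker p R r i i < p * n / 4) := by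
      intro u
      have : ¬ Base n p R S0 (p * n / 8) (List.ofFn u) (traceL (List.ofFn u) (keep r)) →
        ((S0 < ∑ i, (∑ j, Aker p R r i j * sg (u j)) ^ 2) ∨
         ((p * n / 8) ^ 2 < ((∑ i, sg (u i) * ∑ j, Aker p R r i j * sg (u j)) - ∑ i, Aker p R r i i) ^ 2)) ∨
         (∑ i, Aker p R r i i < p * n / 4) := by
        intro hB
        by_contra hcon
        push Not at hcon
        obtain ⟨⟨c1, c2⟩, c3⟩ := hcon
        apply hB
        refine ⟨(traceL_length _ _).trans (by simp), ?_, ?_⟩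
        · simpa only [cc_trace] using c1
        · have h2 : (∑ i : Fin n, sg ((List.ofFn u).getD i false) * cc p R i (traceL (List.ofFn u) (keep r)))
            = ∑ i : Fin n, sg (u i) * ∑ j, Aker p R r i j * sg (u j) := by
            refine Finset.sum_congr rfl fun i _ => ?_
            rw [cc_trace]
            simp [List.getD_eq_getElem?_getD]
          rw [h2]
          have := (abs_le.mp (abs_le_of_sq_le_sq c2 (by positivity))).1
          linarith
      refine (ind_imp_or this).trans ?_
      gcongr
      exact ind_or _ _
    refine (Eb_mono (by norm_num) (by norm_num) _ _ k2).trans ?_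
    rw [Eb_add, Eb_add, Eb_const]
    gcongr
    · refine (Eb_markov (by norm_num) (by norm_num) _ (fun u => Finset.sum_nonneg fun i _ => sq_nonneg _) _ hS).trans ?_
      rw [sqmom _ (Aker01 p R r)]
      gcongr
      exact sumA p R hp hR.le r
    · refine (Eb_markov (by norm_num) (by norm_num) _ (fun u => sq_nonneg _) _ (by positivity)).trans ?_
      have h := (chaos _ (Aker01 p R r)).trans (mul_le_mul_of_nonneg_left (sumA p R hp hR.le r) (by norm_num : (0:ℝ) ≤ 2))
      refine (div_le_div_of_nonneg_right h (by positivity)).trans ?_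
      apply le_of_eq; field_simp; norm_num
  refine (Eb_mono hp.le h1 _ _ key).trans ?_
  rw [Eb_add, Eb_const]
  gcongr
  exact Zbound p R hp h1 hR hn

open Filter Topology in
/-- base test -/
lemma base_exists (p : ℝ) (hp : 0 < p) (h1 : p ≤ 1) : ∃ (lam : ℕ) (Bs : List Bool → List Bool → Prop),
    1 ≤ lam ∧ (∀ u y, Bs u y → y.length ≤ lam) ∧
    (∀ y, Eun lam (fun u => ind (Bs u y)) ≤ (1 / (6 * (lam + 1))) ^ 2) ∧
    Eun lam (fun u => Etr p u (fun y => ind (¬ Bs u y))) ≤ 1 / 36 := by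
  set κ := 24 / p with hκ
  have hκ0 : 0 < κ := by positivity
  set c2 := 2 * κ / p + 1 with hc2
  have hc20 : 0 < c2 := by positivity
  set c3 := p ^ 2 / (128 * 144 * c2) with hc3
  have hc30 : 0 < c3 := by positivity
  have T1 : Tendsto (fun s : ℕ => (s:ℝ)) atTop atTop := tendsto_natCast_atTop_atTop
  have T2 : Tendsto (fun x : ℝ => x ^ 4 * Real.exp (-c3 * x)) atTop (𝓝 0) := by
    simpa using tendsto_rpow_mul_exp_neg_mul_atTop_nhds_zero 4 c3 hc30
  have ev := ((T2.comp T1).eventually (gt_mem_nhds (show (0:ℝ) < 1/144 by norm_num))).and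
    ((T1.eventually_ge_atTop (128 * 144 * c2 / p^2 + 1)).and (T1.eventually_ge_atTop (4 * 144 / p)))
  obtain ⟨s, hs1, hs2, hs3⟩ := ev.exists
  simp only [Function.comp] at hs1
  have hs : (1:ℝ) ≤ s := by
    have : 0 ≤ 128 * 144 * c2 / p^2 := by positivity
    linarith
  have hs0 : 1 ≤ s := by exact_mod_cast hs
  set n := s ^ 2 with hn
  have hn' : (n:ℝ) = (s:ℝ)^2 := by rw [hn]; push_cast; ring
  set R := κ * s with hR
  have hR0 : 0 < R := by positivity
  set W := (n:ℝ) * (2 * R / p + 1) with hW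
  have hWs : W ≤ c2 * (s:ℝ) ^ 3 := by
    rw [hW, hn', hR, hc2]
    have e : (s:ℝ)^2 * (2 * (κ * s) / p + 1) = 2 * κ / p * (s:ℝ)^3 + (s:ℝ)^2 := by ring
    rw [e]; nlinarith [sq_nonneg (s:ℝ)]
  have hW0 : 0 < W := by rw [hW, hn']; positivity
  have hnpos : 0 < n := by positivity
  refine ⟨n, Base n p R (144 * W) (p * n / 8), hnpos, fun u y h => h.1, fun y => ?_, ?_⟩
  · refine (base_false n p R (144 * W) (p * n / 8) (by positivity) (by positivity) y).trans ?_
    have h3 : c3 * s ≤ (p * n / 8) ^ 2 / (2 * (144 * W)) := by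
      rw [le_div_iff₀ (by positivity)]
      calc c3 * s * (2 * (144 * W)) ≤ c3 * s * (2 * (144 * (c2 * (s:ℝ)^3))) := by gcongr
        _ = (p * n / 8) ^ 2 := by rw [hc3, hn']; field_simp; norm_num
    have h4 : Real.exp (-((p * n / 8) ^ 2 / (2 * (144 * W)))) ≤ Real.exp (-c3 * s) := by
      apply Real.exp_le_exp.mpr; linarith
    refine h4.trans ?_
    have h5 : Real.exp (-c3 * s) ≤ 1 / (144 * (s:ℝ)^4) := by
      rw [le_div_iff₀ (by positivity)]; linarith
    refine h5.trans ?_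
    rw [div_pow, one_pow, hn']
    apply one_div_le_one_div_of_le (by positivity)
    nlinarith [sq_nonneg ((s:ℝ)), pow_le_pow_left₀ (by norm_num) hs 2]
  · refine (base_true p R (144 * W) hp h1 hR0 hnpos (by positivity)).trans ?_
    have a1 : (n:ℝ) * (2 * R / p + 1) / (144 * W) = 1 / 144 := by
      rw [← hW]; field_simp
    have a2 : 128 * ((n:ℝ) * (2 * R / p + 1)) / (p * n)^2 ≤ 1 / 144 := by
      rw [← hW, div_le_div_iff₀ (by positivity) (by norm_num), hn']
      have : 128 * 144 * c2 ≤ p ^ 2 * s := by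
        have := (div_le_iff₀ (by positivity : 0 < p^2)).mp (by linarith : 128 * 144 * c2 / p^2 ≤ (s:ℝ))
        linarith
      calc 128 * W * 144 ≤ 128 * 144 * c2 * (s:ℝ)^3 := by nlinarith
        _ ≤ p^2 * s * (s:ℝ)^3 := by gcongr
        _ = _ := by ring
    have a3 : 4 / (p * n) ≤ 1 / 144 := by
      rw [div_le_div_iff₀ (by positivity) (by norm_num), hn']
      have := (div_le_iff₀ hp).mp hs3
      nlinarith
    have a4 : 4 * n / R ^ 2 ≤ 1 / 144 := by
      rw [hR, hn', hκ, div_le_div_iff₀ (by positivity) (by norm_num)]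
      have : (24 / p) ≥ 24 := by rw [ge_iff_le, le_div_iff₀ hp]; linarith
      nlinarith [mul_le_mul this this (by norm_num) (by positivity), sq_nonneg (s:ℝ)]
    linarith

def Seg (lam : ℕ) (Bs : List Bool → List Bool → Prop) : ℕ → ℕ → List Bool → List Bool → Prop
  | 0, _, _, y => y = []
  | N + 1, 0, u, y => ∃ y1 y2, y = y1 ++ y2 ∧ y1.length ≤ lam ∧
      (Bs (u.take lam) y1 ∧ Seg lam Bs N 0 (u.drop lam) y2)
  | N + 1, m + 1, u, y => ∃ y1 y2, y = y1 ++ y2 ∧ y1.length ≤ lam ∧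
      ((Bs (u.take lam) y1 ∧ Seg lam Bs N (m+1) (u.drop lam) y2) ∨ Seg lam Bs N m (u.drop lam) y2)

lemma Seg_len (lam : ℕ) (Bs : List Bool → List Bool → Prop) (N m : ℕ) (u y : List Bool)
    (h : Seg lam Bs N m u y) : y.length ≤ lam * N := by
  induction N generalizing m u y with
  | zero => simp only [Seg] at h; simp [h]
  | succ N ih =>
    rw [Nat.mul_succ]
    cases m with
    | zero =>
      obtain ⟨y1, y2, rfl, h1, h2, h3⟩ := h
      have := ih _ _ _ h3
      simp; omega
    | succ m =>
      obtain ⟨y1, y2, rfl, h1, ⟨h2, h3⟩ | h3⟩ := h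
      all_goals have := ih _ _ _ h3; simp; omega

section
variable {lam : ℕ} {Bs : List Bool → List Bool → Prop}

lemma split_bound (y : List Bool) (lam : ℕ) (P : List Bool → List Bool → Prop) :
    ind (∃ y1 y2, y = y1 ++ y2 ∧ y1.length ≤ lam ∧ P y1 y2) ≤
      ∑ i ∈ Finset.range (lam + 1), ind (P (y.take i) (y.drop i)) := by
  refine (ind_mono ?_).trans (ind_exists_le _ _)
  rintro ⟨y1, y2, rfl, h1, h2⟩
  exact ⟨y1.length, by simp; omega, by simpa using h2⟩

lemma Seg_false (d : ℝ) (hd : 0 < d) (hd1 : d ≤ 1)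
    (hB : ∀ y, Eun lam (fun u => ind (Bs u y)) ≤ d) (N m : ℕ) (y : List Bool) :
    Eun (lam * N) (fun u => ind (Seg lam Bs N m u y)) ≤ (2 * (lam + 1)) ^ N * d ^ N * (1 / d) ^ m := by
  induction N generalizing m y with
  | zero =>
    refine Eun_le _ _ _ fun u _ => (ind_le_one _).trans ?_
    simp only [pow_zero, one_mul]
    exact one_le_pow₀ (by rw [le_div_iff₀ hd]; linarith)
  | succ N ih =>
    have hpass : ∀ (m : ℕ) (y1 y2 : List Bool), Eun lam (fun u1 => Eun (lam * N) (fun u2 =>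
        ind (Bs u1 y1 ∧ Seg lam Bs N m u2 y2))) ≤ d * ((2 * (lam + 1)) ^ N * d ^ N * (1 / d) ^ m) := by
      intro m y1 y2
      have : ∀ u1, Eun (lam * N) (fun u2 => ind (Bs u1 y1 ∧ Seg lam Bs N m u2 y2))
          ≤ ((2 * (lam + 1)) ^ N * d ^ N * (1 / d) ^ m) * ind (Bs u1 y1) := by
        intro u1
        by_cases h : Bs u1 y1
        · rw [ind_true h, mul_one]; simp only [h, true_and]; exact ih m y2
        · rw [ind_false h, mul_zero]; simp only [h, false_and]
          simp [ind_false, Eun_const]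
      refine (Eun_mono _ _ _ fun u1 _ => this u1).trans ?_
      rw [Eun_mul_left, mul_comm]
      gcongr
      exact hB y1
    have hsplit : ∀ (g : List Bool → ℝ), Eun (lam * (N+1)) g
      = Eun lam (fun a => Eun (lam * N) (fun b => g (a ++ b))) := by
      intro g; rw [Nat.mul_succ, add_comm, Eun_append]
    rw [hsplit]
    cases m with
    | zero =>
      calc _ ≤ Eun lam (fun a => Eun (lam * N) (fun b => ∑ i ∈ Finset.range (lam+1),
            ind (Bs a (y.take i) ∧ Seg lam Bs N 0 b (y.drop i)))) := by
              refine Eun_mono _ _ _ fun a ha => Eun_mono _ _ _ fun b _ => ?_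
              have e1 : (a ++ b).take lam = a := by rw [← ha]; simp
              have e2 : (a ++ b).drop lam = b := by rw [← ha]; simp
              simp only [Seg, e1, e2]
              exact split_bound y lam _
        _ = ∑ i ∈ Finset.range (lam+1), Eun lam (fun a => Eun (lam * N) (fun b =>
            ind (Bs a (y.take i) ∧ Seg lam Bs N 0 b (y.drop i)))) := by
              simp only [Eun_sum]
        _ ≤ ∑ i ∈ Finset.range (lam+1), d * ((2 * (lam + 1)) ^ N * d ^ N * (1 / d) ^ 0) :=
              Finset.sum_le_sum fun i _ => hpass 0 _ _
        _ = (lam + 1) * (d * ((2 * (lam + 1)) ^ N * d ^ N * (1 / d) ^ 0)) := by simp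
        _ ≤ _ := by
              rw [pow_succ, pow_succ]
              have : 0 ≤ (2 * ((lam:ℝ) + 1)) ^ N * d ^ N * (1 / d) ^ 0 * ((lam + 1) * d) := by positivity
              linarith
    | succ m =>
      calc _ ≤ Eun lam (fun a => Eun (lam * N) (fun b => ∑ i ∈ Finset.range (lam+1),
            (ind (Bs a (y.take i) ∧ Seg lam Bs N (m+1) b (y.drop i)) + ind (Seg lam Bs N m b (y.drop i))))) := by
              refine Eun_mono _ _ _ fun a ha => Eun_mono _ _ _ fun b _ => ?_
              have e1 : (a ++ b).take lam = a := by rw [← ha]; simp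
              have e2 : (a ++ b).drop lam = b := by rw [← ha]; simp
              simp only [Seg, e1, e2]
              exact (split_bound y lam _).trans (Finset.sum_le_sum fun i _ => ind_or _ _)
        _ = ∑ i ∈ Finset.range (lam+1), (Eun lam (fun a => Eun (lam * N) (fun b =>
            ind (Bs a (y.take i) ∧ Seg lam Bs N (m+1) b (y.drop i)))) +
            Eun (lam * N) (fun b => ind (Seg lam Bs N m b (y.drop i)))) := by
              simp only [Eun_sum, Eun_add, Eun_const]
        _ ≤ ∑ i ∈ Finset.range (lam+1), (d * ((2 * (lam + 1)) ^ N * d ^ N * (1 / d) ^ (m+1)) +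
              (2 * (lam + 1)) ^ N * d ^ N * (1 / d) ^ m) :=
              Finset.sum_le_sum fun i _ => add_le_add (hpass _ _ _) (ih _ _)
        _ = (lam + 1) * ((d * ((2 * (lam + 1)) ^ N * d ^ N * (1 / d) ^ (m+1)) +
              (2 * (lam + 1)) ^ N * d ^ N * (1 / d) ^ m)) := by simp [mul_add]
        _ = _ := by
              rw [pow_succ, pow_succ, pow_succ]
              field_simp
              ring

lemma Seg_true {p : ℝ} (hp0 : 0 ≤ p) (hp1 : p ≤ 1) (d : ℝ) (hd : 0 ≤ d)
    (hB : Eun lam (fun u => Etr p u (fun y => ind (¬ Bs u y))) ≤ d) (N m : ℕ) :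
    Eun (lam * N) (fun u => Etr p u (fun y => ind (¬ Seg lam Bs N m u y))) ≤ 2 ^ N * d ^ (m + 1) := by
  induction N generalizing m with
  | zero =>
    simp only [Nat.mul_zero, Eun, Etr, Seg]
    rw [ind_false (by simp)]; positivity
  | succ N ih =>
    have hsplit : ∀ (g : List Bool → List Bool → ℝ), Eun (lam * (N+1)) (fun u => Etr p u (g u))
      = Eun lam (fun a => Eun (lam * N) (fun b => Etr p a (fun y1 => Etr p b (fun y2 => g (a ++ b) (y1 ++ y2))))) := by
      intro g; rw [Nat.mul_succ, add_comm, Eun_append]; simp only [Etr_append]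
    rw [hsplit]
    cases m with
    | zero =>
      calc _ ≤ Eun lam (fun a => Eun (lam * N) (fun b => Etr p a (fun y1 => Etr p b (fun y2 =>
              ind (¬ Bs a y1) + ind (¬ Seg lam Bs N 0 b y2))))) := by
              refine Eun_mono _ _ _ fun a ha => Eun_mono _ _ _ fun b _ => Etr_mono' hp0 hp1 _ _ _ fun y1 hy1 =>
                Etr_mono hp0 hp1 _ _ _ fun y2 => ?_
              have e1 : (a ++ b).take lam = a := by rw [← ha]; simp
              have e2 : (a ++ b).drop lam = b := by rw [← ha]; simp
              apply ind_imp_or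
              intro h
              by_contra hc
              push Not at hc
              apply h
              exact ⟨y1, y2, rfl, by omega, by rw [e1]; exact hc.1, by rw [e2]; exact hc.2⟩
        _ = Eun lam (fun u => Etr p u (fun y => ind (¬ Bs u y))) +
            Eun (lam * N) (fun u => Etr p u (fun y => ind (¬ Seg lam Bs N 0 u y))) := by
              simp only [Etr_add, Eun_add, Etr_const, Eun_const]
        _ ≤ d + 2 ^ N * d ^ (0 + 1) := add_le_add hB (ih 0)
        _ ≤ _ := by
              have : (1:ℝ) ≤ 2 ^ N := one_le_pow₀ (by norm_num)
              rw [pow_succ (2:ℝ)]; simp; nlinarith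
    | succ m =>
      calc _ ≤ Eun lam (fun a => Eun (lam * N) (fun b => Etr p a (fun y1 => Etr p b (fun y2 =>
              ind (¬ Seg lam Bs N (m+1) b y2) + ind (¬ Bs a y1) * ind (¬ Seg lam Bs N m b y2))))) := by
              refine Eun_mono _ _ _ fun a ha => Eun_mono _ _ _ fun b _ => Etr_mono' hp0 hp1 _ _ _ fun y1 hy1 =>
                Etr_mono hp0 hp1 _ _ _ fun y2 => ?_
              have e1 : (a ++ b).take lam = a := by rw [← ha]; simp
              have e2 : (a ++ b).drop lam = b := by rw [← ha]; simp
              have h0 := mul_nonneg (ind_nonneg (¬ Bs a y1)) (ind_nonneg (¬ Seg lam Bs N m b y2))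
              have h00 := ind_nonneg (¬ Seg lam Bs N (m+1) b y2)
              by_cases hS : Seg lam Bs (N+1) (m+1) (a ++ b) (y1 ++ y2)
              · rw [ind_false (by simpa using hS)]; linarith
              by_cases h1 : Seg lam Bs N (m+1) b y2
              · have h2 : ¬ Bs a y1 := fun h => hS ⟨y1, y2, rfl, by omega, Or.inl ⟨by rwa [e1], by rwa [e2]⟩⟩
                have h3 : ¬ Seg lam Bs N m b y2 := fun h => hS ⟨y1, y2, rfl, by omega, Or.inr (by rwa [e2])⟩
                rw [ind_true hS, ind_true h2, ind_true h3]; linarith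
              · rw [ind_true h1, ind_true hS]; linarith
        _ = Eun (lam * N) (fun u => Etr p u (fun y => ind (¬ Seg lam Bs N (m+1) u y))) +
            Eun lam (fun u => Etr p u (fun y => ind (¬ Bs u y))) *
            Eun (lam * N) (fun u => Etr p u (fun y => ind (¬ Seg lam Bs N m u y))) := by
              have e : ∀ a b, Etr p a (fun y1 => ind (¬ Bs a y1) * Etr p b (fun y2 => ind (¬ Seg lam Bs N m b y2)))
                = Etr p a (fun y1 => ind (¬ Bs a y1)) * Etr p b (fun y2 => ind (¬ Seg lam Bs N m b y2)) := by
                intro a b; simp only [mul_comm _ (Etr p b _)]; rw [Etr_mul_left]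
              have e' : ∀ c : ℝ, Eun lam (fun a => Etr p a (fun y1 => ind (¬ Bs a y1)) * c)
                = Eun lam (fun a => Etr p a (fun y1 => ind (¬ Bs a y1))) * c := by
                intro c; simp only [mul_comm _ c]; rw [Eun_mul_left]
              simp only [Etr_add, Eun_add, Etr_const, Eun_const, Etr_mul_left, e, Eun_mul_left, e']
        _ ≤ 2 ^ N * d ^ (m + 1 + 1) + d * (2 ^ N * d ^ (m + 1)) := by
              refine add_le_add (ih _) (mul_le_mul hB (ih _) ?_ hd)
              exact Eun_nonneg _ _ fun u => Etr_nonneg hp0 hp1 _ _ fun y => ind_nonneg _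
        _ = _ := by ring

end

/-- The test lemma. -/
lemma test_exists (p : ℝ) (hp : 0 < p) (h1 : p ≤ 1) : ∃ (lam : ℕ) (E : List Bool → List Bool → Prop),
    1 ≤ lam ∧ (∀ u y, E u y → y.length ≤ u.length) ∧
    (∀ (N : ℕ) y, Eun (lam * N) (fun u => ind (E u y)) ≤ Real.exp (-N)) ∧
    (∀ (N : ℕ), Eun (lam * N) (fun u => Etr p u (fun y => ind (¬ E u y))) ≤ Real.exp (-N)) := by
  obtain ⟨lam, Bs, hlam, hlen, hf, ht⟩ := base_exists p hp h1
  have h3 : ∀ N : ℕ, (1/3:ℝ) ^ N ≤ Real.exp (-N) := by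
    intro N
    have : Real.exp (-N) = (Real.exp (-1)) ^ N := by rw [← Real.exp_nat_mul]; congr 1; ring
    rw [this]
    have h := Real.exp_one_lt_d9
    have h' : (1/3:ℝ) ≤ Real.exp (-1) := by
      rw [Real.exp_neg, ← one_div]
      apply one_div_le_one_div_of_le (Real.exp_pos _); linarith
    gcongr
  have hq : ∀ (N : ℕ) (u : List Bool), u.length = lam * N → u.length / lam = N := by
    intro N u h; rw [h]; exact Nat.mul_div_cancel_left _ hlam
  refine ⟨lam, fun u y => Seg lam Bs (u.length / lam) (u.length / lam / 2) u y, hlam, ?_, ?_, ?_⟩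
  · intro u y h
    exact (Seg_len _ _ _ _ _ _ h).trans (Nat.mul_div_le _ _)
  · intro N y
    have hD : (0:ℝ) < 6 * (lam + 1) := by positivity
    have hd1 : (1 / (6 * ((lam:ℝ) + 1))) ^ 2 ≤ 1 := by
      apply pow_le_one₀ (by positivity)
      rw [div_le_one hD]; have : (0:ℝ) ≤ lam := by positivity
      linarith
    have h := Seg_false ((1 / (6 * ((lam:ℝ) + 1))) ^ 2) (by positivity) hd1 hf N (N/2) y
    calc _ ≤ Eun (lam * N) (fun u => ind (Seg lam Bs N (N/2) u y)) :=
          Eun_mono _ _ _ fun u hu => by dsimp only; rw [hq N u hu]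
      _ ≤ _ := h
      _ ≤ (1/3) ^ N := by
          rw [mul_assoc]
          have e : ((1 / (6 * ((lam:ℝ) + 1))) ^ 2) ^ N * (1 / (1 / (6 * ((lam:ℝ) + 1))) ^ 2) ^ (N/2)
            ≤ (1 / (6 * ((lam:ℝ) + 1))) ^ N := by
            have e1 : (1 / (1 / (6 * ((lam:ℝ) + 1))) ^ 2) ^ (N/2) ≤ (6 * ((lam:ℝ) + 1)) ^ N := by
              have : (1 / (1 / (6 * ((lam:ℝ) + 1))) ^ 2) ^ (N/2) = (6 * ((lam:ℝ) + 1)) ^ (2 * (N/2)) := by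
                rw [pow_mul]; congr 1; field_simp
              rw [this]
              apply pow_le_pow_right₀
              · have : (0:ℝ) ≤ lam := by positivity
                linarith
              · omega
            calc _ ≤ ((1 / (6 * ((lam:ℝ) + 1))) ^ 2) ^ N * (6 * ((lam:ℝ) + 1)) ^ N := by gcongr
              _ = _ := by rw [← mul_pow]; congr 1; field_simp
          calc _ ≤ (2 * ((lam:ℝ) + 1)) ^ N * (1 / (6 * ((lam:ℝ) + 1))) ^ N := by gcongr
            _ = _ := by rw [← mul_pow]; congr 1; field_simp; norm_num
      _ ≤ _ := h3 N
  · intro N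
    have h := Seg_true hp.le h1 (1/36) (by norm_num) ht N (N/2)
    calc _ ≤ Eun (lam * N) (fun u => Etr p u (fun y => ind (¬ Seg lam Bs N (N/2) u y))) :=
          Eun_mono _ _ _ fun u hu => by dsimp only; rw [hq N u hu]
      _ ≤ _ := h
      _ ≤ 2 ^ N * (1/6) ^ N := by
          gcongr
          have : (1/36:ℝ) ^ (N/2+1) = (1/6) ^ (2 * (N/2+1)) := by rw [pow_mul]; norm_num
          rw [this]
          exact pow_le_pow_of_le_one (by norm_num) (by norm_num) (by omega)
      _ = (1/3) ^ N := by rw [← mul_pow]; norm_num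
      _ ≤ _ := h3 N

lemma prim_prod {n : ℕ} {μ : ℂ} (hμ : IsPrimitiveRoot μ (n + 1)) (x : ℂ) :
    ∏ k ∈ Finset.range n, (x - μ ^ (k + 1)) = ∑ i ∈ Finset.range (n + 1), x ^ i := by
  have := X_pow_sub_C_eq_prod hμ n.zero_lt_succ (one_pow (n + 1))
  rw [Polynomial.C_1, ← mul_geom_sum, Finset.prod_range_succ', pow_zero, mul_one, mul_comm, eq_comm] at this
  replace this := mul_right_cancel₀ (Polynomial.X_sub_C_ne_zero 1) this
  apply_fun Polynomial.eval x at this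
  simpa only [mul_one, map_pow, Polynomial.eval_prod, Polynomial.eval_sub, Polynomial.eval_X,
    Polynomial.eval_pow, Polynomial.eval_C, Polynomial.eval_geom_sum] using this

lemma geom_ge {n : ℕ} (α : ℝ) (hα : |α| ≤ Real.pi / (n + 1)) :
    1 ≤ ‖∑ i ∈ Finset.range (n + 1), Complex.exp (Complex.I * α) ^ i‖ := by
  set ζ := Complex.exp (Complex.I * α) with hζ
  have hn : (0:ℝ) < n + 1 := by positivity
  by_cases h1 : ζ = 1
  · rw [h1]
    have : ∑ i ∈ Finset.range (n+1), (1:ℂ) ^ i = ((n + 1 : ℕ) : ℂ) := by simp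
    rw [this, Complex.norm_natCast]; push_cast
    have : (0:ℝ) ≤ n := by positivity
    linarith
  · rw [geom_sum_eq h1, norm_div]
    have h0 : 0 < ‖ζ - 1‖ := norm_pos_iff.mpr (sub_ne_zero.mpr h1)
    rw [le_div_iff₀ h0, one_mul]
    have e2 : ζ ^ (n+1) = Complex.exp (Complex.I * (((n+1) * α : ℝ) : ℂ)) := by
      rw [hζ, ← Complex.exp_nat_mul]; congr 1; push_cast; ring
    rw [e2, hζ, Complex.norm_exp_I_mul_ofReal_sub_one, Complex.norm_exp_I_mul_ofReal_sub_one]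
    rw [norm_mul, norm_mul]
    gcongr
    have ha : |(n+1) * α| ≤ Real.pi := by
      rw [abs_mul, abs_of_pos hn]
      rw [le_div_iff₀ hn] at hα; linarith
    have hb : |α| ≤ |(n+1) * α| := by
      rw [abs_mul, abs_of_pos hn]
      have : (0:ℝ) ≤ n := by positivity
      nlinarith [abs_nonneg α]
    have key : ∀ x : ℝ, |x| ≤ Real.pi → ‖Real.sin (x/2)‖ = Real.sin (|x|/2) := by
      intro x hx
      rw [Real.norm_eq_abs, Real.abs_sin_eq_sin_abs_of_abs_le_pi, abs_div, abs_two]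
      rw [abs_div, abs_two]; linarith [abs_nonneg x]
    rw [key α (hb.trans ha), key _ ha]
    apply Real.sin_le_sin_of_le_of_le_pi_div_two
    · linarith [abs_nonneg α, Real.pi_pos]
    · linarith
    · linarith

lemma half_sum_bound (ξ : ℂ) (h : ‖ξ‖ = 1) : ‖1 - ξ‖ ^ 2 / 8 ≤ 1 - ‖1 + ξ‖ / 2 := by
  have e := parallelogram_law_with_norm ℝ (1:ℂ) ξ
  rw [h, norm_one] at e
  nlinarith [sq_nonneg (‖1+ξ‖ - 2)]

lemma analytic_core (n : ℕ) (Q : ℂ → ℂ) (hQ : Differentiable ℂ Q) (h0 : ‖Q 0‖ = 1)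
    (hb : ∀ w, ‖w‖ < 1 → ‖Q w‖ ≤ 1 / (1 - ‖w‖)) (ρ : ℝ) (hρ : 0 ≤ ρ) (hρ1 : ρ ≤ 1) :
    ∃ α : ℝ, |α| ≤ Real.pi / (n + 1) ∧
      (1/8:ℝ) ^ (n+1) ≤ ‖Q (ρ * (Complex.exp (Complex.I * α) * ((1 + Complex.exp (Complex.I * α)) / 2)))‖ := by
  set f : ℂ → ℂ := fun ζ => Q (ρ * (ζ * ((1 + ζ) / 2))) with hf
  have hfd : Differentiable ℂ f := by
    apply hQ.comp; fun_prop
  set μ : ℂ := Complex.exp (2 * Real.pi * Complex.I / ((n + 1 : ℕ) : ℂ)) with hμ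
  have hprim : IsPrimitiveRoot μ (n+1) := Complex.isPrimitiveRoot_exp (n+1) (by omega)
  have hμ1 : ‖μ‖ = 1 := hprim.norm'_eq_one (by omega)
  have hμ0 : μ ≠ 0 := by intro h; rw [h] at hμ1; simp at hμ1
  set F : ℂ → ℂ := fun ζ => ∏ k ∈ Finset.range (n+1), f (ζ / μ ^ k) with hF
  have hFd : Differentiable ℂ F := by
    intro ζ
    have : F = ∏ k ∈ Finset.range (n+1), fun ζ => f (ζ / μ ^ k) := by
      funext x; simp [hF]
    rw [this]
    apply DifferentiableAt.finsetProd
    intro k _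
    exact (hfd _).comp ζ (by fun_prop)
  obtain ⟨ζ0, hz1, hz2⟩ := Complex.exists_mem_frontier_isMaxOn_norm (f := F) (U := Metric.ball 0 1)
    Metric.isBounded_ball ⟨0, by simp⟩ hFd.diffContOnCl
  rw [frontier_ball _ one_ne_zero] at hz1
  have hz1' : ‖ζ0‖ = 1 := by simpa using hz1
  have hF0 : ‖F 0‖ = 1 := by
    simp [hF, hf, h0]
  have hFz : 1 ≤ ‖F ζ0‖ := by
    have := hz2 (show (0:ℂ) ∈ closure (Metric.ball 0 1) from subset_closure (by simp))
    simpa [hF0] using this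
  have hshift1 : ∀ ζ, F (ζ / μ) = F ζ := by
    intro ζ
    simp only [hF]
    rw [Finset.prod_range_succ, Finset.prod_range_succ']
    have e1 : ζ / μ / μ ^ n = ζ / μ ^ 0 := by
      rw [div_div, ← pow_succ', hprim.pow_eq_one, pow_zero]
    rw [e1]
    congr 1
    refine Finset.prod_congr rfl fun k _ => ?_
    rw [div_div, ← pow_succ']
  have hshift : ∀ (j : ℕ) ζ, F (ζ / μ ^ j) = F ζ := by
    intro j
    induction j with
    | zero => intro ζ; simp
    | succ j ih => intro ζ; rw [pow_succ, ← div_div, hshift1, ih]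
  set θ := Complex.arg ζ0 + 2 * Real.pi with hθ
  have hθ0 : 0 ≤ θ := by
    have := Complex.neg_pi_lt_arg ζ0; have := Real.pi_pos; rw [hθ]; linarith
  have hζθ : ζ0 = Complex.exp (Complex.I * θ) := by
    have h := Complex.norm_mul_exp_arg_mul_I ζ0
    rw [hz1'] at h
    rw [← h, hθ]; push_cast
    rw [mul_add, Complex.exp_add]
    have : Complex.exp (Complex.I * (2 * Real.pi)) = 1 := by
      rw [mul_comm]; exact Complex.exp_two_pi_mul_I
    rw [this, mul_comm Complex.I]; simp
  have hn : (0:ℝ) < n + 1 := by positivity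
  set j := (round (θ * (n+1) / (2 * Real.pi))).toNat with hj
  set α := θ - 2 * Real.pi * j / (n+1) with hα
  have hround : |θ * (n+1) / (2 * Real.pi) - j| ≤ 1/2 := by
    have h := abs_sub_round (θ * (n+1) / (2 * Real.pi))
    have h3 : 0 ≤ round (θ * (n+1) / (2 * Real.pi)) := by
      have h4 : (0:ℝ) ≤ θ * (n+1) / (2 * Real.pi) := by positivity
      rw [round_eq]
      apply Int.floor_nonneg.mpr; linarith
    have h5 : ((j : ℕ) : ℝ) = ((round (θ * (n+1) / (2 * Real.pi)) : ℤ) : ℝ) := by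
      rw [hj, ← Int.cast_natCast, Int.toNat_of_nonneg h3]
    rw [h5]; exact h
  have hαb : |α| ≤ Real.pi / (n+1) := by
    have e : α = (2 * Real.pi / (n+1)) * (θ * (n+1) / (2 * Real.pi) - j) := by
      rw [hα]; field_simp
    have hpos : 0 < 2 * Real.pi / (n+1) := by positivity
    rw [e, abs_mul, abs_of_pos hpos]
    calc _ ≤ (2 * Real.pi / (n+1)) * (1/2) := by gcongr
      _ = _ := by ring
  set ζ := Complex.exp (Complex.I * α) with hζ
  have hζj : ζ = ζ0 / μ ^ j := by
    rw [hζ, hζθ, hμ, ← Complex.exp_nat_mul, ← Complex.exp_sub, hα]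
    congr 1; push_cast
    ring
  have hζ1 : ‖ζ‖ = 1 := by rw [hζj, norm_div, norm_pow, hμ1, hz1']; simp
  refine ⟨α, hαb, ?_⟩
  have hFζ : 1 ≤ ‖F ζ‖ := by rw [hζj, hshift]; exact hFz
  have hprod : 1 ≤ ∏ k ∈ Finset.range n, ‖1 - ζ / μ ^ (k+1)‖ := by
    have h := geom_ge (n := n) α hαb
    rw [← hζ, ← prim_prod hprim, norm_prod] at h
    refine h.trans (le_of_eq (Finset.prod_congr rfl fun k _ => ?_))
    have : 1 - ζ / μ ^ (k+1) = - ((ζ - μ ^ (k+1)) / μ ^ (k+1)) := by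
      have := pow_ne_zero (k+1) hμ0
      field_simp; ring
    rw [this, norm_neg, norm_div, norm_pow, hμ1]; simp
  have hne : ∀ k ∈ Finset.range n, 0 < ‖1 - ζ / μ ^ (k+1)‖ := by
    intro k hk
    rcases (norm_nonneg (1 - ζ / μ ^ (k+1))).eq_or_lt with h | h
    · rw [Finset.prod_eq_zero hk h.symm] at hprod; linarith
    · exact h
  have hfb : ∀ k ∈ Finset.range n, ‖f (ζ / μ ^ (k+1))‖ ≤ 8 / ‖1 - ζ / μ ^ (k+1)‖ ^ 2 := by
    intro k hk
    set ξ := ζ / μ ^ (k+1) with hξ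
    have hξ1 : ‖ξ‖ = 1 := by rw [hξ, norm_div, norm_pow, hμ1, hζ1]; simp
    have h2 := half_sum_bound ξ hξ1
    have h3 : 0 < ‖1 - ξ‖ ^ 2 / 8 := by have := hne k hk; positivity
    have hw : ‖(ρ:ℂ) * (ξ * ((1 + ξ) / 2))‖ ≤ ‖1 + ξ‖ / 2 := by
      rw [norm_mul, norm_mul, hξ1, norm_div, Complex.norm_real, Real.norm_of_nonneg hρ]
      simp only [Complex.norm_ofNat, one_mul]
      exact mul_le_of_le_one_left (by positivity) hρ1
    have h4 : ‖1 - ξ‖ ^ 2 / 8 ≤ 1 - ‖(ρ:ℂ) * (ξ * ((1 + ξ) / 2))‖ := by linarith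
    refine (hb _ (by linarith)).trans ?_
    refine (one_div_le_one_div_of_le h3 h4).trans (le_of_eq ?_)
    rw [one_div_div]
  have hsplit : ‖F ζ‖ = (∏ k ∈ Finset.range n, ‖f (ζ / μ ^ (k+1))‖) * ‖f ζ‖ := by
    simp only [hF]; rw [Finset.prod_range_succ', norm_mul, norm_prod]; simp
  have hP : (∏ k ∈ Finset.range n, ‖f (ζ / μ ^ (k+1))‖) ≤ 8 ^ n := by
    calc _ ≤ ∏ k ∈ Finset.range n, (8 / ‖1 - ζ / μ ^ (k+1)‖ ^ 2) :=
          Finset.prod_le_prod (fun _ _ => norm_nonneg _) hfb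
      _ = 8 ^ n / (∏ k ∈ Finset.range n, ‖1 - ζ / μ ^ (k+1)‖) ^ 2 := by
          rw [Finset.prod_div_distrib, Finset.prod_const, Finset.card_range, Finset.prod_pow]
      _ ≤ 8 ^ n := by
          apply div_le_self (by positivity)
          exact one_le_pow₀ hprod
  rw [hsplit] at hFζ
  have hfin : 1 ≤ 8 ^ n * ‖f ζ‖ := hFζ.trans (by gcongr)
  change (1/8:ℝ) ^ (n+1) ≤ ‖f ζ‖
  have h8 : (0:ℝ) < 8 ^ n := by positivity
  rw [one_div, inv_pow, inv_le_iff_one_le_mul₀ (by positivity), pow_succ]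
  nlinarith [norm_nonneg (f ζ)]

set_option maxHeartbeats 1000000 in
lemma analytic (p : ℝ) (hp : 0 < p) (hp1 : p ≤ 1) (K : ℕ) (hK : 250 / p ≤ K) (Q : ℂ → ℂ)
    (hQ : Differentiable ℂ Q) (h0 : ‖Q 0‖ = 1)
    (hb : ∀ w, ‖w‖ < 1 → ‖Q w‖ ≤ 1 / (1 - ‖w‖)) :
    ∃ z w : ℂ, w = (1 - p : ℝ) + (p : ℝ) * z ∧ ‖z‖ ≤ 1 - 12 / (K:ℝ) ^ 2 ∧ ‖w‖ ≤ 1 ∧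
      1 - (25 / p + 3) / (K:ℝ) ^ 2 ≤ ‖w‖ ∧ ‖w - 1‖ ≤ 6 / K ∧ (1/8:ℝ) ^ K ≤ ‖Q w‖ := by
  have hK250 : (250:ℝ) ≤ K := by
    have : 250 ≤ 250 / p := by rw [le_div_iff₀ hp]; linarith
    linarith
  have hKp : 250 ≤ p * K := by rw [div_le_iff₀ hp] at hK; linarith
  have hK0 : (0:ℝ) < K := by linarith
  obtain ⟨n, rfl⟩ : ∃ n, K = n + 1 := ⟨K - 1, by
    have : 0 < K := by exact_mod_cast hK0
    omega⟩
  set k : ℝ := ((n+1 : ℕ) : ℝ) with hk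
  have hkn : (n:ℝ) + 1 = k := by rw [hk]; push_cast; ring
  set t := 25 / p / k ^ 2 with ht
  have ht0 : 0 ≤ t := by positivity
  have htp : t * p * k ^ 2 = 25 := by rw [ht]; field_simp
  have htk : t * k ≤ 1/10 := by
    have : t * k = 25 / (p * k) := by rw [ht]; field_simp
    rw [this, div_le_div_iff₀ (by linarith) (by norm_num)]; linarith
  have ht1 : t ≤ 1 := by
    have h3 := mul_le_mul_of_nonneg_left hK250 ht0
    linarith
  obtain ⟨α, hα, hge⟩ := analytic_core n Q hQ h0 hb (1 - t) (by linarith) (by linarith)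
  rw [hkn] at hα
  set ζ := Complex.exp (Complex.I * α) with hζ
  have hζ1 : ‖ζ‖ = 1 := by rw [hζ, mul_comm]; exact Complex.norm_exp_ofReal_mul_I α
  set w0 := ζ * ((1 + ζ) / 2) with hw0
  set w : ℂ := ((1 - t : ℝ) : ℂ) * w0 with hw
  have hζd : ‖ζ - 1‖ ≤ |α| := by
    rw [hζ]; exact Real.norm_exp_I_mul_ofReal_sub_one_le
  have hαk : |α| * k ≤ Real.pi := by rwa [le_div_iff₀ hK0] at hα
  have hpi := Real.pi_lt_d2
  have hαk' : ‖ζ - 1‖ * k ≤ 3.15 := by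
    have h3 := mul_le_mul_of_nonneg_right hζd hK0.le
    linarith
  have hw0n : ‖w0‖ = ‖1 + ζ‖ / 2 := by rw [hw0, norm_mul, hζ1, norm_div]; simp
  have hpar : ‖1 + ζ‖ ^ 2 + ‖ζ - 1‖ ^ 2 = 4 := by
    have e := parallelogram_law_with_norm ℝ (1:ℂ) ζ
    rw [hζ1, norm_one, norm_sub_rev] at e
    nlinarith
  have hw0le : ‖w0‖ ≤ 1 := by
    have h3 := norm_add_le (1:ℂ) ζ
    rw [hζ1, norm_one] at h3
    rw [hw0n]; linarith
  have hw0ge : 1 - ‖ζ - 1‖ ^ 2 / 4 ≤ ‖w0‖ := by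
    have : ‖w0‖ ^ 2 ≤ ‖w0‖ := by
      rw [sq]; exact mul_le_of_le_one_left (norm_nonneg _) hw0le
    rw [hw0n] at this ⊢; linarith [hpar, this, (by ring : (‖1 + ζ‖ / 2)^2 = ‖1+ζ‖^2/4)]
  have hwn : ‖w‖ = (1 - t) * ‖w0‖ := by
    rw [hw, norm_mul, Complex.norm_real, Real.norm_of_nonneg (by linarith)]
  have hw01 : ‖w0 - 1‖ ≤ 3 / 2 * ‖ζ - 1‖ := by
    have e : w0 - 1 = (ζ - 1) * ((ζ + 2) / 2) := by rw [hw0]; ring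
    rw [e, norm_mul, norm_div]
    have : ‖ζ + 2‖ ≤ 3 := (norm_add_le _ _).trans (by rw [hζ1]; simp; norm_num)
    simp only [Complex.norm_ofNat]
    have h3 := mul_le_mul_of_nonneg_left this (norm_nonneg (ζ - 1))
    linarith
  have hw1 : ‖w - 1‖ ≤ t + 3/2 * ‖ζ - 1‖ := by
    have e : w - 1 = (w0 - 1) - (t:ℂ) * w0 := by rw [hw]; push_cast; ring
    rw [e]
    refine (norm_sub_le _ _).trans ?_
    rw [norm_mul, Complex.norm_real, Real.norm_of_nonneg ht0]
    have h3 := mul_le_mul_of_nonneg_left hw0le ht0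
    linarith
  have hw1k : ‖w - 1‖ * k ≤ 4.85 := by
    have h3 := mul_le_mul_of_nonneg_right hw1 hK0.le
    linarith
  have hre : w.re - 1 ≤ - t := by
    have : w.re = (1 - t) * w0.re := by rw [hw, Complex.re_ofReal_mul]
    have h2 : w0.re ≤ 1 := (Complex.re_le_norm w0).trans hw0le
    have h3 := mul_le_mul_of_nonneg_left h2 (by linarith : 0 ≤ 1 - t)
    linarith
  refine ⟨1 + (w - 1) / (p:ℂ), w, ?_, ?_, ?_, ?_, ?_, ?_⟩
  · have : (p:ℂ) ≠ 0 := by exact_mod_cast hp.ne'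
    push_cast; field_simp; ring
  · have e : ‖1 + (w - 1) / (p:ℂ)‖ ^ 2 = 1 + 2 * (w.re - 1) / p + ‖w - 1‖ ^ 2 / p ^ 2 := by
      have hh : (w - 1) / (p:ℂ) = ((1/p : ℝ) : ℂ) * (w - 1) := by push_cast; ring
      rw [hh, ← Complex.normSq_eq_norm_sq, ← Complex.normSq_eq_norm_sq, Complex.normSq_apply, Complex.normSq_apply]
      simp only [Complex.add_re, Complex.add_im, Complex.re_ofReal_mul, Complex.im_ofReal_mul,
        Complex.one_re, Complex.one_im, Complex.sub_re, Complex.sub_im]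
      field_simp; ring
    have hsq : ‖w - 1‖ ^ 2 * k ^ 2 ≤ 24 := by
      have h5 : ‖w-1‖^2 * k^2 = (‖w - 1‖ * k)^2 := by ring
      rw [h5]
      have : 0 ≤ ‖w - 1‖ * k := by positivity
      exact (pow_le_pow_left₀ this hw1k 2).trans (by norm_num)
    have hk2 : 0 < k ^ 2 := by positivity
    have h12 : 0 ≤ 1 - 12 / k ^ 2 := by
      rw [sub_nonneg, div_le_one hk2]; exact le_trans (by norm_num) (pow_le_pow_left₀ (by norm_num) hK250 2)
    have hsq1 : ‖1 + (w - 1) / (p:ℂ)‖ ^ 2 ≤ 1 - 24 / k ^ 2 := by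
      rw [e]
      have a1 : 2 * (w.re - 1) / p ≤ - (50 / (p ^ 2 * k ^ 2)) := by
        have : 2 * (w.re - 1) / p ≤ 2 * (-t) / p := by gcongr
        refine this.trans (le_of_eq ?_)
        rw [ht]; field_simp; norm_num
      have a2 : ‖w - 1‖ ^ 2 / p ^ 2 ≤ 24 / (p ^ 2 * k ^ 2) := by
        rw [div_le_div_iff₀ (by positivity) (by positivity)]
        have h3 := mul_le_mul_of_nonneg_right hsq (sq_nonneg p)
        linarith
      have a3 : 24 / k ^ 2 ≤ 26 / (p ^ 2 * k ^ 2) := by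
        rw [div_le_div_iff₀ (by positivity) (by positivity)]
        have : p ^ 2 ≤ 1 := pow_le_one₀ hp.le hp1
        have h3 := mul_le_mul_of_nonneg_right this hk2.le
        linarith
      have a4 : 50 / (p ^ 2 * k ^ 2) - 24 / (p ^ 2 * k ^ 2) = 26 / (p ^ 2 * k ^ 2) := by ring
      linarith
    apply le_of_sq_le_sq _ h12
    have : (1 - 12 / k^2)^2 = 1 - 24 / k ^ 2 + (12 / k^2)^2 := by ring
    rw [this]; linarith [sq_nonneg (12 / k^2)]
  · rw [hwn]; exact mul_le_one₀ (by linarith) (norm_nonneg _) hw0le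
  · rw [hwn]
    have hk2 : 0 < k ^ 2 := by positivity
    have a1 : ‖ζ - 1‖ ^ 2 / 4 ≤ 3 / k ^ 2 := by
      rw [div_le_div_iff₀ (by norm_num) hk2]
      have : ‖ζ - 1‖^2 * k^2 = (‖ζ - 1‖ * k)^2 := by ring
      rw [this]
      have : 0 ≤ ‖ζ - 1‖ * k := by positivity
      exact (pow_le_pow_left₀ this hαk' 2).trans (by norm_num)
    have a2 : (25 / p + 3) / k ^ 2 = t + 3 / k ^ 2 := by rw [ht]; ring
    rw [a2]
    have h3 := mul_le_mul_of_nonneg_left hw0le ht0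
    linarith
  · rw [le_div_iff₀ hK0]; linarith
  · exact hge

open Classical in
noncomputable def statO (P : List Bool → Prop) : List Bool → List Bool → Option (List Bool)
  | a, [] => if P a then some [] else none
  | a, b :: y => if P a then some (b :: y) else statO P (a ++ [b]) y

noncomputable def stat {V : Type} [AddCommGroup V] (P : List Bool → Prop) (f : List Bool → V)
    (a y : List Bool) : V := (statO P a y).elim 0 f

def NP (P : List Bool → Prop) (a b : List Bool) : Prop := ∀ c, c <+: b → ¬ P (a ++ c)

open Classical in
noncomputable def Phi (P : List Bool → Prop) (p : ℝ) (w : ℂ) : List Bool → List Bool → ℂ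
  | a, [] => if P a then 1 else 0
  | a, b :: u => if P a then w ^ (u.length + 1) else
      (p : ℂ) * Phi P p w (a ++ [b]) u + (1 - p : ℝ) * Phi P p w a u

noncomputable def poly (z : ℂ) : List Bool → ℂ
  | [] => 0
  | b :: y => (if b then 1 else 0) + z * poly z y

noncomputable def bit (l : ℕ) (y : List Bool) : ℝ := if y.getD l false then 1 else 0

lemma NP_nil (P : List Bool → Prop) (a : List Bool) : NP P a [] ↔ ¬ P a := by
  simp [NP]

lemma NP_cons (P : List Bool → Prop) (a y : List Bool) (b : Bool) :
    NP P a (b :: y) ↔ ¬ P a ∧ NP P (a ++ [b]) y := by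
  constructor
  · intro h
    refine ⟨by simpa using h [] (by simp), fun c hc => ?_⟩
    simpa using h (b :: c) (by simpa using hc)
  · rintro ⟨h1, h2⟩ c hc
    cases c with
    | nil => simpa using h1
    | cons b' c =>
      rw [List.cons_prefix_cons] at hc
      obtain ⟨rfl, hc⟩ := hc
      simpa using h2 c hc

lemma NP_append (P : List Bool → Prop) (a b c : List Bool) :
    NP P a (b ++ c) ↔ NP P a b ∧ NP P (a ++ b) c := by
  induction b generalizing a with
  | nil =>
    simp only [List.nil_append, NP_nil, List.append_nil]
    exact ⟨fun h => ⟨by simpa using h [] (by simp), h⟩, fun h => h.2⟩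
  | cons x b ih => simp only [List.cons_append, NP_cons, ih]; simp [and_assoc]

lemma NP_head {P : List Bool → Prop} {a : List Bool} (h : P a) (y : List Bool) : ¬ NP P a y :=
  fun H => H [] (by simp) (by simpa using h)

section
variable {p : ℝ} {P : List Bool → Prop}

lemma Phi_pos {w : ℂ} {a u : List Bool} (h : P a) : Phi P p w a u = w ^ u.length := by
  cases u <;> simp [Phi, h]

lemma Phi_append (w : ℂ) (a u1 u2 : List Bool) :
    Phi P p w a (u1 ++ u2) = w ^ u2.length * Phi P p w a u1 +
      Etr p u1 (fun b => (ind (NP P a b) : ℂ) * Phi P p w (a ++ b) u2) := by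
  by_cases ha : P a
  · rw [Phi_pos ha, Phi_pos ha]
    have : ∀ b, ind (NP P a b) = 0 := fun b => ind_false (NP_head ha b)
    simp only [this]
    simp [Etr_const, pow_add]; ring
  induction u1 generalizing a with
  | nil =>
    simp [Etr, Phi, ha, ind_true ((NP_nil P a).2 ha)]
  | cons b u1 ih =>
    simp only [List.cons_append, Phi, ha, if_false, Etr]
    have h1 : ∀ y, ind (NP P a (b :: y)) = ind (NP P (a ++ [b]) y) := by
      intro y; congr 1; rw [NP_cons]; simp [ha]
    simp only [h1]
    rw [ih a ha]
    by_cases hb : P (a ++ [b])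
    · have : ∀ y, ind (NP P (a ++ [b]) y) = 0 := fun y => ind_false (NP_head hb y)
      simp only [this]
      rw [Phi_pos hb, Phi_pos hb]
      simp [Etr_const, pow_add]; ring
    · rw [ih _ hb]
      simp only [Complex.real_smul, List.append_assoc, List.singleton_append]
      push_cast; ring

lemma Phi_norm_le (h0 : 0 ≤ p) (h1 : p ≤ 1) {w : ℂ} (hw : ‖w‖ ≤ 1) (a u : List Bool) :
    ‖Phi P p w a u‖ ≤ Etr p u (fun y => ind (¬ NP P a y)) := by
  by_cases ha : P a
  · rw [Phi_pos ha]
    have : ∀ b, ind (¬ NP P a b) = 1 := fun b => ind_true (NP_head ha b)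
    simp only [this, Etr_const, norm_pow]
    exact pow_le_one₀ (norm_nonneg _) hw
  induction u generalizing a with
  | nil => simp [Etr, Phi, ha, ind_nonneg]
  | cons b u ih =>
    simp only [Phi, ha, if_false, Etr]
    have h3 : ∀ y, ind (¬ NP P a (b :: y)) = ind (¬ NP P (a ++ [b]) y) := by
      intro y; congr 2; rw [NP_cons]; simp [ha]
    simp only [h3]
    refine (norm_add_le _ _).trans ?_
    have h2 : 0 ≤ 1 - p := by linarith
    rw [norm_mul, norm_mul, Complex.norm_real, Complex.norm_real, Real.norm_of_nonneg h0,
      Real.norm_of_nonneg h2]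
    simp only [smul_eq_mul]
    have := ih a ha
    have h4 : ‖Phi P p w (a ++ [b]) u‖ ≤ Etr p u (fun y => ind (¬ NP P (a ++ [b]) y)) := by
      by_cases hb : P (a ++ [b])
      · rw [Phi_pos hb]
        have : ∀ y, ind (¬ NP P (a ++ [b]) y) = 1 := fun y => ind_true (NP_head hb y)
        simp only [this, Etr_const, norm_pow]
        exact pow_le_one₀ (norm_nonneg _) hw
      · exact ih _ hb
    gcongr

lemma Phi_close (h0 : 0 ≤ p) (h1 : p ≤ 1) {w : ℂ} (ε : ℝ) (hε : 0 ≤ ε) (a u : List Bool)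
    (hw : ∀ i ≤ u.length, ‖w ^ i - 1‖ ≤ ε) :
    ‖Phi P p w a u - (Etr p u (fun y => ind (¬ NP P a y)) : ℝ)‖ ≤ ε := by
  induction u generalizing a with
  | nil =>
    by_cases ha : P a
    · rw [Phi_pos ha]; simp [Etr, ind_true (NP_head ha []), hε]
    · simp [Etr, Phi, ha, ind_false (not_not.2 ((NP_nil P a).2 ha)), hε]
  | cons b u ih =>
    by_cases ha : P a
    · rw [Phi_pos ha]
      have : ∀ b, ind (¬ NP P a b) = 1 := fun b => ind_true (NP_head ha b)
      simp only [this, Etr_const]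
      exact_mod_cast hw _ le_rfl
    simp only [Phi, ha, if_false, Etr]
    have h3 : ∀ y, ind (¬ NP P a (b :: y)) = ind (¬ NP P (a ++ [b]) y) := by
      intro y; congr 2; rw [NP_cons]; simp [ha]
    simp only [h3, smul_eq_mul]
    have i1 := ih a (fun i hi => hw i (by simp; omega))
    have i2 := ih (a ++ [b]) (fun i hi => hw i (by simp; omega))
    have h2 : 0 ≤ 1 - p := by linarith
    set A := Etr p u (fun y => ind (¬ NP P a y))
    set B := Etr p u (fun y => ind (¬ NP P (a ++ [b]) y))
    have e : (p : ℂ) * Phi P p w (a ++ [b]) u + (1 - p : ℝ) * Phi P p w a u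
        - ((p * B + (1 - p) * A : ℝ) : ℂ) =
        (p : ℂ) * (Phi P p w (a ++ [b]) u - (B : ℝ)) + (1 - p : ℝ) * (Phi P p w a u - (A : ℝ)) := by
      push_cast; ring
    rw [e]
    refine (norm_add_le _ _).trans ?_
    rw [norm_mul, norm_mul, Complex.norm_real, Complex.norm_real, Real.norm_of_nonneg h0,
      Real.norm_of_nonneg h2]
    calc _ ≤ p * ε + (1 - p) * ε := by gcongr
      _ = ε := by ring

lemma Etr_poly (z w : ℂ) (hw : w = (1 - p : ℝ) + (p : ℝ) * z) (x : List Bool) :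
    Etr p x (poly z) = p * poly w x := by
  induction x with
  | nil => simp [Etr, poly]
  | cons b x ih =>
    simp only [Etr, poly, Etr_add, Etr_const, Etr_mul_leftC, Complex.real_smul]
    have : Etr p x (fun y => poly z y) = Etr p x (poly z) := rfl
    rw [ih, hw]; push_cast; ring

lemma poly_append (w : ℂ) (u x : List Bool) :
    poly w (u ++ x) = poly w u + w ^ u.length * poly w x := by
  induction u with
  | nil => simp [poly]
  | cons b u ih => simp only [List.cons_append, poly, ih, List.length_cons]; ring

lemma stat_pos {V : Type} [AddCommGroup V] {f : List Bool → V} {a : List Bool} (h : P a)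
    (y : List Bool) : stat P f a y = f y := by
  cases y <;> simp [stat, statO, h]

lemma stat_neg_nil {V : Type} [AddCommGroup V] {f : List Bool → V} {a : List Bool} (h : ¬ P a) :
    stat P f a [] = 0 := by simp [stat, statO, h]

lemma stat_neg_cons {V : Type} [AddCommGroup V] {f : List Bool → V} {a : List Bool} (h : ¬ P a)
    (b : Bool) (y : List Bool) : stat P f a (b :: y) = stat P f (a ++ [b]) y := by
  simp [stat, statO, h]

lemma stat_identity (z w : ℂ) (hw : w = (1 - p : ℝ) + (p : ℝ) * z) (a u x1 x2 : List Bool) :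
    Etr p (u ++ x1) (stat P (poly z) a) - Etr p (u ++ x2) (stat P (poly z) a) =
      Phi P p w a u * (p * (poly w x1 - poly w x2)) +
      Etr p u (fun b => (ind (NP P a b) : ℂ) *
        (Etr p x1 (stat P (poly z) (a ++ b)) - Etr p x2 (stat P (poly z) (a ++ b)))) := by
  have key : ∀ a u, P a → Etr p (u ++ x1) (stat P (poly z) a) -
      Etr p (u ++ x2) (stat P (poly z) a) = Phi P p w a u * (p * (poly w x1 - poly w x2)) +
      Etr p u (fun b => (ind (NP P a b) : ℂ) *
        (Etr p x1 (stat P (poly z) (a ++ b)) - Etr p x2 (stat P (poly z) (a ++ b)))) := by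
    intro a u ha
    have h1 : stat P (poly z) a = poly z := funext fun y => stat_pos ha y
    have : ∀ b, ind (NP P a b) = 0 := fun b => ind_false (NP_head ha b)
    simp only [this]
    rw [h1, Etr_poly z w hw, Etr_poly z w hw, poly_append, poly_append, Phi_pos ha]
    simp [Etr_const]; ring
  by_cases ha : P a
  · exact key a u ha
  induction u generalizing a with
  | nil => simp [Etr, Phi, ha, ind_true ((NP_nil P a).2 ha)]
  | cons b u ih =>
    simp only [List.cons_append, Phi, ha, if_false, Etr]
    have h1 : ∀ y, ind (NP P a (b :: y)) = ind (NP P (a ++ [b]) y) := by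
      intro y; congr 1; rw [NP_cons]; simp [ha]
    have h2 : (fun y => stat P (poly z) a (b :: y)) = stat P (poly z) (a ++ [b]) :=
      funext fun y => stat_neg_cons ha b y
    simp only [h1, h2]
    have e1 := ih a ha
    have e2 := (em (P (a ++ [b]))).elim (key (a ++ [b]) u) (ih (a ++ [b]))
    simp only [Complex.real_smul]
    simp only [List.append_assoc, List.singleton_append] at e2 ⊢
    linear_combination (p : ℂ) * e2 + ((1 - p : ℝ) : ℂ) * e1

lemma statO_some {a y s : List Bool} (h : statO P a y = some s) :
    ∃ c, c <+: y ∧ P (a ++ c) := by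
  induction y generalizing a with
  | nil =>
    by_cases ha : P a
    · exact ⟨[], by simp, by simpa using ha⟩
    · simp [statO, ha] at h
  | cons b y ih =>
    by_cases ha : P a
    · exact ⟨[], by simp, by simpa using ha⟩
    · simp only [statO, ha, if_false] at h
      obtain ⟨c, hc, hP⟩ := ih h
      exact ⟨b :: c, by simpa using hc, by simpa using hP⟩

lemma poly_split (z : ℂ) (L : ℕ) (y : List Bool) :
    poly z y = ∑ l ∈ Finset.range L, z ^ l * (bit l y : ℂ) + z ^ L * poly z (y.drop L) := by
  induction y generalizing L with
  | nil => simp [poly, bit]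
  | cons b y ih =>
    cases L with
    | zero => simp
    | succ L =>
      rw [Finset.sum_range_succ']
      simp only [poly, List.drop_succ_cons]
      rw [ih L, mul_add, Finset.mul_sum]
      have : ∀ l, bit (l+1) (b :: y) = bit l y := fun l => by simp [bit]
      simp only [this]
      have h0 : bit 0 (b :: y) = if b then 1 else 0 := by simp [bit]
      rw [h0]
      have : ∑ i ∈ Finset.range L, z * (z ^ i * (bit i y : ℂ)) =
        ∑ i ∈ Finset.range L, z ^ (i+1) * (bit i y : ℂ) :=
        Finset.sum_congr rfl fun i _ => by ring
      rw [this]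
      cases b <;> simp <;> ring

lemma poly_norm (z : ℂ) (hz : ‖z‖ < 1) (y : List Bool) : ‖poly z y‖ ≤ 1 / (1 - ‖z‖) := by
  have h : 0 < 1 - ‖z‖ := by linarith
  induction y with
  | nil => simp [poly]; linarith
  | cons b y ih =>
    simp only [poly]
    refine (norm_add_le _ _).trans ?_
    rw [norm_mul]
    have : ‖(if b then 1 else 0 : ℂ)‖ ≤ 1 := by cases b <;> simp
    calc _ ≤ 1 + ‖z‖ * (1 / (1 - ‖z‖)) := by gcongr
      _ = 1 / (1 - ‖z‖) := by field_simp; ring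

lemma poly_diff (z : ℂ) (b : Bool) (y y' : List Bool) (hz : ‖z‖ < 1) :
    ‖poly z (b :: y) - poly z ((!b) :: y')‖ ≤ 1 / (1 - ‖z‖) := by
  have h : 0 < 1 - ‖z‖ := by linarith
  have key : ∀ y y', ‖poly z y - poly z y'‖ ≤ 1 / (1 - ‖z‖) := by
    have aux : ∀ y, ‖poly z y‖ ≤ 1 / (1 - ‖z‖) := poly_norm z hz
    intro y
    induction y with
    | nil => intro y'; simpa [poly] using aux y'
    | cons b y ih =>
      intro y'
      cases y' with
      | nil => simpa [poly] using aux (b :: y)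
      | cons b' y' =>
        have e : poly z (b :: y) - poly z (b' :: y') =
          ((if b then 1 else 0) - (if b' then 1 else 0)) + z * (poly z y - poly z y') := by
          simp only [poly]; ring
        rw [e]
        refine (norm_add_le _ _).trans ?_
        rw [norm_mul]
        have : ‖((if b then 1 else 0) - (if b' then 1 else 0) : ℂ)‖ ≤ 1 := by
          cases b <;> cases b' <;> simp
        have := ih y'
        calc _ ≤ 1 + ‖z‖ * (1 / (1 - ‖z‖)) := by gcongr
          _ = 1 / (1 - ‖z‖) := by field_simp; ring
  exact key _ _

lemma poly_differentiable (y : List Bool) : Differentiable ℂ (fun z => poly z y) := by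
  induction y with
  | nil => simp [poly]
  | cons b y ih => simp only [poly]; fun_prop

lemma stat_norm_le {z : ℂ} (hz : ‖z‖ < 1) (a y : List Bool) :
    ‖stat P (poly z) a y‖ ≤ 1 / (1 - ‖z‖) * ind (∃ c, c <+: y ∧ P (a ++ c)) := by
  have h : 0 < 1 - ‖z‖ := by linarith
  unfold stat
  cases hs : statO P a y with
  | none => simp; have := ind_nonneg (∃ c, c <+: y ∧ P (a ++ c)); positivity
  | some s => rw [ind_true (statO_some hs), mul_one]; exact poly_norm z hz s

lemma stat_split {z : ℂ} (hz : ‖z‖ < 1) (L : ℕ) (a y : List Bool) :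
    ‖stat P (poly z) a y - ∑ l ∈ Finset.range L, z ^ l * ((stat P (bit l) a y : ℝ) : ℂ)‖
      ≤ ‖z‖ ^ L * (1 / (1 - ‖z‖)) := by
  have h : 0 < 1 - ‖z‖ := by linarith
  unfold stat
  cases hs : statO P a y with
  | none => simp; positivity
  | some s =>
    simp only [Option.elim]
    rw [poly_split z L s, add_sub_cancel_left, norm_mul, norm_pow]
    gcongr
    exact poly_norm z hz _

lemma stat_bit_mem (l : ℕ) (a y : List Bool) :
    0 ≤ stat P (bit l) a y ∧ stat P (bit l) a y ≤ 1 := by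
  unfold stat
  cases hs : statO P a y with
  | none => simp
  | some s => simp only [Option.elim, bit]; split_ifs <;> simp

end

lemma Etr_stat_split {p : ℝ} {P : List Bool → Prop} (h0 : 0 ≤ p) (h1 : p ≤ 1) {z : ℂ} (hz : ‖z‖ < 1) (L : ℕ)
    (x : List Bool) :
    ‖Etr p x (stat P (poly z) []) -
      ∑ l ∈ Finset.range L, z ^ l * ((Etr p x (stat P (bit l) []) : ℝ) : ℂ)‖
      ≤ ‖z‖ ^ L * (1 / (1 - ‖z‖)) := by
  have e : ∑ l ∈ Finset.range L, z ^ l * ((Etr p x (stat P (bit l) []) : ℝ) : ℂ) =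
      Etr p x (fun y => ∑ l ∈ Finset.range L, z ^ l * ((stat P (bit l) [] y : ℝ) : ℂ)) := by
    rw [Etr_sum]
    refine Finset.sum_congr rfl fun l _ => ?_
    rw [Etr_mul_leftC, Etr_ofReal]
  rw [e, ← Etr_sub]
  refine (Etr_norm_le h0 h1 _ _).trans ?_
  refine (Etr_mono h0 h1 _ _ (fun _ => ‖z‖ ^ L * (1 / (1 - ‖z‖))) (fun y => stat_split hz L [] y)).trans ?_
  rw [Etr_const]

lemma sep_core (p : ℝ) (hp : 0 < p) (hp1 : p ≤ 1) (K : ℕ) (hK : 250 / p ≤ K) (L : ℕ)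
    (P : List Bool → Prop) (u : List Bool) (b : Bool) (y1 y2 : List Bool) (φ late η : ℝ)
    (hφ0 : 0 ≤ φ)
    (hφ : ∀ w : ℂ, ‖w‖ ≤ 1 → 1 - (25/p+3)/(K:ℝ)^2 ≤ ‖w‖ → ‖w-1‖ ≤ 6/K → φ ≤ ‖Phi P p w [] u‖)
    (hl1 : Etr p u (fun a => ind (NP P [] a) *
      Etr p (b :: y1) (fun y => ind (∃ c, c <+: y ∧ P (a ++ c)))) ≤ late)
    (hl2 : Etr p u (fun a => ind (NP P [] a) *
      Etr p ((!b) :: y2) (fun y => ind (∃ c, c <+: y ∧ P (a ++ c)))) ≤ late)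
    (hnum : 2 * η * L + 2 * (K:ℝ)^2 * late + 2 * (K:ℝ)^2 * Real.exp (-(12 * L / (K:ℝ)^2))
      < p * φ * (1/8:ℝ)^K) :
    ∃ l < L, 2 * η < |Etr p (u ++ b :: y1) (stat P (bit l) []) -
      Etr p (u ++ (!b) :: y2) (stat P (bit l) [])| := by
  have hp0 := hp.le
  have hK250 : (250:ℝ) ≤ K := by
    refine le_trans ?_ hK
    rw [le_div_iff₀ hp]; linarith
  set x1 := b :: y1 with hx1
  set x2 := (!b) :: y2 with hx2
  obtain ⟨z, w, hw, hz, hw1, hw2, hw3, hQ⟩ := analytic p hp hp1 K hK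
    (fun w => poly w x1 - poly w x2)
    ((poly_differentiable x1).sub (poly_differentiable x2))
    (by cases b <;> simp [hx1, hx2, poly])
    (fun w hw => poly_diff w b y1 y2 hw)
  have hK2 : (0:ℝ) < (K:ℝ)^2 := by positivity
  have hz1 : ‖z‖ < 1 := by
    have : 0 < 12 / (K:ℝ)^2 := by positivity
    linarith
  have hpos : 0 < 1 - ‖z‖ := by linarith
  set R := 1 / (1 - ‖z‖) with hR
  have hRK : R ≤ (K:ℝ)^2 := by
    rw [hR, div_le_iff₀ hpos]
    have : 12 / (K:ℝ)^2 ≤ 1 - ‖z‖ := by linarith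
    calc (1:ℝ) ≤ (K:ℝ)^2 * (12 / (K:ℝ)^2) := by field_simp; norm_num
      _ ≤ _ := by gcongr
  have hR0 : 0 ≤ R := by positivity
  have hzL : ‖z‖ ^ L ≤ Real.exp (-(12 * L / (K:ℝ)^2)) := by
    have h1 : ‖z‖ ≤ Real.exp (-(12 / (K:ℝ)^2)) := by
      have := Real.add_one_le_exp (-(12 / (K:ℝ)^2))
      linarith
    calc ‖z‖ ^ L ≤ (Real.exp (-(12 / (K:ℝ)^2))) ^ L := by gcongr
      _ = _ := by rw [← Real.exp_nat_mul]; congr 1; ring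
  by_contra hcon
  push Not at hcon
  have id := stat_identity (P := P) z w hw [] u x1 x2
  simp only [List.nil_append] at id
  set D := Etr p (u ++ x1) (stat P (poly z) []) - Etr p (u ++ x2) (stat P (poly z) []) with hD
  -- remainder
  have rem : ‖Etr p u (fun a => (ind (NP P [] a) : ℂ) *
        (Etr p x1 (stat P (poly z) a) - Etr p x2 (stat P (poly z) a)))‖ ≤ R * (2 * late) := by
    refine (Etr_norm_le hp0 hp1 _ _).trans ?_
    have hh : ∀ (x a : List Bool), ‖Etr p x (stat P (poly z) a)‖ ≤
        R * Etr p x (fun y => ind (∃ c, c <+: y ∧ P (a ++ c))) := by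
      intro x a
      refine (Etr_norm_le hp0 hp1 _ _).trans ?_
      rw [← Etr_mul_left]
      exact Etr_mono hp0 hp1 _ _ _ (fun y => stat_norm_le hz1 a y)
    have := Etr_mono hp0 hp1 u (fun a => ‖(ind (NP P [] a) : ℂ) *
        (Etr p x1 (stat P (poly z) a) - Etr p x2 (stat P (poly z) a))‖)
        (fun a => R * (ind (NP P [] a) * Etr p x1 (fun y => ind (∃ c, c <+: y ∧ P (a ++ c))) +
          ind (NP P [] a) * Etr p x2 (fun y => ind (∃ c, c <+: y ∧ P (a ++ c))))) (by
        intro a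
        rw [norm_mul, Complex.norm_real, Real.norm_of_nonneg (ind_nonneg _)]
        have h3 := (norm_sub_le (Etr p x1 (stat P (poly z) a)) (Etr p x2 (stat P (poly z) a))).trans
          (add_le_add (hh x1 a) (hh x2 a))
        have := mul_le_mul_of_nonneg_left h3 (ind_nonneg (NP P [] a))
        linarith)
    refine this.trans ?_
    rw [Etr_mul_left, Etr_add]
    gcongr
    linarith
  have main : ‖Phi P p w [] u * (p * (poly w x1 - poly w x2))‖ ≥ p * φ * (1/8:ℝ)^K := by
    rw [norm_mul, norm_mul, Complex.norm_real, Real.norm_of_nonneg hp0]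
    have h1 := hφ w hw1 hw2 hw3
    calc p * φ * (1/8:ℝ)^K = φ * (p * (1/8:ℝ)^K) := by ring
      _ ≤ _ := by gcongr
  have low : p * φ * (1/8:ℝ)^K - R * (2 * late) ≤ ‖D‖ := by
    rw [id]
    have := norm_sub_le_norm_add (Phi P p w [] u * (p * (poly w x1 - poly w x2)))
      (Etr p u (fun a => (ind (NP P [] a) : ℂ) *
        (Etr p x1 (stat P (poly z) a) - Etr p x2 (stat P (poly z) a))))
    linarith
  have up : ‖D‖ ≤ 2 * η * L + 2 * (‖z‖ ^ L * R) := by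
    have s1 := Etr_stat_split (P := P) hp0 hp1 hz1 L (u ++ x1)
    have s2 := Etr_stat_split (P := P) hp0 hp1 hz1 L (u ++ x2)
    set S1 := ∑ l ∈ Finset.range L, z ^ l * ((Etr p (u ++ x1) (stat P (bit l) []) : ℝ) : ℂ)
    set S2 := ∑ l ∈ Finset.range L, z ^ l * ((Etr p (u ++ x2) (stat P (bit l) []) : ℝ) : ℂ)
    have s3 : ‖S1 - S2‖ ≤ 2 * η * L := by
      rw [← Finset.sum_sub_distrib]
      refine (norm_sum_le _ _).trans ?_
      refine (Finset.sum_le_sum (g := fun _ => 2 * η) ?_).trans ?_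
      · intro l hl
        rw [← mul_sub, ← Complex.ofReal_sub, norm_mul, norm_pow, Complex.norm_real, Real.norm_eq_abs]
        have h1 := hcon l (Finset.mem_range.1 hl)
        have h2 : ‖z‖ ^ l ≤ 1 := pow_le_one₀ (norm_nonneg _) hz1.le
        calc _ ≤ 1 * |Etr p (u ++ x1) (stat P (bit l) []) - Etr p (u ++ x2) (stat P (bit l) [])| := by
              gcongr
          _ ≤ _ := by rw [one_mul]; exact h1
      · simp; linarith
    have e : D = (Etr p (u ++ x1) (stat P (poly z) []) - S1) -
      (Etr p (u ++ x2) (stat P (poly z) []) - S2) + (S1 - S2) := by rw [hD]; ring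
    rw [e]
    refine (norm_add_le _ _).trans ?_
    have := norm_sub_le (Etr p (u ++ x1) (stat P (poly z) []) - S1)
      (Etr p (u ++ x2) (stat P (poly z) []) - S2)
    linarith
  have hlate : 0 ≤ late := by
    refine le_trans ?_ hl1
    exact Etr_nonneg hp0 hp1 _ _ (fun a => mul_nonneg (ind_nonneg _)
      (Etr_nonneg hp0 hp1 _ _ fun y => ind_nonneg _))
  have b1 : R * (2 * late) ≤ (K:ℝ)^2 * (2 * late) := by gcongr
  have b2 : ‖z‖ ^ L * R ≤ Real.exp (-(12 * L / (K:ℝ)^2)) * (K:ℝ)^2 := by gcongr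
  linarith

def Pass (k : ℕ) (E1 E2 : List Bool → Prop) (a : List Bool) : Prop :=
  a.length ≤ k ∧ ∃ s0 s1 s2, a = s0 ++ s1 ++ s2 ∧ E1 s1 ∧ E2 s2

def Hit (E : List Bool → Prop) (y : List Bool) : Prop := ∃ s, s <:+: y ∧ E s

lemma Hit_bound (m : ℕ) (E : List Bool → List Bool → Prop) (c : ℝ)
    (h : ∀ y, Eun m (fun u => ind (E u y)) ≤ c) (y : List Bool) :
    Eun m (fun u => ind (Hit (E u) y)) ≤ ((y.length : ℝ) + 1)^2 * c := by
  have h1 : ∀ u, ind (Hit (E u) y) ≤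
      ∑ ij ∈ Finset.range (y.length + 1) ×ˢ Finset.range (y.length + 1),
        ind (E u ((y.drop ij.1).take ij.2)) := by
    intro u
    refine le_trans (ind_mono ?_) (ind_exists_le _ _)
    rintro ⟨s, ⟨a, b, rfl⟩, hs⟩
    refine ⟨(a.length, s.length), ?_, ?_⟩
    · simp; omega
    · simpa using hs
  refine (Eun_mono m _ _ (fun u _ => h1 u)).trans ?_
  rw [Eun_sum]
  refine (Finset.sum_le_sum (g := fun _ => c) (fun ij _ => h _)).trans ?_
  simp; apply le_of_eq; ring

lemma early_comb {k : ℕ} {E1 E2 : List Bool → Prop} {b0 b1 : List Bool}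
    (h : ¬ NP (Pass k E1 E2) [] (b0 ++ b1)) : Hit E1 b0 ∨ Hit E2 b1 := by
  unfold NP at h
  push Not at h
  obtain ⟨c, ⟨t, ht⟩, -, s0, s1, s2, hc, h1, h2⟩ := h
  rw [List.nil_append] at hc
  have : (s0 ++ s1) ++ (s2 ++ t) = b0 ++ b1 := by rw [← ht, hc]; simp
  rw [List.append_eq_append_iff] at this
  rcases this with ⟨a', e1, e2⟩ | ⟨c', e1, e2⟩
  · exact Or.inl ⟨s1, ⟨s0, a', by rw [e1]⟩, h1⟩
  · exact Or.inr ⟨s2, ⟨c', t, by rw [e2]; simp⟩, h2⟩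

lemma late_comb {k m1 m2 : ℕ} {E1 E2 : List Bool → Prop} (l1 : ∀ s, E1 s → s.length ≤ m1)
    (l2 : ∀ s, E2 s → s.length ≤ m2) {A b2 b3 y : List Bool}
    (h : ∃ c, c <+: y ∧ Pass k E1 E2 (A ++ b2 ++ b3 ++ c)) :
    b3.length < m1 + m2 ∨ Hit E1 ((b2 ++ b3 ++ y).take k) := by
  obtain ⟨c, hc, hk, s0, s1, s2, e, h1, h2⟩ := h
  by_cases hb : b3.length < m1 + m2
  · exact Or.inl hb
  right
  refine ⟨s1, ?_, h1⟩
  have i1 := l1 _ h1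
  have i2 := l2 _ h2
  have suf : s1 ++ s2 <:+ b2 ++ b3 ++ c := by
    refine List.suffix_of_suffix_length_le (l₃ := A ++ b2 ++ b3 ++ c) ⟨s0, by rw [e]; simp⟩
      ⟨A, by simp⟩ ?_
    simp; omega
  have inf : s1 <:+: b2 ++ b3 ++ c := by
    obtain ⟨t, ht⟩ := suf
    exact ⟨t, s2, by rw [← ht]; simp⟩
  have pre : b2 ++ b3 ++ c <+: (b2 ++ b3 ++ y).take k := by
    rw [List.prefix_take_iff]
    refine ⟨?_, ?_⟩
    · exact (List.prefix_append_right_inj _).2 hc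
    · simp at hk ⊢; omega
  exact inf.trans pre.isInfix

section
variable {p : ℝ}

lemma len_tail (h0 : 0 ≤ p) (h1 : p ≤ 1) (m : ℕ) (g : List Bool) :
    Etr p g (fun y => ind (y.length < m)) ≤ Real.exp (m - p * g.length / 2) := by
  have e1 : Etr p g (fun y => Real.exp (-(y.length:ℝ))) ≤ Real.exp (-(p/2)) ^ g.length := by
    induction g with
    | nil => simp [Etr]
    | cons b g ih =>
      simp only [Etr, List.length_cons, smul_eq_mul]
      have : ∀ y : List Bool, Real.exp (-((y.length + 1 : ℕ):ℝ)) =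
        Real.exp (-1) * Real.exp (-(y.length:ℝ)) := fun y => by
        rw [← Real.exp_add]; congr 1; push_cast; ring
      simp only [this, Etr_mul_left]
      have h2 : Real.exp (-1) ≤ 1/2 := by
        rw [Real.exp_neg, one_div]
        apply inv_anti₀ (by norm_num)
        have := Real.add_one_le_exp 1
        linarith
      have h3 := Real.add_one_le_exp (-(p/2))
      have h4 : 0 ≤ Etr p g (fun y => Real.exp (-(y.length:ℝ))) :=
        Etr_nonneg h0 h1 _ _ (fun y => (Real.exp_pos _).le)
      have h6 : p * Real.exp (-1) ≤ p * (1/2) := by gcongr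
      calc _ = (p * Real.exp (-1) + (1-p)) * Etr p g (fun y => Real.exp (-(y.length:ℝ))) := by ring
        _ ≤ Real.exp (-(p/2)) * Real.exp (-(p/2)) ^ g.length := by
          gcongr
          linarith
        _ = _ := by ring
  calc Etr p g (fun y => ind (y.length < m)) ≤
        Etr p g (fun y => Real.exp m * Real.exp (-(y.length:ℝ))) := by
        refine Etr_mono h0 h1 _ _ _ fun y => ?_
        rw [← Real.exp_add]
        by_cases h : y.length < m
        · rw [ind_true h]
          apply Real.one_le_exp
          have : (y.length:ℝ) < m := by exact_mod_cast h
          linarith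
        · rw [ind_false h]; positivity
    _ = Real.exp m * Etr p g (fun y => Real.exp (-(y.length:ℝ))) := Etr_mul_left _ _ _
    _ ≤ Real.exp m * Real.exp (-(p/2)) ^ g.length := by gcongr
    _ = _ := by rw [← Real.exp_nat_mul, ← Real.exp_add]; congr 1; ring

lemma late_bound (h0 : 0 ≤ p) (h1 : p ≤ 1) {k m1 m2 : ℕ} {E1 E2 : List Bool → Prop}
    (l1 : ∀ s, E1 s → s.length ≤ m1) (l2 : ∀ s, E2 s → s.length ≤ m2) (A v g x : List Bool) :
    Etr p (A ++ v ++ g) (fun a => ind (NP (Pass k E1 E2) [] a) *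
      Etr p x (fun y => ind (∃ c, c <+: y ∧ Pass k E1 E2 (a ++ c)))) ≤
    Etr p g (fun y => ind (y.length < m1 + m2)) +
      Etr p (v ++ g ++ x) (fun y => ind (Hit E1 (y.take k))) := by
  have e1 : Etr p (A ++ v ++ g) (fun a => ind (NP (Pass k E1 E2) [] a) *
      Etr p x (fun y => ind (∃ c, c <+: y ∧ Pass k E1 E2 (a ++ c)))) ≤
      Etr p (A ++ v ++ g) (fun a =>
      Etr p x (fun y => ind (∃ c, c <+: y ∧ Pass k E1 E2 (a ++ c)))) := by
    refine Etr_mono h0 h1 _ _ _ fun a => ?_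
    have := ind_le_one (NP (Pass k E1 E2) [] a)
    have h2 : 0 ≤ Etr p x (fun y => ind (∃ c, c <+: y ∧ Pass k E1 E2 (a ++ c))) :=
      Etr_nonneg h0 h1 _ _ fun y => ind_nonneg _
    exact mul_le_of_le_one_left h2 this
  refine e1.trans ?_
  simp only [Etr_append]
  have e2 : ∀ a, Etr p v (fun b => Etr p g (fun d => Etr p x (fun y =>
        ind (∃ c, c <+: y ∧ Pass k E1 E2 (a ++ b ++ d ++ c))))) ≤
      Etr p v (fun b => Etr p g (fun d => Etr p x (fun y => ind (d.length < m1 + m2) +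
        ind (Hit E1 ((b ++ d ++ y).take k))))) := fun a => by
    refine Etr_mono h0 h1 _ _ _ fun b => Etr_mono h0 h1 _ _ _ fun d => Etr_mono h0 h1 _ _ _ fun y => ?_
    exact ind_imp_or (late_comb l1 l2)
  refine (Etr_mono h0 h1 _ _ _ e2).trans ?_
  simp only [Etr_const, Etr_add]
  rfl

lemma phi_low (h0 : 0 ≤ p) (h1 : p ≤ 1) {k : ℕ} {E1 E2 : List Bool → Prop} (u0 U v g : List Bool)
    (hk : (u0 ++ U ++ v).length ≤ k) (d1 d2 : ℝ)
    (a1 : Etr p u0 (fun y => ind (Hit E1 y)) ≤ 1/20)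
    (a2 : Etr p U (fun y => ind (Hit E2 y)) ≤ 1/20)
    (a3 : Etr p U (fun y => ind (¬ E1 y)) ≤ d1)
    (a4 : Etr p v (fun y => ind (¬ E2 y)) ≤ d2) (hd : d1 + d2 ≤ 1/5)
    (w : ℂ) (hw : ‖w‖ ≤ 1) (hw1 : v.length * ‖w - 1‖ ≤ 1/10) :
    ‖w‖ ^ g.length / 2 - (d1 + d2) ≤ ‖Phi (Pass k E1 E2) p w [] (u0 ++ U ++ v ++ g)‖ := by
  set P := Pass k E1 E2 with hP
  -- failure
  have fail : Etr p (u0 ++ U ++ v) (fun y => ind (NP P [] y)) ≤ d1 + d2 := by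
    have : Etr p (u0 ++ U ++ v) (fun y => ind (NP P [] y)) ≤
        Etr p u0 (fun a => Etr p U (fun b => Etr p v (fun c => ind (¬ E1 b) + ind (¬ E2 c)))) := by
      simp only [Etr_append]
      refine Etr_mono' h0 h1 _ _ _ fun a ha => Etr_mono' h0 h1 _ _ _ fun b hb =>
        Etr_mono' h0 h1 _ _ _ fun c hc => ind_imp_or fun hn => ?_
      by_contra hcon
      push Not at hcon
      refine hn (a ++ b ++ c) (List.prefix_refl _) ⟨?_, a, b, c, by simp, hcon.1, hcon.2⟩
      simp at hk ⊢; omega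
    refine this.trans ?_
    simp only [Etr_add, Etr_const]
    linarith
  have early : Etr p (u0 ++ U) (fun y => ind (¬ NP P [] y)) ≤ 1/10 := by
    have : Etr p (u0 ++ U) (fun y => ind (¬ NP P [] y)) ≤
        Etr p u0 (fun a => Etr p U (fun b => ind (Hit E1 a) + ind (Hit E2 b))) := by
      simp only [Etr_append]
      exact Etr_mono h0 h1 _ _ _ fun a => Etr_mono h0 h1 _ _ _ fun b => ind_imp_or early_comb
    refine this.trans ?_
    simp only [Etr_add, Etr_const]
    linarith
  have hwi : ∀ i ≤ v.length, ‖w ^ i - 1‖ ≤ 1/10 := by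
    intro i hi
    have : ∀ i : ℕ, ‖w ^ i - 1‖ ≤ i * ‖w - 1‖ := by
      intro i
      induction i with
      | zero => simp
      | succ i ih =>
        have e : w ^ (i+1) - 1 = w ^ i * (w - 1) + (w ^ i - 1) := by ring
        rw [e]
        refine (norm_add_le _ _).trans ?_
        rw [norm_mul, norm_pow]
        have : ‖w‖ ^ i ≤ 1 := pow_le_one₀ (norm_nonneg _) hw
        have : ‖w‖ ^ i * ‖w - 1‖ ≤ 1 * ‖w - 1‖ := by gcongr
        push_cast; linarith
    refine (this i).trans (le_trans ?_ hw1)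
    gcongr
  set A := u0 ++ U with hA
  have low1 : 1/2 ≤ ‖Phi P p w [] (A ++ v)‖ := by
    rw [Phi_append]
    simp only [List.nil_append]
    set X := w ^ v.length * Phi P p w [] A
    set Y := Etr p A (fun b => (ind (NP P [] b) : ℂ) * Phi P p w b v)
    set Z : ℝ := Etr p A (fun b => ind (NP P [] b) * Etr p v (fun y => ind (¬ NP P b y)))
    have hX : ‖X‖ ≤ 1/10 := by
      rw [norm_mul, norm_pow]
      have h3 : ‖w‖ ^ v.length ≤ 1 := pow_le_one₀ (norm_nonneg _) hw
      have h4 := (Phi_norm_le (P := P) h0 h1 hw [] A).trans early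
      calc _ ≤ 1 * ‖Phi P p w [] A‖ := by gcongr
        _ ≤ _ := by linarith
    have hYZ : ‖Y - (Z : ℝ)‖ ≤ 1/10 := by
      have : Y - (Z:ℝ) = Etr p A (fun b => (ind (NP P [] b) : ℂ) *
          (Phi P p w b v - (Etr p v (fun y => ind (¬ NP P b y)) : ℝ))) := by
        simp only [Y, Z]
        rw [← Etr_ofReal, ← Etr_sub]
        congr 1; funext b; push_cast; ring
      rw [this]
      refine (Etr_norm_le h0 h1 _ _).trans ?_
      rw [← Etr_const (p := p) A (1/10 : ℝ)]
      refine Etr_mono h0 h1 _ _ _ fun b => ?_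
      rw [norm_mul, Complex.norm_real, Real.norm_of_nonneg (ind_nonneg _)]
      have := Phi_close (P := P) h0 h1 (1/10) (by norm_num) b v hwi
      have h5 := ind_le_one (NP P [] b)
      calc _ ≤ 1 * ‖Phi P p w b v - (Etr p v (fun y => ind (¬ NP P b y)) : ℝ)‖ := by
            gcongr
        _ ≤ _ := by rw [one_mul]; exact this
    have hZ : 7/10 ≤ Z := by
      have : Etr p A (fun b => Etr p v (fun y => 1 - ind (NP P [] (b ++ y)) - ind (¬ NP P [] b))) ≤ Z := by
        refine Etr_mono h0 h1 _ _ _ fun b => ?_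
        rw [← Etr_mul_left]
        refine Etr_mono h0 h1 _ _ _ fun y => ?_
        by_cases hb : NP P [] b
        · have : NP P [] (b ++ y) ↔ NP P b y := by rw [NP_append]; simp [hb]
          rw [ind_true hb, ind_false (not_not.2 hb), this, ind_not]; linarith
        · rw [ind_false hb, ind_true hb]
          have := ind_nonneg (NP P [] (b ++ y)); linarith
      simp only [Etr_sub, Etr_const] at this
      rw [Etr_append] at fail
      linarith
    have h9 : Z ≤ ‖X + Y‖ + ‖X‖ + ‖Y - (Z:ℝ)‖ := by
      have e : ((Z:ℝ):ℂ) = (X + Y) - X - (Y - (Z:ℝ)) := by ring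
      calc Z ≤ ‖((Z:ℝ):ℂ)‖ := by rw [Complex.norm_real]; exact le_abs_self Z
        _ = ‖(X + Y) - X - (Y - (Z:ℝ))‖ := by rw [← e]
        _ ≤ _ := (norm_sub_le _ _).trans (by gcongr; exact norm_sub_le _ _)
    linarith
  rw [Phi_append]
  simp only [List.nil_append]
  have rem : ‖Etr p (A ++ v) (fun b => (ind (NP P [] b) : ℂ) * Phi P p w b g)‖ ≤ d1 + d2 := by
    refine (Etr_norm_le h0 h1 _ _).trans (le_trans ?_ fail)
    refine Etr_mono h0 h1 _ _ _ fun b => ?_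
    rw [norm_mul, Complex.norm_real, Real.norm_of_nonneg (ind_nonneg _)]
    refine mul_le_of_le_one_right (ind_nonneg _) ?_
    refine (Phi_norm_le h0 h1 hw b g).trans ?_
    refine (Etr_mono h0 h1 g _ (fun _ => 1) (fun y => ind_le_one _)).trans ?_
    rw [Etr_const]
  have := norm_sub_le_norm_add (w ^ g.length * Phi P p w [] (A ++ v))
    (Etr p (A ++ v) (fun b => (ind (NP P [] b) : ℂ) * Phi P p w b g))
  have h7 : ‖w‖ ^ g.length / 2 ≤ ‖w ^ g.length * Phi P p w [] (A ++ v)‖ := by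
    rw [norm_mul, norm_pow, div_eq_mul_inv, ← one_div]
    gcongr
  linarith
end

noncomputable def ET (p : ℝ) {T n : ℕ} (g : (Fin T → Fin n → Bool) → ℝ) : ℝ :=
  ∑ r : Fin T → Fin n → Bool, (∏ t, bern p (r t)) * g r

section
variable {p : ℝ} {T n : ℕ}

lemma ET_mono (h0 : 0 ≤ p) (h1 : p ≤ 1) (f g : (Fin T → Fin n → Bool) → ℝ) (h : ∀ r, f r ≤ g r) :
    ET p f ≤ ET p g := by
  unfold ET
  refine Finset.sum_le_sum fun r _ => ?_
  have : 0 ≤ ∏ t, bern p (r t) := Finset.prod_nonneg fun t _ => bern_nonneg h0 h1 _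
  exact mul_le_mul_of_nonneg_left (h r) this

lemma ET_prod (f : (Fin n → Bool) → ℝ) :
    ET p (fun r : Fin T → Fin n → Bool => ∏ t, f (r t)) = (Eb p f) ^ T := by
  unfold ET Eb
  have := Finset.prod_univ_sum (fun _ : Fin T => (Finset.univ : Finset (Fin n → Bool)))
    (fun _ r => bern p r * f r)
  rw [Fintype.piFinset_univ] at this
  simp only [← Finset.prod_mul_distrib]
  rw [← this]; simp

lemma ET_const (c : ℝ) : ET p (fun _ : Fin T → Fin n → Bool => c) = c := by
  have := ET_prod (p := p) (T := T) (n := n) (fun _ => 1)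
  rw [Eb_const] at this
  simp only [Finset.prod_const_one, one_pow] at this
  unfold ET at this ⊢
  rw [← Finset.sum_mul]
  simp only [mul_one] at this
  rw [this, one_mul]

lemma ET_add (f g : (Fin T → Fin n → Bool) → ℝ) : ET p (fun r => f r + g r) = ET p f + ET p g := by
  unfold ET; simp only [mul_add, Finset.sum_add_distrib]

lemma ET_mul (c : ℝ) (f : (Fin T → Fin n → Bool) → ℝ) : ET p (fun r => c * f r) = c * ET p f := by
  unfold ET; rw [Finset.mul_sum]; exact Finset.sum_congr rfl fun r _ => by ring

lemma ET_sum {ι : Type} (s : Finset ι) (f : ι → (Fin T → Fin n → Bool) → ℝ) :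
    ET p (fun r => ∑ i ∈ s, f i r) = ∑ i ∈ s, ET p (f i) := by
  unfold ET; simp only [Finset.mul_sum]; rw [Finset.sum_comm]

lemma chernoff (h0 : 0 ≤ p) (h1 : p ≤ 1) (X : (Fin n → Bool) → ℝ) (hX : ∀ r, |X r| ≤ 1)
    (hE : Eb p X = 0) (η : ℝ) (e0 : 0 ≤ η) (e1 : η ≤ 1) :
    ET p (fun r : Fin T → Fin n → Bool => ind ((T:ℝ) * η < ∑ t, X (r t))) ≤
      Real.exp (-(T * η^2/4)) := by
  have b1 : Eb p (fun r => Real.exp (η/2 * X r)) ≤ Real.exp (η^2/4) := by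
    have : Eb p (fun r => Real.exp (η/2 * X r)) ≤ Eb p (fun r => (1 + η^2/4) + η/2 * X r) := by
      refine Eb_mono h0 h1 _ _ fun r => ?_
      have hx := hX r
      have h2 : |η/2 * X r| ≤ η/2 := by
        rw [abs_mul, abs_of_nonneg (by positivity)]
        exact mul_le_of_le_one_right (by positivity) hx
      have h3 := Real.abs_exp_sub_one_sub_id_le (x := η/2 * X r) (by linarith)
      have h4 := le_of_abs_le h3
      have h5 : (η/2 * X r)^2 ≤ (η/2)^2 := by
        rw [← sq_abs (η/2 * X r)]; gcongr
      have : (η/2)^2 = η^2/4 := by ring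
      linarith
    refine this.trans ?_
    rw [Eb_add, Eb_const, Eb_mul, hE]
    have := Real.add_one_le_exp (η^2/4)
    linarith
  calc ET p (fun r : Fin T → Fin n → Bool => ind ((T:ℝ) * η < ∑ t, X (r t)))
      ≤ ET p (fun r : Fin T → Fin n → Bool => Real.exp (-(T * η^2/2)) * ∏ t, Real.exp (η/2 * X (r t))) := by
        refine ET_mono h0 h1 _ _ fun r => ?_
        rw [← Real.exp_sum, ← Real.exp_add, ← Finset.mul_sum]
        by_cases h : (T:ℝ) * η < ∑ t, X (r t)
        · rw [ind_true h]
          apply Real.one_le_exp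
          have := mul_le_mul_of_nonneg_left h.le (by positivity : 0 ≤ η/2)
          linarith [this, (by ring : η/2 * ((T:ℝ)*η) = T * η^2/2)]
        · rw [ind_false h]; positivity
    _ = Real.exp (-(T * η^2/2)) * (Eb p (fun r : Fin n → Bool => Real.exp (η/2 * X r)))^T := by
        rw [ET_mul, ET_prod (fun r => Real.exp (η/2 * X r))]
    _ ≤ Real.exp (-(T * η^2/2)) * (Real.exp (η^2/4))^T := by
        gcongr
        exact Finset.sum_nonneg fun r _ => mul_nonneg (bern_nonneg h0 h1 _) (Real.exp_pos _).le
    _ = _ := by rw [← Real.exp_nat_mul, ← Real.exp_add]; congr 1; ring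

lemma recon {ι : Type} [Fintype ι] (h0 : 0 ≤ p) (h1 : p ≤ 1) (hT : 0 < T) (k : ℕ)
    (Ψ : List Bool → ι → List Bool → ℝ) (hΨ : ∀ x m y, 0 ≤ Ψ x m y ∧ Ψ x m y ≤ 1)
    (Typ : List Bool → Prop) (η : ℝ) (e0 : 0 ≤ η) (e1 : η ≤ 1)
    (sep : ∀ x x', x.length = n → x'.length = n → Typ x → Typ x' → x.take k ≠ x'.take k →
      ∃ m, Ψ x m = Ψ x' m ∧ 2 * η < |Etr p x (Ψ x m) - Etr p x' (Ψ x m)|) :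
    ∃ F : (Fin T → List Bool) → List Bool, ∀ x, x.length = n → Typ x →
      ET p (fun r : Fin T → Fin n → Bool => ind (¬ F (fun t => traceL x (keep (r t))) = x.take k)) ≤
        Fintype.card ι * (2 * Real.exp (-(T * η^2/4))) := by
  classical
  let Fit : List Bool → (Fin T → List Bool) → Prop := fun x Y =>
    ∀ m, |∑ t, (Ψ x m (Y t) - Etr p x (Ψ x m))| ≤ T * η
  refine ⟨fun Y => if h : ∃ x', x'.length = n ∧ Typ x' ∧ Fit x' Y then h.choose.take k else [],
    fun x hx hTx => ?_⟩
  have step1 : ∀ Y, Fit x Y → (if h : ∃ x', x'.length = n ∧ Typ x' ∧ Fit x' Y then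
      h.choose.take k else []) = x.take k := by
    intro Y hY
    have h : ∃ x', x'.length = n ∧ Typ x' ∧ Fit x' Y := ⟨x, hx, hTx, hY⟩
    rw [dif_pos h]
    obtain ⟨hx', hT', hF'⟩ := h.choose_spec
    set x' := h.choose
    by_contra hne
    obtain ⟨m, hm, hlt⟩ := sep x x' hx hx' hTx hT' (fun e => hne e.symm)
    have f1 := hY m
    have f2 := hF' m
    rw [← hm] at f2
    simp only [Finset.sum_sub_distrib, Finset.sum_const, Finset.card_univ, Fintype.card_fin,
      nsmul_eq_mul] at f1 f2
    have hT' : (0:ℝ) < T := by exact_mod_cast hT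
    have f3 : (T:ℝ) * (Etr p x (Ψ x m) - Etr p x' (Ψ x m)) =
      (∑ t, Ψ x m (Y t) - T * Etr p x' (Ψ x m)) - (∑ t, Ψ x m (Y t) - T * Etr p x (Ψ x m)) := by ring
    have f4 := abs_sub (∑ t, Ψ x m (Y t) - T * Etr p x' (Ψ x m)) (∑ t, Ψ x m (Y t) - T * Etr p x (Ψ x m))
    rw [← f3, abs_mul, abs_of_pos hT'] at f4
    have := mul_lt_mul_of_pos_left hlt hT'
    linarith
  have step2 : ∀ m, ET p (fun r : Fin T → Fin n → Bool =>
      ind (¬ |∑ t, (Ψ x m (traceL x (keep (r t))) - Etr p x (Ψ x m))| ≤ T * η)) ≤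
      2 * Real.exp (-(T * η^2/4)) := by
    intro m
    have hmem : ∀ y, 0 ≤ Ψ x m y ∧ Ψ x m y ≤ 1 := hΨ x m
    have hE0 : 0 ≤ Etr p x (Ψ x m) := Etr_nonneg h0 h1 _ _ fun y => (hmem y).1
    have hE1 : Etr p x (Ψ x m) ≤ 1 := by
      have := Etr_mono h0 h1 x (Ψ x m) (fun _ => 1) fun y => (hmem y).2
      rwa [Etr_const] at this
    set X : (Fin n → Bool) → ℝ := fun r => Ψ x m (traceL x (keep r)) - Etr p x (Ψ x m) with hXd
    have hX1 : ∀ r, |X r| ≤ 1 := fun r => by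
      have := hmem (traceL x (keep r))
      rw [abs_le]; simp only [hXd]; constructor <;> linarith
    have hX0 : Eb p X = 0 := by
      have := Eb_add (p := p) (fun r : Fin n → Bool => Ψ x m (traceL x (keep r)))
        (fun _ => - Etr p x (Ψ x m))
      rw [Eb_const, ← Etr_eq_Eb p x hx] at this
      simpa [hXd, sub_eq_add_neg] using this
    have c1 := chernoff (T := T) h0 h1 X hX1 hX0 η e0 e1
    have c2 := chernoff (T := T) h0 h1 (fun r => (-1) * X r) (fun r => by simpa using hX1 r)
      (by rw [Eb_mul, hX0, mul_zero]) η e0 e1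
    calc _ ≤ ET p (fun r : Fin T → Fin n → Bool => ind ((T:ℝ) * η < ∑ t, X (r t)) +
          ind ((T:ℝ) * η < ∑ t, (-1) * X (r t))) := by
          refine ET_mono h0 h1 _ _ fun r => ind_imp_or fun h => ?_
          rw [not_le, lt_abs] at h
          rw [← Finset.mul_sum, neg_one_mul]
          exact h
      _ ≤ _ := by rw [ET_add]; linarith
  calc _ ≤ ET p (fun r : Fin T → Fin n → Bool => ∑ m : ι,
        ind (¬ |∑ t, (Ψ x m (traceL x (keep (r t))) - Etr p x (Ψ x m))| ≤ T * η)) := by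
        refine ET_mono h0 h1 _ _ fun r => ?_
        refine le_trans (ind_mono ?_) (ind_exists_le Finset.univ _)
        intro h
        by_contra hcon
        push Not at hcon
        exact h (step1 _ fun m => hcon m (Finset.mem_univ m))
    _ ≤ _ := by
        rw [ET_sum]
        refine (Finset.sum_le_sum fun m _ => step2 m).trans ?_
        simp
end

lemma Eun_swap (m m' : ℕ) (g : List Bool → List Bool → ℝ) :
    Eun m (fun a => Eun m' (fun b => g a b)) = Eun m' (fun b => Eun m (fun a => g a b)) := by
  induction m generalizing g with
  | zero => simp [Eun]
  | succ m ih =>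
    simp only [Eun, ih]
    rw [← Eun_add]
    have : (fun b => (Eun m (fun y => g (true :: y) b) + Eun m (fun y => g (false :: y) b)) / 2) =
      fun b => (2:ℝ)⁻¹ * (Eun m (fun y => g (true :: y) b) + Eun m (fun y => g (false :: y) b)) := by
      funext b; ring
    rw [this, Eun_mul_left]; ring

def DOk (p : ℝ) (E : List Bool → List Bool → Prop) (k : ℕ) (t1 : ℝ) (x0 U rest : List Bool) : Prop :=
  Etr p rest (fun y => ind (Hit (E U) (y.take k))) ≤ t1 ∧ Etr p U (fun y => ind (¬ E U y)) ≤ t1 ∧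
    Etr p x0 (fun y => ind (Hit (E U) y)) ≤ 1/20

def Bad (p : ℝ) (E : List Bool → List Bool → Prop) (t2 : ℝ) (U v : List Bool) : Prop :=
  t2 < Etr p v (fun y => ind (¬ E v y)) ∨ 1/20 < Etr p U (fun y => ind (Hit (E v) y))

def BadAt (p : ℝ) (E : List Bool → List Bool → Prop) (lU d : ℕ) (t2 : ℝ) (x : List Bool) (e : ℕ) : Prop :=
  Bad p E t2 ((x.take e).drop (e - lU)) ((x.drop e).take d)

def Typ (p : ℝ) (E : List Bool → List Bool → Prop) (lU d m k m0 : ℕ) (t1 t2 : ℝ) (x : List Bool) : Prop :=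
  (∀ x0 U rest, x = x0 ++ U ++ rest → U.length = lU → m0 ≤ x0.length → x0.length ≤ k →
    DOk p E k t1 x0 U rest) ∧
  (∀ s, m0 + lU ≤ s → s ≤ k → s + d * m ≤ x.length → ∃ i < m, ¬ BadAt p E lU d t2 x (s + i * d))

section
variable {p : ℝ} {E : List Bool → List Bool → Prop}

lemma bad_prob (h0 : 0 ≤ p) (h1 : p ≤ 1) (d : ℕ) (c t2 : ℝ) (hc : 0 ≤ c) (ht : 0 < t2)
    (a1 : ∀ y, Eun d (fun u => ind (E u y)) ≤ c)
    (a2 : Eun d (fun u => Etr p u (fun y => ind (¬ E u y))) ≤ c) (U : List Bool) :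
    Eun d (fun v => ind (Bad p E t2 U v)) ≤ c / t2 + 20 * ((U.length:ℝ)+1)^2 * c := by
  have m1 := Eun_markov d (fun v => Etr p v (fun y => ind (¬ E v y)))
    (fun v => Etr_nonneg h0 h1 _ _ fun y => ind_nonneg _) t2 ht c a2
  have m2 := Eun_markov d (fun v => Etr p U (fun y => ind (Hit (E v) y)))
    (fun v => Etr_nonneg h0 h1 _ _ fun y => ind_nonneg _) (1/20) (by norm_num)
    (((U.length:ℝ)+1)^2 * c) (by
      rw [Eun_Etr]
      refine (Etr_mono' h0 h1 U _ (fun _ => ((U.length:ℝ)+1)^2 * c) fun y hy => ?_).trans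
        (by rw [Etr_const])
      refine (Hit_bound d E c a1 y).trans ?_
      gcongr)
  calc _ ≤ Eun d (fun v => ind (t2 < Etr p v (fun y => ind (¬ E v y))) +
        ind (1/20 < Etr p U (fun y => ind (Hit (E v) y)))) := Eun_mono _ _ _ fun v _ => ind_or _ _
    _ ≤ _ := by rw [Eun_add]; linarith

lemma seq_bad (lU d m : ℕ) (t2 ε : ℝ) (hε : 0 ≤ ε)
    (hb : ∀ U, U.length = lU → Eun d (fun v => ind (Bad p E t2 U v)) ≤ ε)
    (a r : List Bool) (ha : lU ≤ a.length) :
    Eun (d * m) (fun s => ind (∀ i < m, BadAt p E lU d t2 (a ++ s ++ r) (a.length + i * d))) ≤ ε ^ m := by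
  induction m generalizing a with
  | zero => simp [Eun, ind_le_one]
  | succ m ih =>
    rw [show d * (m+1) = d + d * m by ring, Eun_append]
    set U := a.drop (a.length - lU)
    have hU : U.length = lU := by simp [U]; omega
    calc _ ≤ Eun d (fun v => ε ^ m * ind (Bad p E t2 U v)) := by
          refine Eun_mono _ _ _ fun v hv => ?_
          rw [mul_comm (ε ^ m)]
          refine le_trans (b := ind (Bad p E t2 U v) * Eun (d*m) (fun s =>
            ind (∀ i < m, BadAt p E lU d t2 ((a ++ v) ++ s ++ r) ((a ++ v).length + i * d)))) ?_
            (mul_le_mul_of_nonneg_left (ih (a ++ v) (by simp; omega)) (ind_nonneg _))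
          rw [← Eun_mul_left]
          refine Eun_mono _ _ _ fun s hs => ?_
          by_cases h : ∀ i < m + 1, BadAt p E lU d t2 (a ++ (v ++ s) ++ r) (a.length + i * d)
          · have g0 : Bad p E t2 U v := by
              have := h 0 (by omega)
              simpa [BadAt, hv, U] using this
            have g1 : ∀ i < m, BadAt p E lU d t2 ((a ++ v) ++ s ++ r) ((a ++ v).length + i * d) := by
              intro i hi
              have := h (i+1) (by omega)
              have e : (a ++ v).length + i * d = a.length + (i+1) * d := by
                simp [hv]; ring
              rw [e]; simpa using this
            rw [ind_true h, ind_true g0, ind_true g1]; norm_num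
          · rw [ind_false h]; exact mul_nonneg (ind_nonneg _) (ind_nonneg _)
      _ = ε ^ m * Eun d (fun v => ind (Bad p E t2 U v)) := Eun_mul_left _ _ _
      _ ≤ ε ^ m * ε := by
          have := hb U hU
          gcongr
      _ = _ := by ring

lemma dok_prob (h0 : 0 ≤ p) (h1 : p ≤ 1) (lU k : ℕ) (c t1 : ℝ) (hc : 0 ≤ c) (ht : 0 < t1)
    (a1 : ∀ y, Eun lU (fun u => ind (E u y)) ≤ c)
    (a2 : Eun lU (fun u => Etr p u (fun y => ind (¬ E u y))) ≤ c) (x0 rest : List Bool)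
    (hx : x0.length ≤ k) :
    Eun lU (fun U => ind (¬ DOk p E k t1 x0 U rest)) ≤
      ((k:ℝ)+1)^2 * c / t1 + c / t1 + 20 * ((k:ℝ)+1)^2 * c := by
  have nn : ∀ x (f : List Bool → Prop), 0 ≤ Etr p x (fun y => ind (f y)) :=
    fun x f => Etr_nonneg h0 h1 _ _ fun y => ind_nonneg _
  have m0 := Eun_markov lU (fun U => Etr p rest (fun y => ind (Hit (E U) (y.take k))))
    (fun v => nn _ _) t1 ht (((k:ℝ)+1)^2 * c) (by
      rw [Eun_Etr]
      refine (Etr_mono h0 h1 rest _ (fun _ => ((k:ℝ)+1)^2 * c) fun y => ?_).trans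
        (by rw [Etr_const])
      refine (Hit_bound lU E c a1 _).trans ?_
      have : (y.take k).length ≤ k := by simp
      gcongr)
  have m1 := Eun_markov lU (fun v => Etr p v (fun y => ind (¬ E v y)))
    (fun v => nn _ _) t1 ht c a2
  have m2 := Eun_markov lU (fun v => Etr p x0 (fun y => ind (Hit (E v) y)))
    (fun v => nn _ _) (1/20) (by norm_num)
    (((k:ℝ)+1)^2 * c) (by
      rw [Eun_Etr]
      refine (Etr_mono' h0 h1 x0 _ (fun _ => ((k:ℝ)+1)^2 * c) fun y hy => ?_).trans
        (by rw [Etr_const])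
      refine (Hit_bound lU E c a1 y).trans ?_
      have : y.length ≤ k := by omega
      gcongr)
  calc _ ≤ Eun lU (fun U => (ind (t1 < Etr p rest (fun y => ind (Hit (E U) (y.take k)))) +
        ind (t1 < Etr p U (fun y => ind (¬ E U y)))) +
        ind (1/20 < Etr p x0 (fun y => ind (Hit (E U) y)))) := by
        refine Eun_mono _ _ _ fun v _ => ?_
        refine le_trans (ind_mono ?_) ((ind_or _ _).trans (add_le_add (ind_or _ _) le_rfl))
        intro h
        unfold DOk at h
        by_contra hcon
        push Not at hcon
        exact h ⟨hcon.1.1, hcon.1.2, hcon.2⟩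
    _ ≤ _ := by rw [Eun_add, Eun_add]; linarith

lemma typ_prob (h0 : 0 ≤ p) (h1 : p ≤ 1) (lU d m k : ℕ) (c c' t1 t2 ε : ℝ) (hc : 0 ≤ c) (hc' : 0 ≤ c')
    (ht1 : 0 < t1) (ht2 : 0 < t2)
    (a1 : ∀ y, Eun lU (fun u => ind (E u y)) ≤ c)
    (a2 : Eun lU (fun u => Etr p u (fun y => ind (¬ E u y))) ≤ c)
    (b1 : ∀ y, Eun d (fun u => ind (E u y)) ≤ c')
    (b2 : Eun d (fun u => Etr p u (fun y => ind (¬ E u y))) ≤ c')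
    (hε : c' / t2 + 20 * ((lU:ℝ)+1)^2 * c' ≤ ε) (w : List Bool) (N : ℕ) :
    Eun N (fun u => ind (¬ Typ p E lU d m k w.length t1 t2 (w ++ u))) ≤
      ((k:ℝ)+1) * (((k:ℝ)+1)^2 * c / t1 + c / t1 + 20 * ((k:ℝ)+1)^2 * c) + ((k:ℝ)+1) * ε ^ m := by
  have hε0 : 0 ≤ ε := le_trans (by positivity) hε
  set A : ℕ → List Bool → Prop := fun i u => ∃ u1 U rest, u = u1 ++ U ++ rest ∧ U.length = lU ∧
    u1.length + w.length = i ∧ i ≤ k ∧ ¬ DOk p E k t1 (w ++ u1) U rest with hA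
  set F : ℕ → List Bool → Prop := fun s u => w.length + lU ≤ s ∧ s + d * m ≤ w.length + u.length ∧
    ∀ i < m, BadAt p E lU d t2 (w ++ u) (s + i * d) with hF
  have pA : ∀ i, Eun N (fun u => ind (A i u)) ≤
      ((k:ℝ)+1)^2 * c / t1 + c / t1 + 20 * ((k:ℝ)+1)^2 * c := by
    intro i
    by_cases hi : w.length ≤ i ∧ i + lU ≤ w.length + N ∧ i ≤ k
    · obtain ⟨N1, rfl⟩ := Nat.exists_eq_add_of_le hi.1
      obtain ⟨N2, e2⟩ := Nat.exists_eq_add_of_le (show N1 + lU ≤ N by omega)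
      rw [e2, Eun_append, Eun_append]
      refine Eun_le _ _ _ fun u1 hu1 => ?_
      rw [Eun_swap]
      refine Eun_le _ _ _ fun rest hr => ?_
      refine le_trans (Eun_mono _ _ _ fun U hU => ?_)
        (dok_prob h0 h1 lU k c t1 hc ht1 a1 a2 (w ++ u1) rest (by simp; omega))
      refine ind_mono ?_
      rintro ⟨u1', U', rest', e, hU', hl, -, hn⟩
      have e' : u1 ++ (U ++ rest) = u1' ++ (U' ++ rest') := by simpa using e
      obtain ⟨rfl, e''⟩ := List.append_inj e' (by omega)
      obtain ⟨rfl, rfl⟩ := List.append_inj e'' (by omega)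
      exact hn
    · refine Eun_le _ _ _ fun u hu => ?_
      rw [ind_false]
      · positivity
      · rintro ⟨u1, U, rest, rfl, hU, hl, hk, -⟩
        simp at hu
        exact hi ⟨by omega, by omega, hk⟩
  have pF : ∀ s, Eun N (fun u => ind (F s u)) ≤ ε ^ m := by
    intro s
    by_cases hs : w.length + lU ≤ s ∧ s + d * m ≤ w.length + N
    · obtain ⟨N1, rfl⟩ := Nat.exists_eq_add_of_le (show w.length ≤ s by omega)
      obtain ⟨N2, e2⟩ := Nat.exists_eq_add_of_le (show N1 + d * m ≤ N by omega)
      rw [e2, Eun_append, Eun_append]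
      refine Eun_le _ _ _ fun u1 hu1 => ?_
      rw [Eun_swap]
      refine Eun_le _ _ _ fun rest hr => ?_
      refine le_trans (Eun_mono _ _ _ fun v hv => ind_mono ?_)
        (seq_bad (p := p) (E := E) lU d m t2 ε hε0 (fun U hU => ?_) (w ++ u1) rest (by simp; omega))
      · rintro ⟨-, -, h⟩ i hi
        have := h i hi
        simpa [hu1] using this
      · have := bad_prob h0 h1 d c' t2 hc' ht2 b1 b2 U
        rw [hU] at this
        exact this.trans hε
    · refine Eun_le _ _ _ fun u hu => ?_
      rw [ind_false]
      · positivity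
      · rintro ⟨g1, g2, -⟩
        exact hs ⟨g1, by omega⟩
  calc _ ≤ Eun N (fun u => ∑ i ∈ Finset.range (k+1), ind (A i u) + ∑ s ∈ Finset.range (k+1), ind (F s u)) := by
        refine Eun_mono _ _ _ fun u hu => ?_
        refine le_trans (ind_imp_or ?_) (add_le_add (ind_exists_le _ _) (ind_exists_le _ _))
        intro h
        by_contra hcon
        push Not at hcon
        refine h ⟨?_, ?_⟩
        · intro x0 U rest e hU hm hk
          by_contra hd
          have hw : w <+: x0 := by
            refine List.prefix_of_prefix_length_le (l₃ := w ++ u) ⟨u, rfl⟩ ⟨U ++ rest, by rw [e]; simp⟩ hm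
          obtain ⟨u1, rfl⟩ := hw
          refine hcon.1 (u1.length + w.length) (by simp at hk ⊢; omega) ⟨u1, U, rest, ?_, hU, rfl, ?_, hd⟩
          · simpa using e
          · simp at hk; omega
        · intro s g1 g2 g3
          by_contra hd
          push Not at hd
          exact hcon.2 s (by simp; omega) ⟨g1, by simpa using g3, hd⟩
    _ ≤ _ := by
        rw [Eun_add, Eun_sum, Eun_sum]
        have s1 := Finset.sum_le_sum (s := Finset.range (k+1)) fun i _ => pA i
        have s2 := Finset.sum_le_sum (s := Finset.range (k+1)) fun i _ => pF i
        simp only [Finset.sum_const, Finset.card_range, nsmul_eq_mul] at s1 s2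
        push_cast at s1 s2
        linarith
end

lemma first_diff (k : ℕ) (x x' : List Bool) (hl : x.length = x'.length) (h : x.take k ≠ x'.take k) :
    ∃ u b y1 y2, x = u ++ b :: y1 ∧ x' = u ++ (!b) :: y2 ∧ u.length < k := by
  induction x generalizing x' k with
  | nil =>
    have : x' = [] := by simpa using hl.symm
    subst this; simp at h
  | cons b x ih =>
    cases x' with
    | nil => simp at hl
    | cons b' x' =>
      cases k with
      | zero => simp at h
      | succ k =>
        by_cases hb : b' = b
        · subst hb
          obtain ⟨u, c, y1, y2, e1, e2, hu⟩ := ih k x' (by simpa using hl) (by simpa using h)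
          exact ⟨b' :: u, c, y1, y2, by simp [e1], by simp [e2], by simpa using hu⟩
        · refine ⟨[], b, x, x', rfl, ?_, by simp⟩
          have : b' = !b := by cases b <;> cases b' <;> simp_all
          simp [this]

def PP (E : List Bool → List Bool → Prop) (lU d k : ℕ) (x : List Bool) (e : ℕ) : List Bool → Prop :=
  if e = 0 then fun _ => True else
    Pass k (E ((x.take e).drop (e - lU))) (E ((x.drop e).take d))

noncomputable def Psi (E : List Bool → List Bool → Prop) (lU d k L : ℕ) (x : List Bool)
    (m : Fin (k+1) × Fin L) : List Bool → ℝ := stat (PP E lU d k x m.1) (bit m.2) []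

lemma sep_final (p : ℝ) (hp : 0 < p) (hp1 : p ≤ 1) (E : List Bool → List Bool → Prop)
    (hE : ∀ u y, E u y → y.length ≤ u.length) (K : ℕ) (hK : 250 / p ≤ K)
    (lU d m k m0 G L : ℕ) (t1 t2 η : ℝ) (hlU : 0 < lU) (ht : t1 + t2 ≤ 1/5)
    (hd : (d:ℝ) * (6/K) ≤ 1/10) (hρ : 0 ≤ 1 - (25/p+3)/(K:ℝ)^2)
    (hnum1 : 2 * η * L + 2 * (K:ℝ)^2 * 0 + 2 * (K:ℝ)^2 * Real.exp (-(12 * L / (K:ℝ)^2))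
      < p * (1 - (25/p+3)/(K:ℝ)^2)^(m0 + lU + G + d * m) * (1/8:ℝ)^K)
    (hφ0 : 0 ≤ (1 - (25/p+3)/(K:ℝ)^2)^(G + d * m) / 2 - (t1 + t2))
    (hnum2 : 2 * η * L + 2 * (K:ℝ)^2 * (Real.exp (((lU + d : ℕ):ℝ) - p * G / 2) + t1)
      + 2 * (K:ℝ)^2 * Real.exp (-(12 * L / (K:ℝ)^2))
      < p * ((1 - (25/p+3)/(K:ℝ)^2)^(G + d * m) / 2 - (t1 + t2)) * (1/8:ℝ)^K)
    (x x' : List Bool) (hl : x.length = x'.length)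
    (hx : Typ p E lU d m k m0 t1 t2 x) (hx' : Typ p E lU d m k m0 t1 t2 x')
    (hne : x.take k ≠ x'.take k) :
    ∃ mm, Psi E lU d k L x mm = Psi E lU d k L x' mm ∧
      2 * η < |Etr p x (Psi E lU d k L x mm) - Etr p x' (Psi E lU d k L x mm)| := by
  obtain ⟨u, b, y1, y2, rfl, rfl, hu⟩ := first_diff k x x' hl hne
  have hp0 := hp.le
  set c := (25/p+3)/(K:ℝ)^2 with hc
  have hc0 : 0 ≤ c := by positivity
  have hρ1 : 1 - c ≤ 1 := by linarith
  by_cases hj : u.length < m0 + lU + G + d * m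
  · have key := sep_core p hp hp1 K hK L (fun _ => True) u b y1 y2
      ((1-c)^(m0 + lU + G + d * m)) 0 η (by positivity)
      (fun w _ h2 _ => by
        rw [Phi_pos trivial, norm_pow]
        calc (1-c)^(m0 + lU + G + d * m) ≤ (1-c)^u.length := pow_le_pow_of_le_one hρ hρ1 hj.le
          _ ≤ _ := by gcongr)
      (by
        have : ∀ a : List Bool, ind (NP (fun _ => True) [] a) = 0 := fun a => ind_false (NP_head trivial a)
        simp [this, Etr_const])
      (by
        have : ∀ a : List Bool, ind (NP (fun _ => True) [] a) = 0 := fun a => ind_false (NP_head trivial a)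
        simp [this, Etr_const])
      hnum1
    obtain ⟨l, hlL, hlt⟩ := key
    refine ⟨(0, ⟨l, hlL⟩), ?_, ?_⟩
    · simp [Psi, PP]
    · simpa [Psi, PP] using hlt
  · push Not at hj
    obtain ⟨s, hs⟩ := Nat.exists_eq_add_of_le (show G + d * m ≤ u.length by omega)
    obtain ⟨i, hi, hbad⟩ := hx.2 s (by omega) (by omega) (by simp; omega)
    set e := s + i * d with he
    have hid : i * d + d ≤ d * m := by
      calc i * d + d = d * (i+1) := by ring
        _ ≤ d * m := Nat.mul_le_mul_left d hi
    have e1 : ∀ r, ((u ++ r).take e).drop (e - lU) = (u.take e).drop (e - lU) := fun r => by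
      rw [List.take_append_of_le_length (by omega)]
    have e2 : ∀ r, ((u ++ r).drop e).take d = (u.drop e).take d := fun r => by
      rw [List.drop_append_of_le_length (by omega), List.take_append_of_le_length (by simp; omega)]
    set u0 := u.take (e - lU) with hu0
    set U := (u.take e).drop (e - lU) with hU
    set v := (u.drop e).take d with hv
    set g := u.drop (e + d) with hg
    have lu0 : u0.length = e - lU := by simp [hu0]; omega
    have lUl : U.length = lU := by simp [hU]; omega
    have lv : v.length = d := by simp [hv]; omega
    have lg : g.length = u.length - (e + d) := by simp [hg]
    have dec : u = u0 ++ U ++ v ++ g := by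
      have h1 : u.take e = u0 ++ U := by
        have := List.take_append_drop (e - lU) (u.take e)
        rw [List.take_take, min_eq_left (by omega)] at this
        exact this.symm
      have h2 : u.drop e = v ++ g := by
        have := List.take_append_drop d (u.drop e)
        rw [List.drop_drop] at this
        exact this.symm
      have h3 := List.take_append_drop e u
      rw [h1, h2] at h3
      rw [← h3]; simp
    have hP : ∀ r, PP E lU d k (u ++ r) e = Pass k (E U) (E v) := fun r => by
      rw [PP, if_neg (by omega), e1, e2]
    unfold BadAt Bad at hbad
    rw [e1, e2] at hbad
    push Not at hbad
    clear_value u0 U v g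
    have dec' : ∀ r, u ++ r = u0 ++ U ++ (v ++ g ++ r) := fun r => by rw [dec]; simp
    obtain ⟨d1a, d1b, d1c⟩ := hx.1 u0 U (v ++ g ++ b :: y1) (dec' _) lUl (by omega) (by omega)
    obtain ⟨d2a, d2b, d2c⟩ := hx'.1 u0 U (v ++ g ++ (!b) :: y2) (dec' _) lUl (by omega) (by omega)
    have tail : Etr p g (fun y => ind (y.length < lU + d)) ≤ Real.exp (((lU + d : ℕ):ℝ) - p * G / 2) := by
      refine (len_tail hp0 hp1 (lU + d) g).trans ?_
      have : G ≤ g.length := by omega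
      gcongr
    have late : ∀ r, Etr p (v ++ g ++ r) (fun y => ind (Hit (E U) (y.take k))) ≤ t1 →
        Etr p u (fun a => ind (NP (Pass k (E U) (E v)) [] a) *
        Etr p r (fun y => ind (∃ c, c <+: y ∧ Pass k (E U) (E v) (a ++ c)))) ≤
        Real.exp (((lU + d : ℕ):ℝ) - p * G / 2) + t1 := by
      intro r hr
      rw [dec]
      refine (late_bound (m1 := lU) (m2 := d) hp0 hp1 (fun s hs => lUl ▸ hE U s hs) (fun s hs => lv ▸ hE v s hs)
        (u0 ++ U) v g r).trans ?_
      linarith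
    have key := sep_core p hp hp1 K hK L (Pass k (E U) (E v)) u b y1 y2
      ((1-c)^(G + d * m) / 2 - (t1 + t2)) (Real.exp (((lU + d : ℕ):ℝ) - p * G / 2) + t1) η hφ0
      (fun w h1 h2 h3 => by
        have := phi_low (p := p) (k := k) hp0 hp1 u0 U v g (by
            have : (u0 ++ U ++ v ++ g).length < k := by rw [← dec]; exact hu
            simp at this ⊢; omega) t1 t2 d1c hbad.2 d1b hbad.1 ht w h1 (by
              rw [lv]
              refine le_trans ?_ hd
              gcongr)
        rw [← dec] at this
        refine le_trans ?_ this
        have h5 : (1-c)^(G + d * m) ≤ ‖w‖ ^ g.length := by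
          calc (1-c)^(G + d * m) ≤ (1-c)^g.length :=
                pow_le_pow_of_le_one hρ hρ1 (by
                  have : i * d ≥ 0 := by positivity
                  omega)
            _ ≤ _ := by gcongr
        linarith)
      (late _ d1a) (late _ d2a) hnum2
    obtain ⟨l, hlL, hlt⟩ := key
    have hek : e < k + 1 := by omega
    refine ⟨(⟨e, hek⟩, ⟨l, hlL⟩), ?_, ?_⟩
    · simp only [Psi]; rw [hP, hP]
    · simp only [Psi]; rw [hP]; exact hlt

lemma growth (Cb : ℝ) : ∃ a0 : ℕ, ∀ a : ℕ, a0 ≤ a → Cb * (a:ℝ)^3 ≤ Real.exp a := by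
  have h := (Real.tendsto_pow_mul_exp_neg_atTop_nhds_zero 3).comp (tendsto_natCast_atTop_atTop (R := ℝ))
  have h2 := h.eventually (gt_mem_nhds (show (0:ℝ) < 1 / (|Cb| + 1) by positivity))
  obtain ⟨a0, ha⟩ := Filter.eventually_atTop.1 h2
  refine ⟨a0, fun a h => ?_⟩
  have h3 := ha a h
  simp only [Function.comp] at h3
  rw [Real.exp_neg, ← div_eq_mul_inv, div_lt_div_iff₀ (Real.exp_pos _) (by positivity)] at h3
  have : Cb * (a:ℝ)^3 ≤ |Cb| * (a:ℝ)^3 := by gcongr; exact le_abs_self _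
  have : 0 ≤ (a:ℝ)^3 := by positivity
  linarith

lemma rho_pow (C0 lam B a : ℝ) (M : ℕ) (h0 : 0 ≤ C0) (hl : 1 ≤ lam) (hB : 1 ≤ B) (ha : 1 ≤ a) (hCB : C0 ≤ B)
    (hM : C0 * M ≤ (B + lam * B^2) * a^3) :
    0 ≤ 1 - C0 / (100 * lam * B * a)^2 ∧ Real.exp (-a) ≤ (1 - C0 / (100 * lam * B * a)^2)^M := by
  set Q := 100 * lam * B * a with hQ
  have hQ0 : 0 < Q := by positivity
  have hQB : B ≤ Q := by
    have h1 : B * 1 ≤ B * (100 * lam * a) := by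
      gcongr
      have : 1 * 1 ≤ lam * a := by gcongr
      linarith
    linarith
  set c := C0 / Q^2 with hc
  have hc0 : 0 ≤ c := by positivity
  have hc1 : c ≤ 1/2 := by
    rw [hc, div_le_iff₀ (by positivity)]
    have hQ100 : 100 ≤ Q := by
      have : 1 * 1 * 1 ≤ lam * B * a := by gcongr
      linarith
    have : 100 * Q ≤ Q * Q := by gcongr
    have : Q^2 = Q * Q := sq Q
    linarith
  refine ⟨by linarith, ?_⟩
  have e1 : Real.exp (-(2*c)) ≤ 1 - c := by
    rw [Real.exp_neg, inv_le_comm₀ (Real.exp_pos _) (by linarith)]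
    refine le_trans ?_ (Real.add_one_le_exp (2*c))
    rw [inv_le_iff_one_le_mul₀ (by linarith)]
    have : c * c ≤ c * (1/2) := by gcongr
    linarith [(by ring : (2*c+1)*(1-c) = 1 + c - 2*(c*c))]
  calc Real.exp (-a) ≤ Real.exp (-(2*c)) ^ M := by
        rw [← Real.exp_nat_mul]
        gcongr
        have : (M:ℝ) * -(2*c) = -(2 * (C0 * M) / Q^2) := by rw [hc]; ring
        rw [this, neg_le_neg_iff, div_le_iff₀ (by positivity)]
        have hBB : B ≤ lam * B^2 := by
          have : 1 * (B * 1) ≤ lam * (B * B) := by gcongr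
          linarith [sq B, (by ring : lam * (B*B) = lam * B^2)]
        have hll : lam * B^2 ≤ lam^2 * B^2 := by
          have : lam * 1 ≤ lam * lam := by gcongr
          rw [mul_one, ← sq] at this
          gcongr
        calc 2 * (C0 * M) ≤ 2 * ((B + lam * B^2) * a^3) := by gcongr
          _ ≤ 2 * ((lam^2 * B^2 + lam^2 * B^2) * a^3) := by gcongr; linarith
          _ = 4 * (lam^2 * B^2 * a^3) := by ring
          _ ≤ 10000 * (lam^2 * B^2 * a^3) := by gcongr; norm_num
          _ = a * Q^2 := by rw [hQ]; ring
    _ ≤ _ := by gcongr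

lemma eight_pow (K : ℕ) : Real.exp (-(3 * K)) ≤ (1/8:ℝ)^K := by
  have : Real.exp (-3) ≤ 1/8 := by
    rw [Real.exp_neg, one_div]
    apply inv_anti₀ (by norm_num)
    have h := Real.add_one_le_exp (1:ℝ)
    calc (8:ℝ) = 2^3 := by norm_num
      _ ≤ (Real.exp 1)^3 := by gcongr; linarith
      _ = Real.exp 3 := by rw [← Real.exp_nat_mul]; norm_num
  calc Real.exp (-(3*K)) = (Real.exp (-3))^K := by rw [← Real.exp_nat_mul]; congr 1; ring
    _ ≤ _ := by gcongr

/-- the numeric inequality behind separation -/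
lemma num_sep (p a K2 L η lt ex φ q8 C3 : ℝ) (hp : 0 < p) (_ha : 0 ≤ a) (hK2 : 0 ≤ K2)
    (h1 : 32 * L * 1 ≤ p * Real.exp a) (h2 : 64 * K2 ≤ p * Real.exp a)
    (hη : η = Real.exp (-((C3 + 1) * a))) (hlt : lt ≤ 2 * Real.exp (-((C3+1) * a)))
    (hex : ex ≤ Real.exp (-((C3+1)*a))) (hφ : Real.exp (-a) / 4 ≤ φ)
    (hq : Real.exp (-((C3-1) * a)) ≤ q8) :
    2 * η * L + 2 * K2 * lt + 2 * K2 * ex < p * φ * q8 := by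
  set X := Real.exp (-((C3+1)*a)) with hX
  have hX0 : 0 < X := Real.exp_pos _
  have e1 : X * Real.exp a = Real.exp (-(C3 * a)) := by rw [hX, ← Real.exp_add]; congr 1; ring
  have e2 : Real.exp (-a) * Real.exp (-((C3-1)*a)) = Real.exp (-(C3 * a)) := by
    rw [← Real.exp_add]; congr 1; ring
  set Y := Real.exp (-(C3*a)) with hY
  have hY0 : 0 < Y := Real.exp_pos _
  have hφ1 : 0 ≤ φ := le_trans (by positivity) hφ
  have r : p * (Y/4) ≤ p * φ * q8 := by
    calc p * (Y/4) = p * (Real.exp (-a)/4) * Real.exp (-((C3-1)*a)) := by rw [← e2]; ring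
      _ ≤ _ := by gcongr
  have l1 : 2 * η * L ≤ p * Y / 16 := by
    have := mul_le_mul_of_nonneg_left h1 hX0.le
    rw [hη]
    linarith [(by rw [← e1]; ring : X * (p * Real.exp a) = p * Y)]
  have l0 : X * (64 * K2) ≤ p * Y := by
    have := mul_le_mul_of_nonneg_left h2 hX0.le
    linarith [(by rw [← e1]; ring : X * (p * Real.exp a) = p * Y)]
  have l2 : 2 * K2 * lt ≤ 2 * K2 * (2 * X) := by gcongr
  have l3 : 2 * K2 * ex ≤ 2 * K2 * X := by gcongr
  have : 0 < p * Y := by positivity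
  linarith

lemma exp_ge_nine {A : ℝ} (hA : 8 ≤ A) : 9 ≤ Real.exp A := by
  have := Real.add_one_le_exp A; linarith

lemma typ_num (A k c t1 εm : ℝ) (hA : 8 ≤ A) (hk0 : 1 ≤ k) (hk : k ≤ Real.exp A) (hc : c = Real.exp (-(11*A)))
    (ht1 : t1 = Real.exp (-A)) (hε0 : 0 ≤ εm) (hε : εm ≤ Real.exp (-(4*A))) :
    (k+1) * ((k+1)^2 * c / t1 + c / t1 + 20 * (k+1)^2 * c) + (k+1) * εm ≤ Real.exp (-A) / 2 := by
  set y := Real.exp (-A) with hy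
  have hy0 : 0 < y := Real.exp_pos _
  have hX : Real.exp A = y⁻¹ := by rw [hy, Real.exp_neg, inv_inv]
  have hy9 : y ≤ 1/9 := by
    have := exp_ge_nine hA
    rw [hX] at this
    rw [le_inv_comm₀ (by norm_num) hy0] at this
    linarith
  have hc' : c = y^11 := by rw [hc, hy, ← Real.exp_nat_mul]; congr 1; push_cast; ring
  have hε' : εm ≤ y^4 := by
    refine hε.trans (le_of_eq ?_); rw [hy, ← Real.exp_nat_mul]; congr 1; push_cast; ring
  have hky : (k+1) * y ≤ 2 := by
    have h1 : k * y ≤ 1 := by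
      rw [hX] at hk
      calc k * y ≤ y⁻¹ * y := by gcongr
        _ = 1 := by field_simp
    linarith
  set z := (k+1)*y with hz
  have hz0 : 0 ≤ z := by positivity
  have e : (k+1) * ((k+1)^2 * c / t1 + c / t1 + 20 * (k+1)^2 * c) =
      z^3 * y^7 + z * y^9 + 20 * z^3 * y^8 := by
    rw [hc', ht1, hz]; field_simp
  have e2 : (k+1) * εm ≤ z * y^3 := by
    calc (k+1) * εm ≤ (k+1) * y^4 := by gcongr
      _ = _ := by rw [hz]; ring
  rw [e]
  have z3 : z^3 ≤ 8 := by calc z^3 ≤ 2^3 := by gcongr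
    _ = 8 := by norm_num
  have y2 : y^2 ≤ (1/9)^2 := by gcongr
  have y6 : y^6 ≤ (1/9)^6 := by gcongr
  have y7 : y^7 ≤ (1/9)^7 := by gcongr
  have y8 : y^8 ≤ (1/9)^8 := by gcongr
  calc z^3 * y^7 + z * y^9 + 20 * z^3 * y^8 + (k+1) * εm
      ≤ z^3 * y^7 + z * y^9 + 20 * z^3 * y^8 + z * y^3 := by linarith
    _ = y * (z^3 * y^6 + z * y^8 + 20 * (z^3 * y^7) + z * y^2) := by ring
    _ ≤ y * (8 * (1/9)^6 + 2 * (1/9)^8 + 20 * (8 * (1/9)^7) + 2 * (1/9)^2) := by gcongr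
    _ ≤ y * (1/2) := by gcongr; norm_num
    _ = y/2 := by ring

lemma eps_num (a b lU : ℝ) (ha : 2 ≤ a) (hb : 12 * a ≤ b) (hl0 : 0 ≤ lU) (hl : lU + 1 ≤ Real.exp a) :
    Real.exp (-b) / Real.exp (-(b/2)) + 20 * (lU+1)^2 * Real.exp (-b) ≤ Real.exp (-(b/3)) := by
  have hy0 : 0 < Real.exp (-a) := Real.exp_pos _
  have h3 : Real.exp (-a) ≤ 1/3 := by
    rw [Real.exp_neg, one_div]; apply inv_anti₀ (by norm_num)
    have := Real.add_one_le_exp a; linarith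
  have h1 : Real.exp (-b) / Real.exp (-(b/2)) ≤ Real.exp (-(b/3)) * Real.exp (-a)^2 := by
    rw [← Real.exp_sub, ← Real.exp_nat_mul, ← Real.exp_add]
    gcongr; push_cast; linarith
  have h2 : 20 * (lU+1)^2 * Real.exp (-b) ≤ Real.exp (-(b/3)) * (20 * Real.exp (-a)^6) := by
    calc 20 * (lU+1)^2 * Real.exp (-b) ≤ 20 * (Real.exp a)^2 * Real.exp (-b) := by gcongr
      _ = 20 * Real.exp (2 * a - b) := by
        rw [← Real.exp_nat_mul, mul_assoc, ← Real.exp_add]; congr 2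
      _ ≤ 20 * Real.exp (-(b/3) + 6 * (-a)) := by gcongr; linarith
      _ = _ := by rw [Real.exp_add, ← Real.exp_nat_mul]; push_cast; ring
  have h4 : Real.exp (-a)^2 ≤ (1/3)^2 := by gcongr
  have h6 : Real.exp (-a)^6 ≤ (1/3)^6 := by gcongr
  have hz : 0 < Real.exp (-(b/3)) := Real.exp_pos _
  calc _ ≤ Real.exp (-(b/3)) * (Real.exp (-a)^2 + 20 * Real.exp (-a)^6) := by linarith
    _ ≤ Real.exp (-(b/3)) * ((1/3)^2 + 20 * (1/3)^6) := by gcongr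
    _ ≤ Real.exp (-(b/3)) * 1 := by gcongr; norm_num
    _ = _ := mul_one _

lemma recon_num (a A k L T η C6 : ℝ) (haA : a ≤ A) (hA : 8 ≤ A) (hk0 : 1 ≤ k) (hk : k ≤ Real.exp A)
    (hL0 : 0 ≤ L) (hL : 32 * L ≤ Real.exp a) (h16 : 16 * A ≤ Real.exp a)
    (hT : Real.exp ((2 * C6 + 1) * a) ≤ T) (hη : η = Real.exp (-(C6 * a))) :
    (k+1) * L * (2 * Real.exp (-(T * η^2/4))) ≤ Real.exp (-A) / 2 := by
  have h1 : 4 * A ≤ T * η^2/4 := by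
    have : Real.exp a ≤ T * η^2 := by
      calc Real.exp a = Real.exp ((2 * C6 + 1) * a) * η^2 := by
            rw [hη, ← Real.exp_nat_mul, ← Real.exp_add]; congr 1; push_cast; ring
        _ ≤ _ := by gcongr
    linarith
  have h2 : Real.exp (-(T * η^2/4)) ≤ Real.exp (-(4*A)) := by gcongr
  have h3 : L ≤ Real.exp A / 32 := by
    have : Real.exp a ≤ Real.exp A := by gcongr
    linarith
  have h4 : k + 1 ≤ 2 * Real.exp A := by
    have := exp_ge_nine hA; linarith
  have hX := exp_ge_nine hA
  calc (k+1) * L * (2 * Real.exp (-(T * η^2/4)))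
      ≤ (2 * Real.exp A) * (Real.exp A / 32) * (2 * Real.exp (-(4*A))) := by gcongr
    _ = (1/8) * Real.exp (-(2*A)) := by
        have : Real.exp (-(2*A)) = Real.exp A * Real.exp A * Real.exp (-(4*A)) := by
          rw [← Real.exp_add, ← Real.exp_add]; congr 1; ring
        rw [this]; ring
    _ ≤ (1/2) * Real.exp (-A) := by gcongr <;> linarith
    _ = _ := by ring

lemma cube_ge {a : ℝ} {X : ℝ} (ha : 1 ≤ a) (hX : X ≤ a) (hX0 : 0 ≤ X) : X * a ≤ a^3 := by
  have h1 : X * a ≤ a * a := mul_le_mul_of_nonneg_right hX (by linarith)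
  have h2 : a * a * 1 ≤ a * a * a := mul_le_mul_of_nonneg_left ha (by positivity)
  have : a^3 = a*a*a := by ring
  linarith

lemma core_sep (p : ℝ) (hp : 0 < p) (hp1 : p ≤ 1) (E : List Bool → List Bool → Prop)
    (hE : ∀ u y, E u y → y.length ≤ u.length) (lam B g0 c'' C3 L0 a k m0 : ℕ)
    (hlam : 1 ≤ lam) (hB12 : 12 ≤ B) (hCB : 25/p+3 ≤ B)
    (hCB2 : (25/p+3) * ((c'':ℝ) + 11*lam + g0) ≤ B)
    (hg0 : 2/p * (12*lam+1) ≤ (g0:ℝ))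
    (hC3 : C3 = 300*lam*B+1) (hL0 : L0 = 1000*lam^2*B^2*(C3+1))
    (haC : C3 + 1 ≤ a) (haB : B ≤ a)
    (h1 : 32 * ((L0:ℝ) * a^3) ≤ p * Real.exp a)
    (h2 : 64 * (10000 * (lam:ℝ)^2 * B^2 * a^3) ≤ p * Real.exp a)
    (hm0 : m0 ≤ c'' * a^3) (x x' : List Bool) (hl : x.length = x'.length)
    (hx : Typ p E (lam*(11*a^3)) (lam*(B*a)) (a^2) k m0 (Real.exp (-(a:ℝ)^3)) (Real.exp (-((B:ℝ)*a/2))) x)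
    (hx' : Typ p E (lam*(11*a^3)) (lam*(B*a)) (a^2) k m0 (Real.exp (-(a:ℝ)^3)) (Real.exp (-((B:ℝ)*a/2))) x')
    (hne : x.take k ≠ x'.take k) :
    ∃ mm, Psi E (lam*(11*a^3)) (lam*(B*a)) k (L0*a^3) x mm = Psi E (lam*(11*a^3)) (lam*(B*a)) k (L0*a^3) x' mm ∧
      2*Real.exp (-(((C3:ℝ)+1)*a)) < |Etr p x (Psi E (lam*(11*a^3)) (lam*(B*a)) k (L0*a^3) x mm)
        - Etr p x' (Psi E (lam*(11*a^3)) (lam*(B*a)) k (L0*a^3) x mm)| := by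
  have hlamR : (1:ℝ) ≤ lam := by exact_mod_cast hlam
  have hBR : (12:ℝ) ≤ B := by exact_mod_cast hB12
  have haBR : (B:ℝ) ≤ a := by exact_mod_cast haB
  have haR : (12:ℝ) ≤ a := by linarith
  have haCR : (C3:ℝ) + 1 ≤ a := by exact_mod_cast haC
  have hC3R : (C3:ℝ) = 300*lam*B+1 := by rw [hC3]; push_cast; ring
  have hL0R : (L0:ℝ) = 1000*lam^2*B^2*(C3+1) := by rw [hL0]; push_cast; ring
  have hC30 : (0:ℝ) ≤ C3 := by positivity
  have hC0 : 0 ≤ 25/p+3 := by positivity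
  have ha1 : (1:ℝ) ≤ a := by linarith
  have hKc : ((100*lam*B*a : ℕ):ℝ) = 100*lam*B*a := by push_cast; ring
  have hA : ((C3:ℝ)+1)*a ≤ (a:ℝ)^3 := cube_ge ha1 haCR (by linarith)
  -- Ms
  have hM : (25/p+3) * ((m0+lam*(11*a^3)+g0*a^3+lam*(B*a)*a^2 : ℕ):ℝ) ≤ ((B:ℝ)+lam*(B:ℝ)^2)*(a:ℝ)^3 := by
    have hm : (m0:ℝ) ≤ c'' * (a:ℝ)^3 := by exact_mod_cast hm0
    have e1 : ((m0+lam*(11*a^3)+g0*a^3+lam*(B*a)*a^2 : ℕ):ℝ) ≤ ((c'':ℝ) + 11*lam + g0) * (a:ℝ)^3 + lam*B*(a:ℝ)^3 := by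
      push_cast
      have : (lam:ℝ)*(B*a)*(a:ℝ)^2 = lam*B*(a:ℝ)^3 := by ring
      rw [this]; linarith
    have e2 := mul_le_mul_of_nonneg_left e1 hC0
    have e3 := mul_le_mul_of_nonneg_right hCB2 (by positivity : (0:ℝ) ≤ (a:ℝ)^3)
    have e4 := mul_le_mul_of_nonneg_right hCB (by positivity : (0:ℝ) ≤ lam*B*(a:ℝ)^3)
    refine e2.trans ?_
    calc _ = (25/p+3) * ((c'':ℝ) + 11*lam + g0) * (a:ℝ)^3 + (25/p+3) * (lam*B*(a:ℝ)^3) := by ring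
      _ ≤ B * (a:ℝ)^3 + B * (lam*B*(a:ℝ)^3) := add_le_add e3 e4
      _ = _ := by ring
  have hM2 : (25/p+3) * ((g0*a^3+lam*(B*a)*a^2 : ℕ):ℝ) ≤ ((B:ℝ)+lam*(B:ℝ)^2)*(a:ℝ)^3 := by
    refine le_trans (mul_le_mul_of_nonneg_left ?_ hC0) hM
    exact_mod_cast (by omega : g0*a^3+lam*(B*a)*a^2 ≤ m0+lam*(11*a^3)+g0*a^3+lam*(B*a)*a^2)
  obtain ⟨hρ, r1⟩ := rho_pow (25/p+3) lam B a _ hC0 hlamR (by linarith) ha1 hCB hM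
  obtain ⟨_, r2⟩ := rho_pow (25/p+3) lam B a _ hC0 hlamR (by linarith) ha1 hCB hM2
  rw [← hKc] at hρ r1 r2
  have hexa : (8:ℝ) ≤ Real.exp a := by have := Real.add_one_le_exp (a:ℝ); linarith
  have hea0 : 0 < Real.exp (-(a:ℝ)) := Real.exp_pos _
  have hea : Real.exp (-(a:ℝ)) * Real.exp a = 1 := by rw [← Real.exp_add]; simp
  have hea8 : Real.exp (-(a:ℝ)) ≤ 1/8 := by
    have := mul_le_mul_of_nonneg_left hexa hea0.le
    linarith
  have ht1 : Real.exp (-(a:ℝ)^3) ≤ Real.exp (-(2*(a:ℝ))) := by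
    apply Real.exp_le_exp.2
    have := cube_ge ha1 (by linarith : (2:ℝ) ≤ a) (by norm_num)
    linarith
  have ht2 : Real.exp (-((B:ℝ)*a/2)) ≤ Real.exp (-(2*(a:ℝ))) := by
    apply Real.exp_le_exp.2
    have := mul_le_mul_of_nonneg_right hBR (by linarith : (0:ℝ) ≤ a)
    linarith
  have h2a : Real.exp (-(2*(a:ℝ))) ≤ Real.exp (-(a:ℝ)) / 8 := by
    have : Real.exp (-(2*(a:ℝ))) = Real.exp (-(a:ℝ)) * Real.exp (-(a:ℝ)) := by
      rw [← Real.exp_add]; congr 1; ring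
    rw [this]
    have := mul_le_mul_of_nonneg_left hea8 hea0.le
    linarith
  have hq : Real.exp (-(((C3:ℝ)-1)*a)) ≤ (1/8:ℝ)^(100*lam*B*a) := by
    refine le_trans (le_of_eq ?_) (eight_pow _)
    rw [hKc, hC3R]; congr 1; ring
  have hK0 : (0:ℝ) < ((100*lam*B*a : ℕ):ℝ) := by rw [hKc]; positivity
  have hK2 : 64 * ((100*lam*B*a : ℕ):ℝ)^2 ≤ p * Real.exp a := by
    refine le_trans ?_ h2
    rw [hKc]
    have : (a:ℝ)^2 ≤ (a:ℝ)^3 := pow_le_pow_right₀ ha1 (by norm_num)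
    have := mul_le_mul_of_nonneg_left this (by positivity : (0:ℝ) ≤ 64*(10000 * (lam:ℝ)^2 * B^2))
    linarith
  have hex : Real.exp (-(12*((L0*a^3 : ℕ):ℝ)/((100*lam*B*a : ℕ):ℝ)^2)) ≤ Real.exp (-(((C3:ℝ)+1)*a)) := by
    apply Real.exp_le_exp.2
    rw [neg_le_neg_iff, le_div_iff₀ (by positivity), hKc]
    push_cast
    rw [hL0R]
    have : (0:ℝ) ≤ ((C3:ℝ)+1) * a^3*lam^2*B^2 := by positivity
    linarith
  have hL1 : 32 * ((L0*a^3 : ℕ):ℝ) * 1 ≤ p * Real.exp a := by push_cast; linarith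
  refine sep_final p hp hp1 E hE (100*lam*B*a) ?_ (lam*(11*a^3)) (lam*(B*a)) (a^2) k m0 (g0*a^3) (L0*a^3)
    (Real.exp (-(a:ℝ)^3)) (Real.exp (-((B:ℝ)*a/2))) (Real.exp (-(((C3:ℝ)+1)*a))) ?_ ?_ ?_ hρ ?_ ?_ ?_ x x' hl hx hx' hne
  · rw [hKc]
    have : 250/p ≤ 10 * (B:ℝ) := by
      have : 250/p = 10*(25/p) := by ring
      linarith
    refine this.trans ?_
    have e : (1:ℝ) ≤ lam * a := one_le_mul_of_one_le_of_one_le hlamR ha1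
    have := mul_le_mul_of_nonneg_left e (by positivity : (0:ℝ) ≤ 100*B)
    linarith
  · have : 0 < a := by omega
    positivity
  · linarith
  · rw [hKc]; push_cast
    have : (lam:ℝ)*B*a ≠ 0 := by positivity
    have e : (lam:ℝ)*(B*a)*(6/(100*lam*B*a)) = 6/100 := by field_simp
    rw [e]; norm_num
  · refine num_sep p a _ _ _ 0 _ _ _ C3 hp (by linarith) (by positivity) hL1 hK2 rfl (by positivity) hex ?_ hq
    linarith
  · linarith
  · refine num_sep p a _ _ _ _ _ _ _ C3 hp (by linarith) (by positivity) hL1 hK2 rfl ?_ hex ?_ hq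
    · have i1 : Real.exp (-(a:ℝ)^3) ≤ Real.exp (-(((C3:ℝ)+1)*a)) := Real.exp_le_exp.2 (by linarith)
      have i2 : Real.exp (((lam*(11*a^3) + lam*(B*a) : ℕ):ℝ) - p*((g0*a^3 : ℕ):ℝ)/2) ≤ Real.exp (-(a:ℝ)^3) := by
        apply Real.exp_le_exp.2
        push_cast
        have j1 : (B:ℝ)*a ≤ (a:ℝ)^3 := cube_ge ha1 haBR (by linarith)
        have j2 := mul_le_mul_of_nonneg_left j1 (by linarith : (0:ℝ) ≤ lam)
        have j3 : 12*(lam:ℝ)+1 ≤ p*g0/2 := by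
          have := mul_le_mul_of_nonneg_left hg0 (by positivity : 0 ≤ p/2)
          have e : p/2*(2/p*(12*(lam:ℝ)+1)) = 12*lam+1 := by field_simp
          linarith
        have j4 := mul_le_mul_of_nonneg_right j3 (by positivity : (0:ℝ) ≤ (a:ℝ)^3)
        linarith
      linarith
    · linarith

lemma core_typ (p : ℝ) (hp : 0 < p) (hp1 : p ≤ 1) (E : List Bool → List Bool → Prop) (lam B a k : ℕ)
    (hE1 : ∀ (N : ℕ) y, Eun (lam*N) (fun u => ind (E u y)) ≤ Real.exp (-N))
    (hE2 : ∀ N : ℕ, Eun (lam*N) (fun u => Etr p u (fun y => ind (¬ E u y))) ≤ Real.exp (-N))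
    (hlam : 1 ≤ lam) (hB12 : 12 ≤ B) (ha : 2 ≤ a) (h12 : 12 * (lam:ℝ) * a^3 ≤ Real.exp a)
    (hk : 1 ≤ k) (hkA : (k:ℝ) ≤ Real.exp ((a:ℝ)^3)) (w : List Bool) (N : ℕ) :
    Eun N (fun u => ind (¬ Typ p E (lam*(11*a^3)) (lam*(B*a)) (a^2) k w.length
      (Real.exp (-(a:ℝ)^3)) (Real.exp (-((B:ℝ)*a/2))) (w ++ u))) ≤ Real.exp (-(a:ℝ)^3)/2 := by
  have haR : (2:ℝ) ≤ a := by exact_mod_cast ha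
  have hBR : (12:ℝ) ≤ B := by exact_mod_cast hB12
  have hlamR : (1:ℝ) ≤ lam := by exact_mod_cast hlam
  have hA8 : (8:ℝ) ≤ (a:ℝ)^3 := by
    have := pow_le_pow_left₀ (by norm_num) haR 3
    norm_num at this; linarith
  have c1 : Real.exp (-((11*a^3 : ℕ):ℝ)) = Real.exp (-(11*(a:ℝ)^3)) := by push_cast; rfl
  have c2 : Real.exp (-((B*a : ℕ):ℝ)) = Real.exp (-((B:ℝ)*a)) := by push_cast; rfl
  have hk1 : (1:ℝ) ≤ k := by exact_mod_cast hk
  refine (typ_prob hp.le hp1 (lam*(11*a^3)) (lam*(B*a)) (a^2) k (Real.exp (-(11*(a:ℝ)^3))) (Real.exp (-((B:ℝ)*a)))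
    (Real.exp (-(a:ℝ)^3)) (Real.exp (-((B:ℝ)*a/2))) (Real.exp (-((B:ℝ)*a/3))) (Real.exp_pos _).le (Real.exp_pos _).le
    (Real.exp_pos _) (Real.exp_pos _) ?_ ?_ ?_ ?_ ?_ w N).trans ?_
  · intro y; rw [← c1]; exact hE1 _ y
  · rw [← c1]; exact hE2 _
  · intro y; rw [← c2]; exact hE1 _ y
  · rw [← c2]; exact hE2 _
  · refine eps_num a (B*a) _ haR (mul_le_mul_of_nonneg_right hBR (by linarith)) (by positivity) ?_
    refine le_trans ?_ h12
    push_cast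
    have : (1:ℝ) ≤ lam * (a:ℝ)^3 := one_le_mul_of_one_le_of_one_le hlamR (by linarith)
    linarith
  · refine typ_num ((a:ℝ)^3) k _ _ _ hA8 hk1 hkA rfl rfl (by positivity) ?_
    rw [← Real.exp_nat_mul]
    apply Real.exp_le_exp.2
    push_cast
    have := mul_le_mul_of_nonneg_right hBR (by positivity : (0:ℝ) ≤ (a:ℝ)^3)
    have e : (a:ℝ)^2 * -((B:ℝ)*a/3) = -(B*(a:ℝ)^3/3) := by ring
    rw [e]; linarith

lemma core (p : ℝ) (hp : 0 < p) (hp1 : p ≤ 1) (c'' : ℕ) : ∃ (a0 C : ℕ), 1 ≤ C ∧ ∀ a : ℕ, a0 ≤ a →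
    ∀ k N n T : ℕ, ∀ w : List Bool, 1 ≤ k → (k:ℝ) ≤ Real.exp ((a:ℝ)^3) → w.length ≤ c''*a^3 →
    w.length + N = n → Real.exp (C*a) ≤ T → ∃ F : (Fin T → List Bool) → List Bool,
    Eun N (fun u => ET p (fun r : Fin T → Fin n → Bool =>
      ind (¬ F (fun t => traceL (w++u) (keep (r t))) = (w++u).take k))) ≤ 1/k := by
  obtain ⟨lam, E, hlam, hE, hE1, hE2⟩ := test_exists p hp hp1
  obtain ⟨g0, hg0⟩ := exists_nat_ge (2/p * (12*(lam:ℝ)+1))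
  obtain ⟨B, hB⟩ := exists_nat_ge ((25/p+3) * ((c'':ℝ) + 11*lam + g0 + 1) + 12)
  have hlamR : (1:ℝ) ≤ lam := by exact_mod_cast hlam
  have hC0 : 0 ≤ 25/p+3 := by positivity
  have hX : 0 ≤ (25/p+3) * ((c'':ℝ) + 11*lam + g0) := by positivity
  have hB12 : 12 ≤ B := by
    have : (12:ℝ) ≤ B := by linarith
    exact_mod_cast this
  have hCB : 25/p+3 ≤ (B:ℝ) := by linarith
  have hCB2 : (25/p+3) * ((c'':ℝ) + 11*lam + g0) ≤ B := by linarith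
  obtain ⟨C3, hC3⟩ : ∃ C3, C3 = 300*lam*B+1 := ⟨_, rfl⟩
  obtain ⟨L0, hL0⟩ : ∃ L0, L0 = 1000*lam^2*B^2*(C3+1) := ⟨_, rfl⟩
  obtain ⟨a1, ha1⟩ := growth ((32*L0 + 64*(10000 * (lam:ℝ)^2 * B^2) + 12*lam+16)/p)
  refine ⟨a1 + C3 + 1 + B, 2*(C3+1)+1, by omega, ?_⟩
  intro a haa k N n T w hk hkA hw hn hT
  have hg := ha1 a (by omega)
  have hA0 : (0:ℝ) ≤ (a:ℝ)^3 := by positivity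
  have hg' : 32*((L0:ℝ)*a^3) + 64*(10000 * (lam:ℝ)^2 * B^2 * a^3) + 12*lam*a^3+16*a^3 ≤ p * Real.exp a := by
    have := mul_le_mul_of_nonneg_left hg hp.le
    refine le_trans (le_of_eq ?_) this
    field_simp
  have n1 : 0 ≤ 32*((L0:ℝ)*a^3) := by positivity
  have n2 : 0 ≤ 64*(10000 * (lam:ℝ)^2 * B^2 * a^3) := by positivity
  have n3 : 0 ≤ 12*(lam:ℝ)*a^3 := by positivity
  have hpe : p * Real.exp a ≤ Real.exp a := mul_le_of_le_one_left (Real.exp_pos _).le hp1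
  have haR : (2:ℝ) ≤ a := by exact_mod_cast (by omega : 2 ≤ a)
  have hA8 : (8:ℝ) ≤ (a:ℝ)^3 := by
    have := pow_le_pow_left₀ (by norm_num) haR 3
    norm_num at this; linarith
  have haA : (a:ℝ) ≤ (a:ℝ)^3 := by
    have := cube_ge (a := (a:ℝ)) (X := 1) (by linarith) (by linarith) (by norm_num)
    linarith
  have hk1 : (1:ℝ) ≤ k := by exact_mod_cast hk
  have hT0 : 0 < T := by
    have : (0:ℝ) < T := lt_of_lt_of_le (Real.exp_pos _) hT
    exact_mod_cast this
  obtain ⟨F, hF⟩ := recon (p := p) (n := n) (T := T) hp.le hp1 hT0 k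
    (Psi E (lam*(11*a^3)) (lam*(B*a)) k (L0*a^3))
    (fun x m y => stat_bit_mem _ _ _)
    (Typ p E (lam*(11*a^3)) (lam*(B*a)) (a^2) k w.length (Real.exp (-(a:ℝ)^3)) (Real.exp (-((B:ℝ)*a/2))))
    (Real.exp (-(((C3:ℝ)+1)*a))) (Real.exp_pos _).le
    (Real.exp_le_one_iff.2 (by have : (0:ℝ) ≤ ((C3:ℝ)+1)*a := by positivity
                               linarith))
    (fun x x' h h' ht ht' hne => core_sep p hp hp1 E hE lam B g0 c'' C3 L0 a k w.length hlam hB12 hCB hCB2 hg0 hC3 hL0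
      (by omega) (by omega) (by linarith) (by linarith) hw x x' (h.trans h'.symm) ht ht' hne)
  refine ⟨F, ?_⟩
  have hty := core_typ p hp hp1 E lam B a k hE1 hE2 hlam hB12 (by omega) (by linarith) hk hkA w N
  have hrn := recon_num a ((a:ℝ)^3) k (L0*a^3) T _ (C3+1) haA hA8 hk1 hkA (by positivity) (by linarith) (by linarith)
    (le_trans (le_of_eq (by push_cast; rfl)) hT) rfl
  have hcard : (Fintype.card (Fin (k+1) × Fin (L0*a^3)) : ℝ) = (k+1)*(L0*a^3) := by
    rw [Fintype.card_prod, Fintype.card_fin, Fintype.card_fin]; push_cast; ring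
  rw [hcard] at hF
  have hle : ∀ u : List Bool, u.length = N → ET p (fun r : Fin T → Fin n → Bool =>
      ind (¬ F (fun t => traceL (w++u) (keep (r t))) = (w++u).take k)) ≤
      ind (¬ Typ p E (lam*(11*a^3)) (lam*(B*a)) (a^2) k w.length
      (Real.exp (-(a:ℝ)^3)) (Real.exp (-((B:ℝ)*a/2))) (w ++ u)) + Real.exp (-(a:ℝ)^3)/2 := by
    intro u hu
    by_cases ht : Typ p E (lam*(11*a^3)) (lam*(B*a)) (a^2) k w.length
      (Real.exp (-(a:ℝ)^3)) (Real.exp (-((B:ℝ)*a/2))) (w ++ u)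
    · have := hF (w++u) (by rw [List.length_append, hu, hn]) ht
      have := ind_nonneg (¬ Typ p E (lam*(11*a^3)) (lam*(B*a)) (a^2) k w.length
        (Real.exp (-(a:ℝ)^3)) (Real.exp (-((B:ℝ)*a/2))) (w ++ u))
      linarith
    · rw [ind_true ht]
      have h := ET_mono hp.le hp1 (fun r : Fin T → Fin n → Bool =>
        ind (¬ F (fun t => traceL (w++u) (keep (r t))) = (w++u).take k)) (fun _ => 1) (fun r => ind_le_one _)
      rw [ET_const] at h
      have := Real.exp_pos (-(a:ℝ)^3)
      linarith
  refine (Eun_mono N _ _ hle).trans ?_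
  rw [Eun_add, Eun_const]
  have : Real.exp (-(a:ℝ)^3) ≤ 1/k := by
    rw [Real.exp_neg, one_div]
    exact inv_anti₀ (by linarith) hkA
  linarith

lemma prob_bridge (p : ℝ) (N n T k : ℕ) (w : List Bool) (F : (Fin T → List Bool) → List Bool) :
    prob (fun ω : (Fin N → Bool) × (Fin T → Fin n → Bool) => unif N * ∏ t, bern p (ω.2 t))
          {ω | F (fun t => traceL (w ++ List.ofFn ω.1) (keep (ω.2 t)))
              = (w ++ List.ofFn ω.1).take k} =
    1 - Eun N (fun u => ET p (fun r : Fin T → Fin n → Bool =>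
      ind (¬ F (fun t => traceL (w++u) (keep (r t))) = (w++u).take k))) := by
  have h1 : ∀ u : List Bool, ET p (fun r : Fin T → Fin n → Bool =>
      ind (¬ F (fun t => traceL (w++u) (keep (r t))) = (w++u).take k)) =
      1 + (-1) * ET p (fun r : Fin T → Fin n → Bool =>
      ind (F (fun t => traceL (w++u) (keep (r t))) = (w++u).take k)) := by
    intro u
    rw [← ET_mul]
    rw [← ET_const (p := p) (T := T) (n := n) 1, ← ET_add]
    rw [ET_const]
    congr 1; funext r; rw [ind_not]; ring
  simp only [h1]
  rw [Eun_add, Eun_const, Eun_mul_left, Eun_eq_Eb]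
  unfold prob Eb ET
  rw [Fintype.sum_prod_type]
  simp only [bern_half]
  have : ∀ a b : ℝ, a = b → a = 1 - (1 + (-1) * b) := by intro a b h; linarith
  apply this
  refine Finset.sum_congr rfl fun s _ => ?_
  rw [Finset.mul_sum]
  refine Finset.sum_congr rfl fun r _ => ?_
  by_cases h : F (fun t => traceL (w ++ List.ofFn s) (keep (r t))) = (w ++ List.ofFn s).take k
  · rw [ind_true h, Set.indicator_of_mem (by exact h)]; ring
  · rw [ind_false h, Set.indicator_of_notMem (by exact h)]; ring

/-- **Generalization of Holden–Pemantle–Peres–Zhai.**  For all `q ∈ (0,1)` and `C' ≥ 1`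
there is `C ≥ 1` such that for all `1 ≤ k ≤ n` the following holds.  Let `w` be a fixed
binary string of length at most `C'·log k` (so in particular `|w| ≤ n`), and let
`x ∈ {0,1}^n` be `w` followed by `n - |w|` uniformly random bits.  Then there is a
reconstruction function `F` taking `T := exp(C·(log k)^{1/3})` traces such that with
probability at least `1 - 1/k` over `x` and `T` independent traces of `x` through the
deletion channel with deletion probability `q`, `F` outputs the first `k` bits of `x`. -/
theorem reconstruct_prefix_of_pseudorandom_string
    (q : ℝ) (hq : q ∈ Set.Ioo (0 : ℝ) 1) (C' : ℝ) (hC' : 1 ≤ C') :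
    ∃ C : ℝ, 1 ≤ C ∧ ∀ k n : ℕ, 1 ≤ k → k ≤ n →
      ∀ w : List Bool, (w.length : ℝ) ≤ C' * Real.log k → w.length ≤ n →
      ∀ T : ℕ, T = ⌈Real.exp (C * Real.log k ^ ((1 : ℝ) / 3))⌉₊ →
      ∃ F : (Fin T → List Bool) → List Bool,
        prob (fun ω : (Fin (n - w.length) → Bool) × (Fin T → Fin n → Bool) =>
            unif (n - w.length) * ∏ t, bern (1 - q) (ω.2 t))
          {ω | F (fun t => traceL (w ++ List.ofFn ω.1) (keep (ω.2 t)))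
              = (w ++ List.ofFn ω.1).take k}
        ≥ 1 - 1 / k := by
  obtain ⟨hq0, hq1⟩ := hq
  have hp : 0 < 1 - q := by linarith
  have hp1 : 1 - q ≤ 1 := by linarith
  obtain ⟨a0, C, hC, hcore⟩ := core (1-q) hp hp1 ⌈C'⌉₊
  have hCR : (1:ℝ) ≤ C := by exact_mod_cast hC
  refine ⟨C * (2*a0+3), ?_, ?_⟩
  · have : (1:ℝ) ≤ 2*a0+3 := by
      have : (0:ℝ) ≤ a0 := by positivity
      linarith
    exact one_le_mul_of_one_le_of_one_le hCR this
  intro k n hk hkn w hw hwn T hT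
  by_cases hk1 : k = 1
  · refine ⟨fun _ => [], ?_⟩
    rw [hk1]
    have : (0:ℝ) ≤ prob (fun ω : (Fin (n - w.length) → Bool) × (Fin T → Fin n → Bool) =>
            unif (n - w.length) * ∏ t, bern (1 - q) (ω.2 t))
          {ω | (fun _ => []) (fun t => traceL (w ++ List.ofFn ω.1) (keep (ω.2 t)))
              = (w ++ List.ofFn ω.1).take 1} := by
      unfold prob
      refine Finset.sum_nonneg fun ω _ => Set.indicator_nonneg (fun ω _ => ?_) _
      refine mul_nonneg (by unfold unif; positivity) (Finset.prod_nonneg fun t _ => bern_nonneg hp.le hp1 _)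
    have e : (1:ℝ) - 1 / ((1:ℕ):ℝ) = 0 := by norm_num
    rw [e]; exact this
  have hk2 : (2:ℝ) ≤ k := by exact_mod_cast (by omega : 2 ≤ k)
  set l := Real.log k with hl
  have hl8 : 1/8 ≤ l := by
    have h := Real.log_le_log (by norm_num) hk2
    have := Real.log_two_gt_d9
    linarith
  set s := l ^ ((1:ℝ)/3) with hs
  have hs3 : s^3 = l := by
    rw [hs, ← Real.rpow_natCast, ← Real.rpow_mul (by linarith)]; norm_num
  have hs0 : 0 ≤ s := Real.rpow_nonneg (by linarith) _
  have hs2 : 1/2 ≤ s := by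
    by_contra h
    push Not at h
    have := pow_lt_pow_left₀ h hs0 (by norm_num : 3 ≠ 0)
    rw [hs3] at this; norm_num at this; linarith
  have hsa : s ≤ (max a0 ⌈s⌉₊ : ℕ) := (Nat.le_ceil s).trans (by exact_mod_cast le_max_right _ _)
  have haub : ((max a0 ⌈s⌉₊ : ℕ):ℝ) ≤ (2*a0+3)*s := by
    have h1 : (max a0 ⌈s⌉₊ : ℕ) ≤ a0 + ⌈s⌉₊ := by omega
    have h2 : ((max a0 ⌈s⌉₊ : ℕ):ℝ) ≤ a0 + ⌈s⌉₊ := by exact_mod_cast h1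
    have h3 := Nat.ceil_lt_add_one hs0
    have h4 := mul_le_mul_of_nonneg_left hs2 (by positivity : (0:ℝ) ≤ 2*a0)
    linarith
  set a := max a0 ⌈s⌉₊ with ha
  have hla : l ≤ (a:ℝ)^3 := by rw [← hs3]; exact pow_le_pow_left₀ hs0 hsa 3
  have g1 : (k:ℝ) ≤ Real.exp ((a:ℝ)^3) := by
    rw [← Real.log_le_iff_le_exp (by linarith)]; exact hla
  have g2 : w.length ≤ ⌈C'⌉₊ * a^3 := by
    have : (w.length:ℝ) ≤ ⌈C'⌉₊ * (a:ℝ)^3 := by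
      refine hw.trans (mul_le_mul (Nat.le_ceil _) hla (by linarith) (by positivity))
    exact_mod_cast this
  have g3 : Real.exp (C*a) ≤ T := by
    rw [hT]
    refine le_trans (Real.exp_le_exp.2 ?_) (Nat.le_ceil _)
    rw [mul_assoc]
    exact mul_le_mul_of_nonneg_left haub (by linarith)
  obtain ⟨F, hF⟩ := hcore a (le_max_left _ _) k (n - w.length) n T w hk g1 g2 (by omega) g3
  refine ⟨F, ?_⟩
  rw [prob_bridge]
  linarith
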